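/- Let ψ be an irreducible 𝕂-linear representation of a finite p-group G. Then there exists a subquotient H/K of G such that H/K is a Roquette p-group and ψ is tightly induced from a faithful 𝕂(H/K)-irrep φ. For any such subquotient H/K, the faithful 𝕂(H/K)-irrep φ from which ψ is tightly induced is unique up to isomorphism. Moreover, if H'/K' is another subquotient of G such that H'/K' is Roquette and ψ is tightly induced from a faithful 𝕂(H'/K')-irrep, then H/K and H'/K' are isomorphic as groups. -/

import Mathlib

open scoped Classical

noncomputable section

namespace Genotype

variable {k : Type} [Field k] {G : Type} [Group G]

/-- The subfield generated (over the prime field `ℚ`) by the values of a function,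
e.g. the field `ℚ[ψ]` generated by the values of a character. -/
def charField {X : Type} {k : Type} [Field k] (f : X → k) : Subfield k :=
  Subfield.closure (Set.range f)

theorem mem_charField {X : Type} {k : Type} [Field k] (f : X → k) (x : X) :
    f x ∈ charField f :=
  Subfield.subset_closure ⟨x, rfl⟩

/-- Two functions (typically characters of irreps over possibly different
characteristic-zero fields) are Galois conjugate: there is a Galois extension `M` of `ℚ`
containing (copies of) all their values and a field automorphism `α` of `M` with
`α (f g) = f' g` for all `g`. -/
def IsGaloisConj {k l : Type} [Field k] [Field l] {G : Type}
    (f : G → k) (f' : G → l) : Prop :=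
  ∃ (M : Type) (_ : Field M) (_ : Algebra ℚ M), IsGalois ℚ M ∧
    ∃ (i : charField f →+* M) (j : charField f' →+* M) (α : M ≃+* M),
      ∀ g : G, α (i ⟨f g, mem_charField f g⟩) = j ⟨f' g, mem_charField f' g⟩

/-- Irreducibility of a finite-dimensional representation. -/
def IsIrr (V : FDRep k G) : Prop :=
  Nontrivial V ∧
    ∀ U : Submodule k V, (∀ g : G, ∀ x ∈ U, V.ρ g x ∈ U) → U = ⊥ ∨ U = ⊤

/-- Faithfulness of a representation. -/
def IsFaithfulRep (V : FDRep k G) : Prop := Function.Injective V.ρ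

/-- `f` (the character of an irrep) occurs in the character `c`,
i.e. `c = f + (character of some representation)`. -/
def CharOccurs (f c : G → k) : Prop :=
  ∃ W : FDRep k G, c = f + W.character

/-- `f` (the character of an irrep) occurs in `c` with multiplicity exactly `m`. -/
def CharMult (f c : G → k) (m : ℕ) : Prop :=
  ∃ W : FDRep k G, c = m • f + W.character ∧ ¬ CharOccurs f W.character

/-- `f` is the character of an irreducible representation. -/
def IsIrrChar (f : G → k) : Prop := ∃ V : FDRep k G, IsIrr V ∧ f = V.character

/-- Restriction of a character to a subgroup. -/
def resChar (H : Subgroup G) (c : G → k) : H → k := fun h => c h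

/-- The induced character `ind_H^G f`. -/
def indChar (H : Subgroup G) (f : H → k) : G → k := fun g =>
  (Nat.card H : k)⁻¹ *
    ∑ᶠ x : G, if h : x⁻¹ * g * x ∈ H then f ⟨x⁻¹ * g * x, h⟩ else 0

/-- The character `cψ` (of a `kG`-irrep) is tightly induced from the character `cφ`
(of a `kH`-irrep): `cψ` is the induced character of `cφ`, `cφ` occurs with multiplicity
exactly `1` in the restriction of `cψ`, and no Galois conjugate of `cφ` other than `cφ`
itself occurs in the restriction of `cψ`. -/
def TightInd (H : Subgroup G) (cψ : G → k) (cφ : H → k) : Prop :=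
  cψ = indChar H cφ ∧ CharMult cφ (resChar H cψ) 1 ∧
    ∀ cφ' : H → k, IsIrrChar cφ' → IsGaloisConj cφ cφ' →
      CharOccurs cφ' (resChar H cψ) → cφ' = cφ

/-- Tight induction from a subquotient `H/K` of `G`: tight induction from `H`
of the inflation. -/
def TightIndSub (H : Subgroup G) (K : Subgroup H) [K.Normal]
    (cψ : G → k) (cφ : (H ⧸ K) → k) : Prop :=
  TightInd H cψ (fun h => cφ (QuotientGroup.mk h))

/-- A group is Roquette if every normal abelian subgroup of it is cyclic. -/
def IsRoquette (P : Type) [Group P] : Prop :=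
  ∀ A : Subgroup P, A.Normal → (∀ x ∈ A, ∀ y ∈ A, x * y = y * x) → IsCyclic A

/-- `χ` is the rational form `ψ_ℚ` of `V`: a rational irrep such that `V` occurs in the
scalar extension `k ⊗_ℚ χ`. -/
def IsRatForm [CharZero k] (χ : FDRep ℚ G) (V : FDRep k G) : Prop :=
  IsIrr χ ∧ CharOccurs V.character (fun g => algebraMap ℚ k (χ.character g))

/-- Irreps over possibly different characteristic-zero fields are quasiconjugate if they
determine the same rational irrep. -/
def Quasiconj {k l : Type} [Field k] [Field l] [CharZero k] [CharZero l] {G : Type} [Group G]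
    (V : FDRep k G) (W : FDRep l G) : Prop :=
  ∃ χ : FDRep ℚ G, IsRatForm χ V ∧ IsRatForm χ W

end Genotype


namespace Genotype

/-- A nontrivial normal subgroup of a finite `p`-group contains a nontrivial central element. -/
theorem exists_central_mem {p : ℕ} (hp : p.Prime) {Q : Type} [Group Q] [Finite Q]
    (hQ : IsPGroup p Q) (N : Subgroup Q) (hN : N.Normal) (hne : N ≠ ⊥) :
    ∃ z ∈ N, z ≠ 1 ∧ ∀ g : Q, g * z = z * g := by
  have : Fact p.Prime := ⟨hp⟩
  have := hN
  have hnt : Nontrivial N := (Subgroup.nontrivial_iff_ne_bot N).2 hne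
  have h1 := (hQ.of_equiv ConjAct.toConjAct).exists_fixed_point_of_prime_dvd_card_of_fixed_point
    (α := N)
  have dvd : p ∣ Nat.card N := by
    obtain ⟨n, hn0, hn⟩ := (hQ.to_subgroup N).nontrivial_iff_card.mp inferInstance
    exact hn.symm ▸ dvd_pow_self _ (ne_of_gt hn0)
  obtain ⟨b, hb, hb1⟩ := h1 dvd (a := 1) (by
    rw [MulAction.mem_fixedPoints]; intro g; exact smul_one g)
  refine ⟨b, b.2, fun h => hb1 (Subtype.ext h.symm), fun g => ?_⟩
  have h2 := congrArg (Subtype.val) (hb (ConjAct.toConjAct g))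
  have h3 : g * (b : Q) * g⁻¹ = b := by
    rw [ConjAct.Subgroup.val_conj_smul, ConjAct.toConjAct_smul] at h2; exact h2
  calc g * (b:Q) = (g * b * g⁻¹) * g := by group
    _ = b * g := by rw [h3]

/-- A finite `p`-group has a normal abelian self-centralizing subgroup. -/
theorem exists_selfcentralizing {p : ℕ} (hp : p.Prime) {R : Type} [Group R] [Finite R]
    (hR : IsPGroup p R) :
    ∃ A : Subgroup R, A.Normal ∧ (∀ x ∈ A, ∀ y ∈ A, x * y = y * x) ∧
      ∀ g : R, (∀ x ∈ A, g * x = x * g) → g ∈ A := by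
  obtain ⟨A, hA⟩ := (Set.toFinite {A : Subgroup R | A.Normal ∧
    (∀ x ∈ A, ∀ y ∈ A, x * y = y * x)}).exists_maximal ⟨⊥, inferInstance, by
      intro x hx y hy
      rw [Subgroup.mem_bot] at hx hy; simp [hx, hy]⟩
  obtain ⟨hAn, hAc⟩ := hA.1
  refine ⟨A, hAn, hAc, ?_⟩
  by_contra! hcon
  obtain ⟨g₀, hg₀, hg₀A⟩ := hcon
  have := hAn
  have hCn : ((Subgroup.centralizer (A : Set R)).map (QuotientGroup.mk' A)).Normal :=
    Subgroup.Normal.map inferInstance _ (QuotientGroup.mk'_surjective A)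
  obtain ⟨z, hz, hz1, hzc⟩ := exists_central_mem hp (hR.to_quotient A)
    ((Subgroup.centralizer (A : Set R)).map (QuotientGroup.mk' A)) hCn (by
      intro h
      have : QuotientGroup.mk' A g₀ ∈ ((Subgroup.centralizer (A : Set R)).map
          (QuotientGroup.mk' A)) :=
        Subgroup.mem_map_of_mem _ (by
          rw [Subgroup.mem_centralizer_iff]; intro x hx; exact (hg₀ x hx).symm)
      rw [h, Subgroup.mem_bot] at this
      exact hg₀A ((QuotientGroup.eq_one_iff g₀).1 this))
  obtain ⟨g, hg, rfl⟩ := hz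
  have hgA : g ∉ A := fun h => hz1 ((QuotientGroup.eq_one_iff g).2 h)
  have hgc : ∀ x ∈ A, g * x = x * g := fun x hx =>
    ((Subgroup.mem_centralizer_iff.1 hg) x hx).symm
  have hconj : ∀ r : R, ∃ c ∈ A, r * g * r⁻¹ = c * g := by
    intro r
    refine ⟨r * g * r⁻¹ * g⁻¹, ?_, by group⟩
    rw [← QuotientGroup.eq_one_iff]
    have h := hzc (QuotientGroup.mk' A r)
    simp only [QuotientGroup.mk'_apply] at h
    rw [QuotientGroup.mk_mul, QuotientGroup.mk_mul, QuotientGroup.mk_mul, h]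
    simp
  let B : Subgroup R := A ⊔ Subgroup.zpowers g
  have hB : ∀ b ∈ B, ∃ c ∈ A, ∃ i : ℤ, b = c * g ^ i := by
    intro b hb
    obtain ⟨c, hc, d, hd, rfl⟩ := Subgroup.mem_sup_of_normal_left.1 hb
    obtain ⟨i, rfl⟩ := Subgroup.mem_zpowers_iff.1 hd
    exact ⟨c, hc, i, rfl⟩
  have hgz : ∀ (i : ℤ), ∀ x ∈ A, g ^ i * x = x * g ^ i := fun i x hx =>
    (Commute.zpow_left (hgc x hx) i)
  have hBle : B ≤ A := hA.2 ⟨⟨by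
      intro b hb r
      obtain ⟨c, hc, i, rfl⟩ := hB b hb
      obtain ⟨d, hd, hd2⟩ := hconj r
      have : r * (c * g ^ i) * r⁻¹ = (r * c * r⁻¹) * (r * g * r⁻¹) ^ i := by
        rw [conj_zpow]; group
      rw [this, hd2]
      refine B.mul_mem ((le_sup_left : A ≤ B) (hAn.conj_mem c hc r)) (B.zpow_mem ?_ i)
      exact B.mul_mem ((le_sup_left : A ≤ B) hd)
        ((le_sup_right : _ ≤ B) (Subgroup.mem_zpowers g))⟩, by
      intro x hx y hy
      obtain ⟨c, hc, i, rfl⟩ := hB x hx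
      obtain ⟨d, hd, j, rfl⟩ := hB y hy
      calc c * g ^ i * (d * g ^ j) = c * (g ^ i * d) * g ^ j := by group
        _ = (c * d) * (g ^ i * g ^ j) := by rw [hgz i d hd]; group
        _ = (d * c) * (g ^ j * g ^ i) := by rw [hAc c hc d hd, ← zpow_add, ← zpow_add, add_comm]
        _ = d * (c * g ^ j) * g ^ i := by group
        _ = d * g ^ j * (c * g ^ i) := by rw [← hgz j c hc]; group⟩ le_sup_left
  exact hgA (hBle ((le_sup_right : _ ≤ B) (Subgroup.mem_zpowers g)))

/-- If `z`, `y` commute, have order dividing `p`, generate a normal subgroup of the Roquette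
group, `z ≠ 1`, then `y` is a power of `z`. -/
theorem roquette_excl {p : ℕ} (hp : p.Prime) {R : Type} [Group R] [Finite R]
    (hRoq : IsRoquette R) (z y : R) (hz1 : z ≠ 1) (hzp : z ^ p = 1) (hyp : y ^ p = 1)
    (hzy : z * y = y * z) (hz : ∀ r : R, r * z * r⁻¹ ∈ Subgroup.zpowers z)
    (hy : ∀ r : R, ∃ c ∈ Subgroup.zpowers z, r * y * r⁻¹ = c * y) :
    y ∈ Subgroup.zpowers z := by
  have : Fact p.Prime := ⟨hp⟩
  have hform : ∀ (b : R), b ∈ Subgroup.closure {z, y} ↔ ∃ i j : ℤ, b = z ^ i * y ^ j := by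
    intro b
    have hc : ∀ i j : ℤ, y ^ j * z ^ i = z ^ i * y ^ j := fun i j =>
      ((Commute.zpow_zpow (show Commute z y from hzy) i j)).symm.eq
    constructor
    · intro hb
      induction hb using Subgroup.closure_induction with
      | mem x hx =>
        rcases hx with rfl | rfl
        · exact ⟨1, 0, by simp⟩
        · exact ⟨0, 1, by simp⟩
      | one => exact ⟨0, 0, by simp⟩
      | mul u v _ _ hu hv =>
        obtain ⟨i, j, rfl⟩ := hu
        obtain ⟨i', j', rfl⟩ := hv
        refine ⟨i + i', j + j', ?_⟩
        rw [zpow_add, zpow_add]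
        calc z ^ i * y ^ j * (z ^ i' * y ^ j') = z ^ i * (y ^ j * z ^ i') * y ^ j' := by group
          _ = _ := by rw [hc]; group
      | inv u _ hu =>
        obtain ⟨i, j, rfl⟩ := hu
        exact ⟨-i, -j, by rw [mul_inv_rev, ← zpow_neg, ← zpow_neg, hc]⟩
    · rintro ⟨i, j, rfl⟩
      exact Subgroup.mul_mem _ (Subgroup.zpow_mem _ (Subgroup.subset_closure (by simp)) _)
        (Subgroup.zpow_mem _ (Subgroup.subset_closure (by simp)) _)
  have hcyc : IsCyclic (Subgroup.closure {z, y}) := by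
    apply hRoq
    · constructor
      intro b hb r
      obtain ⟨i, j, rfl⟩ := (hform b).1 hb
      have : r * (z ^ i * y ^ j) * r⁻¹ = (r * z * r⁻¹) ^ i * (r * y * r⁻¹) ^ j := by
        rw [conj_zpow, conj_zpow]; group
      rw [this]
      obtain ⟨c, hc, hc'⟩ := hy r
      have hle : Subgroup.zpowers z ≤ Subgroup.closure {z, y} := by
        rw [Subgroup.zpowers_le]; exact Subgroup.subset_closure (by simp)
      rw [hc']
      exact Subgroup.mul_mem _ (Subgroup.zpow_mem _ (hle (hz r)) _)
        (Subgroup.zpow_mem _ (Subgroup.mul_mem _ (hle hc) (Subgroup.subset_closure (by simp))) _)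
    · intro x hx x' hx'
      obtain ⟨i, j, rfl⟩ := (hform x).1 hx
      obtain ⟨i', j', rfl⟩ := (hform x').1 hx'
      have h1 : Commute z y := hzy
      exact (((Commute.refl z).zpow_zpow i i').mul_right (h1.zpow_zpow i j')).mul_left
        ((h1.symm.zpow_zpow j i').mul_right ((Commute.refl y).zpow_zpow j j'))
  obtain ⟨w, hw⟩ := hcyc.exists_generator
  have hwp : (w : R) ^ p = 1 := by
    obtain ⟨i, j, hij⟩ := (hform w).1 w.2
    have h1 : Commute z y := hzy
    rw [hij, (h1.zpow_zpow i j).mul_pow, ← zpow_natCast, ← zpow_natCast, ← zpow_mul, ← zpow_mul,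
      mul_comm i, mul_comm j, zpow_mul, zpow_mul, zpow_natCast, zpow_natCast, hzp, hyp]
    simp
  have hzo : orderOf z = p := orderOf_eq_prime hzp hz1
  have hwz : ∀ u ∈ Subgroup.closure {z, y}, u ∈ Subgroup.zpowers (w : R) := by
    intro u hu
    obtain ⟨i, hi⟩ := Subgroup.mem_zpowers_iff.1 (hw ⟨u, hu⟩)
    exact Subgroup.mem_zpowers_iff.2 ⟨i, by simpa using congrArg Subtype.val hi⟩
  have hz' := hwz z (Subgroup.subset_closure (by simp))
  have hwo : orderOf (w : R) ∣ p := orderOf_dvd_of_pow_eq_one hwp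
  have heq : Subgroup.zpowers z = Subgroup.zpowers (w : R) := by
    apply Subgroup.eq_of_le_of_card_ge
    · rwa [Subgroup.zpowers_le]
    · rw [Nat.card_zpowers, Nat.card_zpowers, hzo]
      exact Nat.le_of_dvd hp.pos hwo
  rw [heq]
  exact hwz y (Subgroup.subset_closure (by simp))

end Genotype

namespace Genotype

theorem conj_pow_form {R : Type} [Group R] (a y z : R) (t : ℕ)
    (hy : y * a * y⁻¹ = a * z ^ t) (haz : a * z = z * a) (hyz : y * z = z * y) (i n : ℕ) :
    (a ^ i * y) ^ n = a ^ (i * n) * z ^ (t * i * n.choose 2) * y ^ n := by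
  have haz' : Commute a z := haz
  have hyz' : Commute y z := hyz
  have h1 : ∀ i : ℕ, y * a ^ i = a ^ i * z ^ (t * i) * y := by
    intro i
    have : y * a ^ i * y⁻¹ = (y * a * y⁻¹) ^ i := by rw [conj_pow]
    rw [hy, (haz'.pow_right t).mul_pow, ← pow_mul] at this
    rw [← this]; group
  have h2 : ∀ n i : ℕ, y ^ n * a ^ i = a ^ i * z ^ (t * i * n) * y ^ n := by
    intro n i
    induction n with
    | zero => simp
    | succ n ih =>
      rw [pow_succ', mul_assoc, ih]
      calc y * (a ^ i * z ^ (t * i * n) * y ^ n) = (y * a ^ i) * z ^ (t * i * n) * y ^ n := by group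
        _ = a ^ i * z ^ (t * i) * (y * z ^ (t * i * n)) * y ^ n := by rw [h1]; group
        _ = a ^ i * (z ^ (t * i) * z ^ (t * i * n)) * (y * y ^ n) := by
            rw [(hyz'.pow_right _).eq]; group
        _ = _ := by rw [← pow_add, ← pow_succ']; congr 3; ring
  induction n with
  | zero => simp
  | succ n ih =>
    rw [pow_succ, ih]
    have hz2 : z ^ (t * i * n.choose 2) * a ^ i = a ^ i * z ^ (t * i * n.choose 2) :=
      (haz'.pow_pow _ _).symm.eq
    calc a ^ (i * n) * z ^ (t * i * n.choose 2) * y ^ n * (a ^ i * y)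
        = a ^ (i * n) * z ^ (t * i * n.choose 2) * (y ^ n * a ^ i) * y := by group
      _ = a ^ (i * n) * (z ^ (t * i * n.choose 2) * a ^ i) * z ^ (t * i * n) * (y ^ n * y) := by
          rw [h2]; group
      _ = (a ^ (i * n) * a ^ i) * (z ^ (t * i * n.choose 2) * z ^ (t * i * n)) * (y ^ n * y) := by
          rw [hz2]; group
      _ = _ := by
          rw [← pow_add, ← pow_add, ← pow_succ, Nat.choose_succ_succ' n 1, Nat.choose_one_right]
          congr 3; ring

theorem roquette_no_mod {p : ℕ} (hp : p.Prime) {R : Type} [Group R] [Finite R]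
    (hRoq : IsRoquette R) (a : R) (n : ℕ) (hn : 1 ≤ n) (hao : orderOf a = p ^ (n + 1))
    (hpn : p ≠ 2 ∨ 2 ≤ n)
    (hnorm : ∀ r : R, ∃ s : ℕ, r * a * r⁻¹ = a ^ s)
    (hcomm : ∀ r g : R, ∃ i : ℕ, r * g * r⁻¹ = a ^ i * g)
    (g : R) (hgA : g ∉ Subgroup.zpowers a) (hgp : ∃ j : ℕ, g ^ p = a ^ j) (t : ℕ)
    (hg : g * a * g⁻¹ = a * (a ^ p ^ n) ^ t) (hgt : ¬ p ∣ t) : False := by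
  set z := a ^ p ^ n with hz
  have hzo : orderOf z = p := by
    rw [hz, orderOf_pow' _ (pow_pos hp.pos n).ne', hao]
    rw [Nat.gcd_eq_right (pow_dvd_pow p (Nat.le_succ n)), pow_succ,
      Nat.mul_div_cancel_left _ (pow_pos hp.pos n)]
  have hz1 : z ≠ 1 := by
    intro h; rw [h, orderOf_one] at hzo; exact hp.one_lt.ne hzo
  have hzp : z ^ p = 1 := by rw [← hzo]; exact pow_orderOf_eq_one z
  have haz : a * z = z * a := (Commute.self_pow a _).eq
  -- conj by element acting this way
  have hzc : ∀ y : R, y * a * y⁻¹ = a * z ^ t → y * z = z * y := by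
    intro y hy
    have : y * z * y⁻¹ = z := by
      rw [hz, ← conj_pow, hy, ((show Commute a z from haz).pow_right t).mul_pow, ← pow_mul]
      obtain ⟨n', rfl⟩ : ∃ n', n = n' + 1 := ⟨n - 1, by omega⟩
      rw [show t * p ^ (n' + 1) = p * (t * p ^ n') by ring, pow_mul, hzp, one_pow, mul_one]
    calc y * z = (y * z * y⁻¹) * y := by group
      _ = z * y := by rw [this]
  obtain ⟨q, hq, hpq⟩ : ∃ q, p ^ n * p.choose 2 = p * q ∧ p ∣ q := by
    obtain ⟨n', rfl⟩ : ∃ n', n = n' + 1 := ⟨n - 1, by omega⟩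
    rcases hpn with h2 | h2
    · refine ⟨p ^ n' * p.choose 2, by ring, Dvd.dvd.mul_left ?_ _⟩
      exact hp.dvd_choose_self (by norm_num) (lt_of_le_of_ne hp.two_le (Ne.symm h2))
    · refine ⟨p ^ n' * p.choose 2, by ring, Dvd.dvd.mul_right ?_ _⟩
      exact dvd_pow_self p (by omega)
  have hform : ∀ y : R, y * a * y⁻¹ = a * z ^ t → ∀ i : ℕ,
      (a ^ i * y) ^ p = a ^ (p * (i * (1 + t * q))) * y ^ p := by
    intro y hy i
    rw [conj_pow_form a y z t hy haz (hzc y hy), hz, ← pow_mul a (p ^ n), ← pow_add]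
    congr 2
    calc i * p + p ^ n * (t * i * p.choose 2) = i * p + (p ^ n * p.choose 2) * (t * i) := by ring
      _ = _ := by rw [hq]; ring
  have hcop : Nat.Coprime (1 + t * q) (p ^ n) := by
    apply Nat.Coprime.pow_right
    obtain ⟨q', rfl⟩ := hpq
    rw [show 1 + t * (p * q') = 1 + (t * q') * p by ring]
    simp
  -- p divides j
  obtain ⟨j, hj⟩ := hgp
  have hpj : p ∣ j := by
    have h1 : g * a ^ j * g⁻¹ = a ^ j := by rw [← hj]; group
    rw [← conj_pow, hg, ((show Commute a z from haz).pow_right t).mul_pow, ← pow_mul] at h1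
    have h2 : z ^ (t * j) = 1 := by simpa using h1
    have h3 := orderOf_dvd_of_pow_eq_one h2
    rw [hzo] at h3
    exact (hp.dvd_mul.1 h3).resolve_left hgt
  obtain ⟨l, rfl⟩ := hpj
  have hpn1 : 1 < p ^ n := Nat.one_lt_pow (by omega) hp.one_lt
  obtain ⟨v, -, hv⟩ := Nat.exists_mul_mod_eq_one_of_coprime hcop hpn1
  obtain ⟨i, hi⟩ : ∃ i, p ^ n ∣ i * (1 + t * q) + l := by
    refine ⟨v * (l * (p ^ n - 1)), ?_⟩
    have h1 : (1 + t * q) * v ≡ 1 [MOD p ^ n] := by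
      unfold Nat.ModEq; rw [hv, Nat.mod_eq_of_lt hpn1]
    have h2 : v * (l * (p ^ n - 1)) * (1 + t * q) + l ≡ 1 * (l * (p ^ n - 1)) + l [MOD p ^ n] := by
      apply Nat.ModEq.add_right
      have := h1.mul_right (l * (p ^ n - 1))
      convert this using 1; ring
    rw [← Nat.modEq_zero_iff_dvd]
    refine h2.trans ?_
    rw [Nat.modEq_zero_iff_dvd]
    refine ⟨l, ?_⟩
    obtain ⟨w, hw⟩ : ∃ w, p ^ n = w + 1 := ⟨p ^ n - 1, by omega⟩
    rw [hw]; simp; ring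
  set y := a ^ i * g with hy
  have hyp : y ^ p = 1 := by
    rw [hy, hform g hg, hj, ← pow_add]
    rw [← orderOf_dvd_iff_pow_eq_one, hao, pow_succ', ← mul_add]
    exact mul_dvd_mul_left p hi
  have hya : y * a * y⁻¹ = a * z ^ t := by
    rw [hy]
    calc a ^ i * g * a * (a ^ i * g)⁻¹ = a ^ i * (g * a * g⁻¹) * (a ^ i)⁻¹ := by group
      _ = a ^ i * (a * z ^ t) * (a ^ i)⁻¹ := by rw [hg]
      _ = (a * z ^ t) * a ^ i * (a ^ i)⁻¹ := by
        congr 1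
        exact ((Commute.pow_self a i).mul_right (((show Commute a z from haz).pow_pow i t))).eq
      _ = a * z ^ t := by group
  have hyA : y ∉ Subgroup.zpowers a := by
    intro h
    apply hgA
    have : g = (a ^ i)⁻¹ * y := by rw [hy]; group
    rw [this]
    exact Subgroup.mul_mem _ (Subgroup.inv_mem _ (Subgroup.npow_mem_zpowers a i)) h
  have := roquette_excl hp hRoq z y hz1 hzp hyp (hzc y hya).symm (by
      intro r
      obtain ⟨s, hs⟩ := hnorm r
      rw [hz, ← conj_pow, hs, ← pow_mul, mul_comm, pow_mul]
      exact Subgroup.npow_mem_zpowers _ _) (by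
      intro r
      obtain ⟨i, hi⟩ := hcomm r y
      refine ⟨a ^ i, ?_, hi⟩
      have h1 : (r * y * r⁻¹) ^ p = 1 := by rw [conj_pow, hyp]; group
      rw [hi, hform y hya, hyp, mul_one, ← orderOf_dvd_iff_pow_eq_one, hao, pow_succ'] at h1
      have h2 := Nat.dvd_of_mul_dvd_mul_left hp.pos h1
      obtain ⟨w, rfl⟩ := (hcop.symm.dvd_of_dvd_mul_right h2)
      rw [pow_mul]
      exact Subgroup.npow_mem_zpowers _ _)
  apply hyA
  have hle : Subgroup.zpowers z ≤ Subgroup.zpowers a := by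
    rw [Subgroup.zpowers_le]; exact Subgroup.npow_mem_zpowers _ _
  exact hle this

end Genotype

namespace Genotype

/-- `R` is generated by a cyclic subgroup `⟨a⟩` of index two and order `N`, with
`x a x⁻¹ = a ^ s` and `x ^ 2 = a ^ t`. -/
def TwoGen {R : Type} [Group R] (N s t : ℕ) (a x : R) : Prop :=
  orderOf a = N ∧ x ∉ Subgroup.zpowers a ∧
    (∀ g : R, g ∈ Subgroup.zpowers a ∨ g * x⁻¹ ∈ Subgroup.zpowers a) ∧
    x * a * x⁻¹ = a ^ s ∧ x ^ 2 = a ^ t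

/-- the three possible parameter triples -/
def TwoPar (m s t : ℕ) : Prop :=
  2 ≤ m ∧ ((s = 2 ^ m - 1 ∧ t = 0 ∧ 3 ≤ m) ∨ (s = 2 ^ m - 1 ∧ t = 2 ^ (m - 1)) ∨
    (s = 2 ^ (m - 1) - 1 ∧ t = 0 ∧ 3 ≤ m))

theorem nt_odd {p : ℕ} (hp : p.Prime) (h2 : p ≠ 2) (m s : ℕ)
    (h : s ^ (p : ℕ) ≡ 1 [MOD p ^ (m + 1)]) (hs : 1 ≤ s) : p ^ (m + 1) ∣ p * (s - 1) ∧ p ∣ s - 1 := by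
  have : Fact p.Prime := ⟨hp⟩
  have h1 : (p : ℤ) ∣ (s : ℤ) - 1 := by
    have h3 : s ^ p ≡ 1 [MOD p] := h.of_dvd (dvd_pow_self p (by omega))
    have h4 := (ZMod.natCast_eq_natCast_iff _ _ _).2 h3
    push_cast at h4
    rw [ZMod.pow_card] at h4
    rw [← ZMod.intCast_zmod_eq_zero_iff_dvd]
    push_cast; rw [h4]; simp
  have hodd : Odd p := hp.odd_of_ne_two h2
  have hns : ¬ (p : ℤ) ∣ (s : ℤ) := by
    intro h5
    have : (p : ℤ) ∣ 1 := by
      have := dvd_sub h5 h1; simpa using this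
    have := Int.natCast_dvd_natCast.1 (by exact_mod_cast this : (p : ℤ) ∣ ((1 : ℕ) : ℤ))
    exact hp.one_lt.ne' (Nat.dvd_one.1 this)
  have h6 := Int.emultiplicity_pow_sub_pow hp hodd (x := s) (y := 1) (by simpa using h1) hns p
  have h7 : (p : ℤ) ^ (m + 1) ∣ (s : ℤ) ^ p - 1 ^ p := by
    have := (Nat.modEq_iff_dvd.1 h.symm)
    push_cast at this
    simpa using this
  have h8 : (p : ℤ) ∣ (p : ℤ) := dvd_rfl
  have h9 : ((m + 1 : ℕ) : ℕ∞) ≤ emultiplicity (p : ℤ) ((p : ℤ) * ((s : ℤ) - 1)) := by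
    rw [emultiplicity_mul (Nat.prime_iff_prime_int.1 hp), add_comm (emultiplicity (p : ℤ) (p : ℤ))]
    have := le_emultiplicity_of_pow_dvd h7
    rw [h6] at this
    rwa [← Int.natCast_emultiplicity] at this
  have h10 := pow_dvd_of_le_emultiplicity h9
  constructor
  · zify [hs]; simpa using h10
  · zify [hs]; simpa using h1

theorem nt_two (m s : ℕ) (hm : 2 ≤ m) (h : s ^ 2 ≡ 1 [MOD 2 ^ m]) :
    2 ^ (m - 1) ∣ s - 1 ∧ s % 4 = 1 ∨ 2 ^ (m - 1) ∣ s + 1 ∧ s % 4 = 3 := by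
  have h4 : s ^ 2 ≡ 1 [MOD 4] := h.of_dvd (by
    have := pow_dvd_pow 2 hm
    norm_num at this
    exact this)
  have hodd : s % 4 = 1 ∨ s % 4 = 3 := by
    have : s % 4 < 4 := Nat.mod_lt _ (by norm_num)
    have h5 : (s % 4) ^ 2 % 4 = 1 := by
      have := h4; unfold Nat.ModEq at this; rw [Nat.pow_mod] at this; simpa using this
    interval_cases hs : s % 4 <;> simp_all
  have hd : (2 : ℤ) ^ m ∣ ((s : ℤ) - 1) * (s + 1) := by
    have := (Nat.modEq_iff_dvd.1 h.symm)
    push_cast at this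
    convert this using 1; ring
  obtain ⟨n, rfl⟩ : ∃ n, m = n + 1 := ⟨m - 1, by omega⟩
  have hs : 1 ≤ s := by omega
  rcases hodd with h1 | h3
  · left
    refine ⟨?_, h1⟩
    obtain ⟨w, hw⟩ : ∃ w : ℤ, (s : ℤ) + 1 = 2 * (2 * w + 1) := ⟨(s : ℤ) / 4, by omega⟩
    rw [hw, show ((s : ℤ) - 1) * (2 * (2 * w + 1)) = 2 * (((s : ℤ) - 1) * (2 * w + 1)) by ring,
      pow_succ', mul_dvd_mul_iff_left (by norm_num)] at hd
    have hc : IsCoprime ((2 : ℤ) ^ n) (2 * w + 1) := by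
      apply IsCoprime.pow_left; exact ⟨-w, 1, by ring⟩
    have := hc.dvd_of_dvd_mul_right hd
    simp only [Nat.add_sub_cancel]
    zify [hs]; exact this
  · right
    refine ⟨?_, h3⟩
    obtain ⟨w, hw⟩ : ∃ w : ℤ, (s : ℤ) - 1 = 2 * (2 * w + 1) := ⟨(s : ℤ) / 4, by omega⟩
    rw [hw, mul_assoc,
      pow_succ', mul_dvd_mul_iff_left (by norm_num)] at hd
    have hc : IsCoprime ((2 : ℤ) ^ n) (2 * w + 1) := by
      apply IsCoprime.pow_left; exact ⟨-w, 1, by ring⟩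
    have := hc.dvd_of_dvd_mul_left hd
    simp only [Nat.add_sub_cancel]
    zify; exact this

theorem mem_zpowers_nat {R : Type} [Group R] [Finite R] {a g : R}
    (h : g ∈ Subgroup.zpowers a) : ∃ i : ℕ, g = a ^ i := by
  rw [← mem_powers_iff_mem_zpowers] at h
  obtain ⟨i, hi⟩ := h
  exact ⟨i, hi.symm⟩

theorem exists_pow_edge {p : ℕ} {R : Type} [Group R] [Finite R] (hR : IsPGroup p R)
    (A : Subgroup R) (g : R) (hg : g ∉ A) :
    ∃ e : ℕ, g ^ p ^ e ∉ A ∧ g ^ p ^ (e + 1) ∈ A := by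
  by_contra! hcon
  have : ∀ e : ℕ, g ^ p ^ e ∉ A := by
    intro e
    induction e with
    | zero => simpa using hg
    | succ e ih => exact hcon e ih
  obtain ⟨k, hk⟩ := hR g
  exact this k (hk ▸ A.one_mem)

theorem roquette_class {p : ℕ} (hp : p.Prime) {R : Type} [Group R] [Finite R]
    (hR : IsPGroup p R) (hRoq : IsRoquette R) :
    (∃ (m : ℕ) (a : R), orderOf a = p ^ m ∧ ∀ g, g ∈ Subgroup.zpowers a) ∨
    (p = 2 ∧ ∃ (m s t : ℕ) (a x : R), TwoPar m s t ∧ TwoGen (2 ^ m) s t a x) := by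
  have : Fact p.Prime := ⟨hp⟩
  obtain ⟨A, hAn, hAc, hAself⟩ := exists_selfcentralizing hp hR
  obtain ⟨⟨a, haA⟩, ha⟩ := (hRoq A hAn hAc).exists_generator
  have hAa : A = Subgroup.zpowers a := by
    apply le_antisymm
    · intro g hg
      obtain ⟨i, hi⟩ := Subgroup.mem_zpowers_iff.1 (ha ⟨g, hg⟩)
      exact Subgroup.mem_zpowers_iff.2 ⟨i, by simpa using congrArg Subtype.val hi⟩
    · rwa [Subgroup.zpowers_le]
  subst hAa
  clear ha hAc
  obtain ⟨m, hm⟩ := IsPGroup.iff_orderOf.1 hR a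
  have hcent : ∀ g : R, g * a = a * g → g ∈ Subgroup.zpowers a := by
    intro g hg
    apply hAself
    intro x hx
    obtain ⟨i, rfl⟩ := Subgroup.mem_zpowers_iff.1 hx
    exact (show Commute g a from hg).zpow_right i
  have hcent' : ∀ g : R, g ∉ Subgroup.zpowers a → g * a * g⁻¹ ≠ a := by
    intro g hg h
    apply hg; apply hcent
    calc g * a = (g * a * g⁻¹) * g := by group
      _ = a * g := by rw [h]
  have hnorm : ∀ r : R, ∃ s : ℕ, r * a * r⁻¹ = a ^ s := fun r =>
    mem_zpowers_nat (hAn.conj_mem a haA r)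
  have hmul : ∀ (g h : R) (s s' : ℕ), g * a * g⁻¹ = a ^ s → h * a * h⁻¹ = a ^ s' →
      (g * h) * a * (g * h)⁻¹ = a ^ (s * s') := by
    intro g h s s' hs hs'
    calc (g * h) * a * (g * h)⁻¹ = g * (h * a * h⁻¹) * g⁻¹ := by group
      _ = a ^ (s * s') := by rw [hs', ← conj_pow, hs, pow_mul]
  have hcomm : ∀ r g : R, ∃ i : ℕ, r * g * r⁻¹ = a ^ i * g := by
    intro r g
    obtain ⟨s, hs⟩ := hnorm r
    obtain ⟨s', hs'⟩ := hnorm g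
    have h1 := hmul r g s s' hs hs'
    have h2 := hmul g r s' s hs' hs
    rw [mul_comm s', ← h1] at h2
    have : r * g * r⁻¹ * g⁻¹ ∈ Subgroup.zpowers a := by
      have h3 : (g * r)⁻¹ * (r * g) ∈ Subgroup.zpowers a := by
        apply hcent
        calc (g * r)⁻¹ * (r * g) * a = (g * r)⁻¹ * ((r * g) * a * (r * g)⁻¹) * (r * g) := by group
          _ = (g * r)⁻¹ * (g * r * a * (g * r)⁻¹) * (r * g) := by rw [← h2]
          _ = a * ((g * r)⁻¹ * (r * g)) := by group
      have := hAn.conj_mem _ h3 (g * r)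
      convert this using 1; group
    obtain ⟨i, hi⟩ := mem_zpowers_nat this
    exact ⟨i, by rw [← hi]; group⟩
  have hpowconj : ∀ (g : R) (s n : ℕ), g * a * g⁻¹ = a ^ s →
      g ^ n * a * (g ^ n)⁻¹ = a ^ (s ^ n) := by
    intro g s n hs
    induction n with
    | zero => simp
    | succ n ih => rw [pow_succ, pow_succ]; exact hmul _ _ _ _ ih hs
  have hedge : ∀ (g : R) (s : ℕ), g ^ p ∈ Subgroup.zpowers a → g * a * g⁻¹ = a ^ s →
      s ^ p ≡ 1 [MOD p ^ m] := by
    intro g s hg hs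
    rw [← hm, ← pow_eq_pow_iff_modEq, ← hpowconj g s p hs, pow_one]
    obtain ⟨i, hi⟩ := mem_zpowers_nat hg
    rw [hi]; group
  by_cases hall : ∀ g, g ∈ Subgroup.zpowers a
  · exact Or.inl ⟨m, a, hm, hall⟩
  right
  push Not at hall
  obtain ⟨g₀, hg₀⟩ := hall
  have ha1 : a ≠ 1 := by
    rintro rfl; apply hcent' g₀ hg₀; simp
  have hspos : ∀ (g : R) (s : ℕ), g * a * g⁻¹ = a ^ s → 1 ≤ s := by
    intro g s hs
    by_contra h
    have : s = 0 := by omega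
    subst this
    rw [pow_zero] at hs
    exact ha1 (conj_eq_one_iff.1 hs)
  obtain ⟨n, rfl⟩ : ∃ n, m = n + 1 := by
    rcases m with _ | n
    · exfalso; apply ha1; rw [← orderOf_eq_one_iff, hm, pow_zero]
    · exact ⟨n, rfl⟩
  -- general exclusion
  have hexcl : ∀ (g : R) (s : ℕ), g ∉ Subgroup.zpowers a → g ^ p ∈ Subgroup.zpowers a →
      g * a * g⁻¹ = a ^ s → p ^ n ∣ s - 1 → 1 ≤ n → (p ≠ 2 ∨ 2 ≤ n) → False := by
    intro g s hg hgp hs ⟨t, ht⟩ hn hpn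
    have hs1 := hspos g s hs
    have hs' : s = 1 + p ^ n * t := by omega
    refine roquette_no_mod hp hRoq a n hn hm hpn hnorm hcomm g hg (mem_zpowers_nat hgp) t ?_ ?_
    · rw [hs, hs', pow_add, pow_one, pow_mul]
    · rintro ⟨t', rfl⟩
      apply hcent' g hg
      rw [hs, hs', pow_add, pow_one, show p ^ n * (p * t') = p ^ (n + 1) * t' by ring, pow_mul,
        ← hm, pow_orderOf_eq_one, one_pow, mul_one]
  by_cases hp2 : p = 2
  swap
  · exfalso
    obtain ⟨e, he, he'⟩ := exists_pow_edge hR _ g₀ hg₀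
    set g := g₀ ^ p ^ e with hgdef
    have hgp : g ^ p ∈ Subgroup.zpowers a := by rw [hgdef, ← pow_mul, ← pow_succ]; exact he'
    obtain ⟨s, hs⟩ := hnorm g
    obtain ⟨h1, h2⟩ := nt_odd hp hp2 n s (hedge g s hgp hs) (hspos g s hs)
    rw [pow_succ'] at h1
    have h3 := Nat.dvd_of_mul_dvd_mul_left hp.pos h1
    rcases Nat.eq_zero_or_pos n with h0 | hn
    · subst h0
      apply hcent' g he
      obtain ⟨w, hw⟩ := h2
      have := hspos g s hs
      have hs' : s = 1 + p * w := by omega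
      rw [hs, hs', pow_add, pow_one, pow_mul]
      simp only [zero_add, pow_one] at hm
      rw [← hm, pow_orderOf_eq_one, one_pow, mul_one]
    · exact hexcl g s he hgp hs h3 hn (Or.inl hp2)
  subst hp2
  refine ⟨rfl, ?_⟩
  -- n ≥ 1
  have hn : 1 ≤ n := by
    by_contra h
    have h0 : n = 0 := by omega
    subst h0
    obtain ⟨s, hs⟩ := hnorm g₀
    have hodd : s % 2 = 1 := by
      by_contra h2
      obtain ⟨w, hw⟩ : ∃ w, s = 2 * w := ⟨s / 2, by omega⟩
      simp only [zero_add, pow_one] at hm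
      rw [hw, pow_mul, ← hm, pow_orderOf_eq_one, one_pow] at hs
      exact ha1 (conj_eq_one_iff.1 hs)
    apply hcent' g₀ hg₀
    obtain ⟨w, hw⟩ : ∃ w, s = 1 + 2 * w := ⟨s / 2, by omega⟩
    simp only [zero_add, pow_one] at hm
    rw [hs, hw, pow_add, pow_mul, ← hm, pow_orderOf_eq_one, one_pow, mul_one, pow_one]
  have h4dvd : 4 ∣ 2 ^ (n + 1) := by
    have := pow_dvd_pow 2 (show 2 ≤ n + 1 by omega); simpa using this
  -- L2
  have hL2 : ∀ (g : R) (s : ℕ), g ∉ Subgroup.zpowers a → g ^ 2 ∈ Subgroup.zpowers a →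
      g * a * g⁻¹ = a ^ s → s % 4 = 3 ∧ 2 ^ n ∣ s + 1 := by
    intro g s hg hg2 hs
    rcases nt_two (n + 1) s (by omega) (hedge g s hg2 hs) with ⟨h1, h2⟩ | ⟨h1, h2⟩
    · exfalso
      simp only [Nat.add_sub_cancel] at h1
      by_cases hn2 : 2 ≤ n
      · exact hexcl g s hg hg2 hs h1 hn (Or.inr hn2)
      · have hn1 : n = 1 := by omega
        subst hn1
        apply hcent' g hg
        obtain ⟨w, hw⟩ : ∃ w, s = 1 + 2 ^ (1 + 1) * w := ⟨s / 4, by omega⟩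
        rw [hs, hw, pow_add, pow_mul, ← hm, pow_orderOf_eq_one, one_pow, mul_one, pow_one]
    · exact ⟨h2, by simpa using h1⟩
  -- L3
  have hL3 : ∀ g : R, g ^ 2 ∈ Subgroup.zpowers a := by
    intro g
    by_contra hg2
    have hg : g ∉ Subgroup.zpowers a := fun h => hg2 (Subgroup.pow_mem _ h 2)
    obtain ⟨e, he, he'⟩ := exists_pow_edge hR _ (g ^ 2) hg2
    set h := g ^ 2 ^ e with hh
    have e1 : (g ^ 2) ^ 2 ^ e = h ^ 2 := by rw [hh, ← pow_mul, ← pow_mul]; congr 1; ring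
    have e2 : (g ^ 2) ^ 2 ^ (e + 1) = (h ^ 2) ^ 2 := by rw [pow_succ 2 e, pow_mul, e1]
    rw [e1] at he
    rw [e2] at he'
    obtain ⟨r, hr⟩ := hnorm h
    have := (hL2 (h ^ 2) (r ^ 2) he he' (hpowconj h r 2 hr)).1
    have h5 : r % 4 < 4 := Nat.mod_lt _ (by norm_num)
    rw [Nat.pow_mod] at this
    interval_cases hs : r % 4 <;> simp_all
  -- L4
  have hL4 : ∀ x g : R, x ∉ Subgroup.zpowers a → g ∉ Subgroup.zpowers a →
      g * x⁻¹ ∈ Subgroup.zpowers a := by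
    intro x g hx hg
    by_contra hgx
    obtain ⟨s, hs⟩ := hnorm (g * x⁻¹)
    obtain ⟨s', hs'⟩ := hnorm x
    have h1 := hmul _ _ _ _ hs hs'
    have e : g * x⁻¹ * x = g := by group
    rw [e] at h1
    have a1 := (hL2 _ _ hgx (hL3 _) hs).1
    have a2 := (hL2 _ _ hx (hL3 _) hs').1
    have a3 := (hL2 _ _ hg (hL3 _) h1).1
    rw [Nat.mul_mod, a1, a2] at a3
    norm_num at a3
  obtain ⟨s, hs⟩ := hnorm g₀
  obtain ⟨hs4, w, hw⟩ := hL2 g₀ s hg₀ (hL3 _) hs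
  obtain ⟨j, hj⟩ := mem_zpowers_nat (hL3 g₀)
  have hpow : ∀ i : ℕ, a ^ (2 ^ (n + 1) * i) = 1 := by
    intro i; rw [pow_mul, ← hm, pow_orderOf_eq_one, one_pow]
  have hjs : 2 ^ n ∣ j := by
    have h1 : g₀ * a ^ j * g₀⁻¹ = a ^ j := by rw [← hj]; group
    rw [← conj_pow, hs, ← pow_mul, pow_eq_pow_iff_modEq, hm] at h1
    have h2 := Nat.modEq_iff_dvd.1 h1.symm
    push_cast at h2
    obtain ⟨u, hu⟩ : ∃ u : ℤ, (s : ℤ) - 1 = 2 * (2 * u + 1) := ⟨(s : ℤ) / 4, by omega⟩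
    rw [show (s : ℤ) * j - j = 2 * ((2 * u + 1) * j) by rw [← sub_one_mul, hu]; ring, pow_succ',
      mul_dvd_mul_iff_left (by norm_num)] at h2
    have hc : IsCoprime ((2 : ℤ) ^ n) (2 * u + 1) := by
      apply IsCoprime.pow_left; exact ⟨-u, 1, by ring⟩
    have := hc.dvd_of_dvd_mul_left h2
    exact_mod_cast this
  have hj2 : g₀ ^ 2 = 1 ∨ g₀ ^ 2 = a ^ 2 ^ n := by
    obtain ⟨v, rfl⟩ := hjs
    rcases Nat.even_or_odd' v with ⟨v', rfl | rfl⟩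
    · left; rw [hj, show 2 ^ n * (2 * v') = 2 ^ (n + 1) * v' by ring, hpow]
    · right; rw [hj, show 2 ^ n * (2 * v' + 1) = 2 ^ (n + 1) * v' + 2 ^ n by ring, pow_add, hpow,
        one_mul]
  have h2n : 1 ≤ 2 ^ n := Nat.one_le_two_pow
  have hgen : ∀ g : R, g ∈ Subgroup.zpowers a ∨ g * g₀⁻¹ ∈ Subgroup.zpowers a := by
    intro g
    by_cases h : g ∈ Subgroup.zpowers a
    · exact Or.inl h
    · exact Or.inr (hL4 g₀ g hg₀ h)
  rcases Nat.even_or_odd' w with ⟨w', hw' | hw'⟩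
  · -- s ≡ -1
    have hs1 : g₀ * a * g₀⁻¹ = a ^ (2 ^ (n + 1) - 1) := by
      rw [hs, pow_eq_pow_iff_modEq, hm]
      have : s + 1 ≡ (2 ^ (n + 1) - 1) + 1 [MOD 2 ^ (n + 1)] := by
        rw [Nat.sub_add_cancel (Nat.one_le_two_pow), hw, hw',
          show 2 ^ n * (2 * w') = 2 ^ (n + 1) * w' by ring]
        exact (Nat.modEq_zero_iff_dvd.2 (Dvd.intro _ rfl)).trans
          (Nat.modEq_zero_iff_dvd.2 dvd_rfl).symm
      exact Nat.ModEq.add_right_cancel' 1 this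
    rcases hj2 with hx | hx
    · have hn2 : 2 ≤ n := by
        by_contra hcon
        have hn1 : n = 1 := by omega
        subst hn1
        have hinv : g₀ * a * g₀⁻¹ = a⁻¹ := by
          rw [hs1, eq_inv_iff_mul_eq_one, ← pow_succ]
          simpa using hpow 1
        have ho : orderOf a = 4 := by rw [hm]; norm_num
        have hginv : g₀⁻¹ = g₀ := by
          rw [inv_eq_iff_mul_eq_one, ← pow_two, hx]
        have hxa : ∀ i : ℤ, a ^ i * g₀ * (a ^ i)⁻¹ = (a ^ 2) ^ i * g₀ := by
          intro i
          have h3 : g₀ * (a ^ i)⁻¹ * g₀⁻¹ = a ^ i := by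
            rw [← zpow_neg, ← conj_zpow, hinv, inv_zpow, zpow_neg, inv_inv]
          calc a ^ i * g₀ * (a ^ i)⁻¹ = a ^ i * (g₀ * (a ^ i)⁻¹ * g₀⁻¹) * g₀ := by group
            _ = a ^ i * a ^ i * g₀ := by rw [h3]
            _ = (a ^ 2) ^ i * g₀ := by rw [← zpow_add, ← zpow_natCast, ← zpow_mul]; congr 2; push_cast; ring
        have hz4 : (a ^ 2) ^ 2 = 1 := by rw [← pow_mul]; simpa using hpow 1
        have hzin : (a ^ 2)⁻¹ = a ^ 2 := by
          rw [inv_eq_iff_mul_eq_one, ← pow_two, hz4]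
        have hcz : g₀ * a ^ 2 * g₀⁻¹ = a ^ 2 := by
          rw [← conj_pow, hinv, inv_pow, hzin]
        have hres := roquette_excl Nat.prime_two hRoq (a ^ 2) g₀ (by
            intro h
            have := orderOf_dvd_of_pow_eq_one h
            rw [ho] at this; norm_num at this) hz4 hx (by
            calc a ^ 2 * g₀ = (g₀ * a ^ 2 * g₀⁻¹) * g₀ := by rw [hcz]
              _ = g₀ * a ^ 2 := by group) (by
            intro r
            obtain ⟨s, hs⟩ := hnorm r
            rw [← conj_pow, hs, ← pow_mul, mul_comm, pow_mul]
            exact Subgroup.npow_mem_zpowers _ _) (by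
            intro r
            rcases hgen r with hr | hr
            · obtain ⟨i, rfl⟩ := Subgroup.mem_zpowers_iff.1 hr
              exact ⟨_, Subgroup.zpow_mem_zpowers _ i, hxa i⟩
            · obtain ⟨i, hi⟩ := Subgroup.mem_zpowers_iff.1 hr
              have : r = a ^ i * g₀ := by rw [hi]; group
              refine ⟨_, Subgroup.zpow_mem_zpowers _ i, ?_⟩
              rw [← hxa i, this]; group)
        apply hg₀
        exact (Subgroup.zpowers_le.2 (Subgroup.npow_mem_zpowers a 2)) hres
      exact ⟨n + 1, _, 0, a, g₀, ⟨by omega, Or.inl ⟨rfl, rfl, by omega⟩⟩, hm, hg₀, hgen, hs1,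
        by rw [hx, pow_zero]⟩
    · exact ⟨n + 1, _, _, a, g₀, ⟨by omega, Or.inr (Or.inl ⟨rfl, rfl⟩)⟩, hm, hg₀, hgen, hs1,
        by simpa using hx⟩
  · have hn2 : 2 ≤ n := by
      by_contra hcon
      have hn1 : n = 1 := by omega
      subst hn1
      omega
    have hs1 : g₀ * a * g₀⁻¹ = a ^ (2 ^ n - 1) := by
      rw [hs, pow_eq_pow_iff_modEq, hm]
      have : s + 1 ≡ (2 ^ n - 1) + 1 [MOD 2 ^ (n + 1)] := by
        rw [Nat.sub_add_cancel (Nat.one_le_two_pow), hw, hw',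
          show 2 ^ n * (2 * w' + 1) = 2 ^ (n + 1) * w' + 2 ^ n by ring]
        have := (Nat.modEq_zero_iff_dvd.2 (Dvd.intro w' rfl : 2 ^ (n + 1) ∣ 2 ^ (n + 1) * w'))
        simpa using this.add_right (2 ^ n)
      exact Nat.ModEq.add_right_cancel' 1 this
    have hpar : TwoPar (n + 1) (2 ^ n - 1) 0 :=
      ⟨by omega, Or.inr (Or.inr ⟨by simp, rfl, by omega⟩)⟩
    rcases hj2 with hx | hx
    · exact ⟨n + 1, _, 0, a, g₀, hpar, hm, hg₀, hgen, hs1, by rw [hx, pow_zero]⟩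
    · refine ⟨n + 1, _, 0, a, a * g₀, hpar, hm, ?_, ?_, ?_, ?_⟩
      · intro h
        apply hg₀
        have := Subgroup.mul_mem _ (Subgroup.inv_mem _ haA) h
        simpa using this
      · intro g
        rcases hgen g with h | h
        · exact Or.inl h
        · right
          have := Subgroup.mul_mem _ h (Subgroup.inv_mem _ haA)
          rwa [show g * (a * g₀)⁻¹ = g * g₀⁻¹ * a⁻¹ by group]
      · calc a * g₀ * a * (a * g₀)⁻¹ = a * (g₀ * a * g₀⁻¹) * a⁻¹ := by group
          _ = a * a ^ (2 ^ n - 1) * a⁻¹ := by rw [hs1]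
          _ = a ^ (2 ^ n - 1) := by rw [(Commute.self_pow a _).eq]; group
      · calc (a * g₀) ^ 2 = a * (g₀ * a * g₀⁻¹) * g₀ ^ 2 := by rw [pow_two, pow_two]; group
          _ = a * a ^ (2 ^ n - 1) * a ^ 2 ^ n := by rw [hs1, hx]
          _ = a ^ 2 ^ n * a ^ 2 ^ n := by
            rw [← pow_succ', Nat.sub_add_cancel h2n]
          _ = a ^ 0 := by
            rw [← pow_add, ← two_mul, ← pow_succ', pow_zero]; simpa using hpow 1

end Genotype

namespace Genotype

theorem TwoGen.comm {R : Type} [Group R] {N s t : ℕ} {a x : R} (h : TwoGen N s t a x) (j : ℤ) :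
    x * a ^ j = a ^ ((s : ℤ) * j) * x := by
  have h1 := h.2.2.2.1
  rw [zpow_mul, zpow_natCast, ← h1, ← MulAut.conj_apply, ← map_zpow, MulAut.conj_apply]
  group

theorem TwoGen.sq {R : Type} [Group R] {N s t : ℕ} {a x : R} (h : TwoGen N s t a x) :
    x * x = a ^ (t : ℤ) := by
  rw [← pow_two, h.2.2.2.2, zpow_natCast]

theorem TwoGen.inv_eq {R : Type} [Group R] {N s t : ℕ} {a x : R} (h : TwoGen N s t a x) :
    x⁻¹ = a ^ (-(t : ℤ)) * x := by
  rw [zpow_neg, ← h.sq]; group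

theorem TwoGen.form {R : Type} [Group R] {N s t : ℕ} {a x : R} (h : TwoGen N s t a x) (g : R) :
    ∃ i : ℤ, g = a ^ i ∨ g = a ^ i * x := by
  rcases h.2.2.1 g with h1 | h1
  · obtain ⟨i, hi⟩ := h1
    exact ⟨i, Or.inl hi.symm⟩
  · obtain ⟨i, hi⟩ := h1
    refine ⟨i, Or.inr ?_⟩
    have : a ^ i = g * x⁻¹ := hi
    rw [this]; group

theorem TwoGen.zpow_eq {R R' : Type} [Group R] [Group R'] {N : ℕ} {a : R} {a' : R'}
    (h : orderOf a = N) (h' : orderOf a' = N) (i j : ℤ) (hij : a ^ i = a ^ j) :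
    a' ^ i = a' ^ j := by
  rw [zpow_eq_zpow_iff_modEq] at hij ⊢
  rw [h'] ; rwa [h] at hij

/-- the graph of the isomorphism -/
def twoGraph {R R' : Type} [Group R] [Group R'] {N s t : ℕ} {a x : R} {a' x' : R'}
    (h : TwoGen N s t a x) (h' : TwoGen N s t a' x') : Subgroup (R × R') where
  carrier := {q | ∃ i : ℤ, q = (a ^ i, a' ^ i) ∨ q = (a ^ i * x, a' ^ i * x')}
  one_mem' := ⟨0, by left; simp; rfl⟩
  mul_mem' := by
    rintro _ _ ⟨i, rfl | rfl⟩ ⟨j, rfl | rfl⟩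
    · exact ⟨i + j, by left; simp [zpow_add]⟩
    · exact ⟨i + j, by right; simp [zpow_add, mul_assoc]⟩
    · refine ⟨i + s * j, ?_⟩
      right
      simp only [Prod.mk_mul_mk, zpow_add, mul_assoc, h.comm, h'.comm]
    · refine ⟨i + s * j + t, ?_⟩
      left
      simp only [Prod.mk_mul_mk, zpow_add, mul_assoc]
      rw [← mul_assoc x, ← mul_assoc x', h.comm, h'.comm, mul_assoc, mul_assoc, h.sq, h'.sq]
  inv_mem' := by
    rintro _ ⟨i, rfl | rfl⟩
    · exact ⟨-i, by left; simp⟩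
    · refine ⟨-t + s * (-i), ?_⟩
      right
      simp only [Prod.inv_mk, mul_inv_rev, zpow_add]
      rw [h.inv_eq, h'.inv_eq, ← zpow_neg, ← zpow_neg, mul_assoc, h.comm, mul_assoc, h'.comm,
        mul_assoc, mul_assoc]

theorem twoGen_equiv {R R' : Type} [Group R] [Group R'] {N s t : ℕ} {a x : R} {a' x' : R'}
    (h : TwoGen N s t a x) (h' : TwoGen N s t a' x') :
    ∃ e : R ≃* R', e a = a' ∧ e x = x' := by
  have b1 : Function.Bijective ((MonoidHom.fst R R').comp (twoGraph h h').subtype) := by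
    constructor
    · rw [injective_iff_map_eq_one]
      rintro ⟨_, i, rfl | rfl⟩ hi
      · have hi : a ^ i = 1 := hi
        have := TwoGen.zpow_eq h.1 h'.1 i 0 (by simpa using hi)
        ext <;> simp [hi]
        simpa using this
      · have hi : a ^ i * x = 1 := hi
        exact absurd ⟨-i, by simp [eq_inv_of_mul_eq_one_right hi]⟩ h.2.1
    · intro g
      obtain ⟨i, rfl | rfl⟩ := h.form g
      · exact ⟨⟨_, i, Or.inl rfl⟩, rfl⟩
      · exact ⟨⟨_, i, Or.inr rfl⟩, rfl⟩
  have b2 : Function.Bijective ((MonoidHom.snd R R').comp (twoGraph h h').subtype) := by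
    constructor
    · rw [injective_iff_map_eq_one]
      rintro ⟨_, i, rfl | rfl⟩ hi
      · have hi : a' ^ i = 1 := hi
        have := TwoGen.zpow_eq h'.1 h.1 i 0 (by simpa using hi)
        ext <;> simp [hi]
        simpa using this
      · have hi : a' ^ i * x' = 1 := hi
        exact absurd ⟨-i, by simp [eq_inv_of_mul_eq_one_right hi]⟩ h'.2.1
    · intro g
      obtain ⟨i, rfl | rfl⟩ := h'.form g
      · exact ⟨⟨_, i, Or.inl rfl⟩, rfl⟩
      · exact ⟨⟨_, i, Or.inr rfl⟩, rfl⟩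
  let e1 := MulEquiv.ofBijective _ b1
  let e2 := MulEquiv.ofBijective _ b2
  refine ⟨e1.symm.trans e2, ?_, ?_⟩
  · have : e1 ⟨(a, a'), 1, Or.inl (by simp)⟩ = a := rfl
    have h2 : e1.symm a = _ := (e1.symm_apply_eq.2 this.symm)
    rw [MulEquiv.trans_apply, h2]; rfl
  · have : e1 ⟨(x, x'), 0, Or.inr (by simp)⟩ = x := rfl
    have h2 : e1.symm x = _ := (e1.symm_apply_eq.2 this.symm)
    rw [MulEquiv.trans_apply, h2]; rfl

theorem zpowers_pow_coprime {R : Type} [Group R] {N u : ℕ} {a : R} (hN : orderOf a = N)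
    (hu : u.Coprime N) (h0 : 0 < N) : Subgroup.zpowers (a ^ u) = Subgroup.zpowers a := by
  subst hN
  have : Finite (Subgroup.zpowers a) := Nat.finite_of_card_ne_zero (by rw [Nat.card_zpowers]; exact h0.ne.symm)
  apply Subgroup.eq_of_le_of_card_ge
  · rw [Subgroup.zpowers_le]; exact Subgroup.pow_mem _ (Subgroup.mem_zpowers a) u
  · rw [Nat.card_zpowers, Nat.card_zpowers, Nat.Coprime.orderOf_pow hu.symm]

theorem twoGen_aut {R : Type} [Group R] {N s t u : ℕ} {a x : R} (h0 : 0 < N)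
    (h : TwoGen N s t a x) (hu : u.Coprime N) (ht : t * u ≡ t [MOD N]) :
    ∃ e : R ≃* R, e a = a ^ u := by
  have hz := zpowers_pow_coprime h.1 hu h0
  have h' : TwoGen N s t (a ^ u) x := by
    refine ⟨?_, ?_, ?_, ?_, ?_⟩
    · rw [Nat.Coprime.orderOf_pow (by rw [h.1]; exact hu.symm), h.1]
    · rw [hz]; exact h.2.1
    · rw [hz]; exact h.2.2.1
    · rw [← conj_pow, h.2.2.2.1, ← pow_mul, ← pow_mul, mul_comm]
    · rw [h.2.2.2.2, ← pow_mul, pow_eq_pow_iff_modEq, h.1, mul_comm]; exact ht.symm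
  obtain ⟨e, he, -⟩ := twoGen_equiv h h'
  exact ⟨e, he⟩

theorem cyc_equiv {R R' : Type} [Group R] [Group R'] {N : ℕ} {a : R} {a' : R'}
    (h : orderOf a = N) (h' : orderOf a' = N) (hg : ∀ g, g ∈ Subgroup.zpowers a)
    (hg' : ∀ g, g ∈ Subgroup.zpowers a') : ∃ e : R ≃* R', e a = a' :=
  ⟨mulEquivOfOrderOfEq hg hg' (h.trans h'.symm), mulEquivOfOrderOfEq_apply_gen hg hg' _⟩

theorem cyc_aut {R : Type} [Group R] {N u : ℕ} {a : R} (h0 : 0 < N)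
    (h : orderOf a = N) (hg : ∀ g, g ∈ Subgroup.zpowers a) (hu : u.Coprime N) :
    ∃ e : R ≃* R, e a = a ^ u := by
  refine cyc_equiv h (N := N) ?_ hg ?_
  · rw [Nat.Coprime.orderOf_pow (by rw [h]; exact hu.symm), h]
  · rw [zpowers_pow_coprime h hu h0]; exact hg

end Genotype

namespace Genotype

set_option linter.unusedSectionVars false

section avgsec
variable {k : Type} [Field k] [CharZero k] {G : Type} [Group G] [Fintype G]
  {V : Type} [AddCommGroup V] [Module k V]

/-- averaging operator over a subgroup -/
def avg (ρ : Representation k G V) (Y : Subgroup G) : Module.End k V :=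
  (Nat.card Y : k)⁻¹ • ∑ y : Y, ρ y

variable (ρ : Representation k G V) {Y Z : Subgroup G}

theorem avg_apply (v : V) : avg ρ Y v = (Nat.card Y : k)⁻¹ • ∑ y : Y, ρ y v := by
  simp [avg, LinearMap.sum_apply]

theorem card_ne (Y : Subgroup G) : (Nat.card Y : k) ≠ 0 :=
  Nat.cast_ne_zero.2 Nat.card_pos.ne'

theorem rho_avg {y : G} (hy : y ∈ Y) : ρ y * avg ρ Y = avg ρ Y := by
  rw [avg, mul_smul_comm, Finset.mul_sum]
  congr 1
  refine Fintype.sum_equiv (Equiv.mulLeft (⟨y, hy⟩ : Y)) _ _ ?_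
  intro x; simp

theorem avg_rho {y : G} (hy : y ∈ Y) : avg ρ Y * ρ y = avg ρ Y := by
  rw [avg, smul_mul_assoc, Finset.sum_mul]
  congr 1
  refine Fintype.sum_equiv (Equiv.mulRight (⟨y, hy⟩ : Y)) _ _ ?_
  intro x; simp

theorem rho_avg_apply {y : G} (hy : y ∈ Y) (v : V) : ρ y (avg ρ Y v) = avg ρ Y v :=
  LinearMap.congr_fun (rho_avg ρ hy) v

theorem avg_fix {v : V} (h : ∀ y ∈ Y, ρ y v = v) : avg ρ Y v = v := by
  rw [avg_apply, Finset.sum_congr rfl (fun (y : Y) _ => h y y.2), Finset.sum_const, Finset.card_univ,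
    ← Nat.card_eq_fintype_card, ← Nat.cast_smul_eq_nsmul k, smul_smul,
    inv_mul_cancel₀ (card_ne Y), one_smul]

theorem avg_mul_of_fix {T : Module.End k V} (h : ∀ y ∈ Y, ρ y * T = T) : avg ρ Y * T = T := by
  ext v
  exact avg_fix ρ (fun y hy => LinearMap.congr_fun (h y hy) v)

theorem mul_avg_of_fix {T : Module.End k V} (h : ∀ y ∈ Y, T * ρ y = T) : T * avg ρ Y = T := by
  rw [avg, mul_smul_comm, Finset.mul_sum, Finset.sum_congr rfl (fun (y : Y) _ => h y y.2),
    Finset.sum_const, Finset.card_univ,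
    ← Nat.card_eq_fintype_card, ← Nat.cast_smul_eq_nsmul k, smul_smul,
    inv_mul_cancel₀ (card_ne Y), one_smul]

theorem avg_idem : avg ρ Y * avg ρ Y = avg ρ Y :=
  avg_mul_of_fix ρ (fun _ hy => rho_avg ρ hy)

theorem avg_mul_avg (h : Y ≤ Z) : avg ρ Y * avg ρ Z = avg ρ Z :=
  avg_mul_of_fix ρ (fun _ hy => rho_avg ρ (h hy))

theorem avg_mul_avg' (h : Y ≤ Z) : avg ρ Z * avg ρ Y = avg ρ Z :=
  mul_avg_of_fix ρ (fun _ hy => avg_rho ρ (h hy))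

theorem avg_comm {g : G} (hg : ∀ y, y ∈ Y ↔ g * y * g⁻¹ ∈ Y) :
    ρ g * avg ρ Y = avg ρ Y * ρ g := by
  rw [avg, mul_smul_comm, smul_mul_assoc, Finset.mul_sum, Finset.sum_mul]
  congr 1
  let e : Y ≃ Y :=
    { toFun := fun y => ⟨g * y * g⁻¹, (hg y).1 y.2⟩
      invFun := fun y => ⟨g⁻¹ * y * g, (hg _).2 (by simpa [mul_assoc] using y.2)⟩
      left_inv := fun y => by ext; simp [mul_assoc]
      right_inv := fun y => by ext; simp [mul_assoc] }
  refine Fintype.sum_equiv e _ _ ?_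
  intro x
  simp only [e, Equiv.coe_fn_mk, ← map_mul]
  congr 1
  group

theorem avg_bot : avg ρ (⊥ : Subgroup G) = 1 := by
  have h : avg ρ (⊥ : Subgroup G) * 1 = 1 := avg_mul_of_fix ρ (by
    intro y hy; rw [Subgroup.mem_bot.1 hy]; simp)
  simpa using h

end avgsec

section reps
variable {k : Type} [Field k] {G : Type} [Group G]

/-- irreducibility for unbundled representations -/
def Irr {V : Type} [AddCommGroup V] [Module k V] (ρ : Representation k G V) : Prop :=
  Nontrivial V ∧ ∀ U : Submodule k V, (∀ g : G, ∀ x ∈ U, ρ g x ∈ U) → U = ⊥ ∨ U = ⊤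

/-- the representation on the range of a commuting operator -/
def rangeRep {V : Type} [AddCommGroup V] [Module k V] (ρ : Representation k G V)
    (e : Module.End k V) (hc : ∀ g, ρ g * e = e * ρ g) : Representation k G (LinearMap.range e) where
  toFun g := (ρ g).restrict (p := LinearMap.range e) (q := LinearMap.range e) (by
    rintro _ ⟨v, rfl⟩
    exact ⟨ρ g v, (LinearMap.congr_fun (hc g) v).symm⟩)
  map_one' := by ext; simp
  map_mul' g h := by ext; simp

theorem rangeRep_apply {V : Type} [AddCommGroup V] [Module k V] (ρ : Representation k G V)
    (e : Module.End k V) (hc : ∀ g, ρ g * e = e * ρ g) (g : G) (v : LinearMap.range e) :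
    (rangeRep ρ e hc g v : V) = ρ g v := rfl

theorem rangeRep_trace {V : Type} [AddCommGroup V] [Module k V] [FiniteDimensional k V]
    (ρ : Representation k G V)
    (e : Module.End k V) (hc : ∀ g, ρ g * e = e * ρ g) (hi : e * e = e) (g : G) :
    LinearMap.trace k _ (rangeRep ρ e hc g) = LinearMap.trace k V (ρ g * e) := by
  have h1 : rangeRep ρ e hc g = e.rangeRestrict ∘ₗ (ρ g ∘ₗ (LinearMap.range e).subtype) := by
    ext ⟨v, w, rfl⟩
    simp only [rangeRep_apply, LinearMap.comp_apply, Submodule.subtype_apply,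
      LinearMap.codRestrict_apply]
    have := LinearMap.congr_fun (hc g) (e w)
    have h3 := LinearMap.congr_fun hi w
    simp only [Module.End.mul_apply] at this h3
    change _ = e (ρ g (e w))
    rw [← this, h3]
  rw [h1, LinearMap.trace_comp_comm', LinearMap.comp_assoc]
  rfl

theorem char_of {V : Type} [AddCommGroup V] [Module k V] [FiniteDimensional k V]
    (ρ : Representation k G V) (g : G) :
    (FDRep.of ρ).character g = LinearMap.trace k V (ρ g) := rfl

theorem irr_of {V : Type} [AddCommGroup V] [Module k V] [FiniteDimensional k V]
    (ρ : Representation k G V) : IsIrr (FDRep.of ρ) ↔ Irr ρ := Iff.rfl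

theorem char_one' (W : FDRep k G) : W.character 1 = (Module.finrank k W : k) := by
  simp

theorem exists_sum_rep (W W' : FDRep k G) :
    ∃ W'' : FDRep k G, W''.character = W.character + W'.character := by
  refine ⟨FDRep.of (Representation.prod W.ρ W'.ρ), ?_⟩
  ext g
  rw [char_of]
  exact LinearMap.trace_prodMap' (W.ρ g) (W'.ρ g)

theorem CharOccurs.add {f c : G → k} (h : CharOccurs f c) (W : FDRep k G) :
    CharOccurs f (W.character + c) := by
  obtain ⟨W', rfl⟩ := h
  obtain ⟨W'', h⟩ := exists_sum_rep W W'
  exact ⟨W'', by rw [h]; ring⟩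

end reps

end Genotype

namespace Genotype

theorem normal_iff {G : Type} [Group G] (Y : Subgroup G) [hY : Y.Normal] (g y : G) :
    y ∈ Y ↔ g * y * g⁻¹ ∈ Y :=
  ⟨fun h => hY.conj_mem y h g, fun h => by
    have := hY.conj_mem _ h g⁻¹
    simpa [mul_assoc] using this⟩

theorem galConj_eq {k l X : Type} [Field k] [Field l] {f : X → k} {f' : X → l}
    (h : IsGaloisConj f f') {x y : X} (hxy : f x = f y) : f' x = f' y := by
  obtain ⟨M, _, _, _, i, j, α, h⟩ := h
  have h1 := h x
  have h2 := h y
  have : (⟨f x, mem_charField f x⟩ : charField f) = ⟨f y, mem_charField f y⟩ := by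
    ext; exact hxy
  rw [this, h2] at h1
  have := j.injective h1
  simpa using this.symm

theorem galConj_nat {k l X : Type} [Field k] [Field l] {f : X → k} {f' : X → l}
    (h : IsGaloisConj f f') {x : X} (n : ℕ) (hxy : f x = n) : f' x = n := by
  obtain ⟨M, _, _, _, i, j, α, h⟩ := h
  have h1 := h x
  have : (⟨f x, mem_charField f x⟩ : charField f) = (n : charField f) := by
    ext; simpa using hxy
  rw [this, map_natCast, map_natCast, ← map_natCast j] at h1
  have := j.injective h1
  simpa using (congrArg Subtype.val this).symm

section
variable {k : Type} [Field k] [CharZero k] {G : Type} [Group G] [Fintype G]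

theorem trace_avg {V : Type} [AddCommGroup V] [Module k V] [FiniteDimensional k V]
    (ρ : Representation k G V) (Y : Subgroup G) (h : G) :
    LinearMap.trace k V (ρ h * avg ρ Y) =
      (Nat.card Y : k)⁻¹ * ∑ y : Y, LinearMap.trace k V (ρ (h * y)) := by
  rw [avg, mul_smul_comm, map_smul, Finset.mul_sum, map_sum, smul_eq_mul]
  simp

/-- averaged character -/
def avgChar (Y : Subgroup G) (f : G → k) (h : G) : k := (Nat.card Y : k)⁻¹ * ∑ y : Y, f (h * y)

theorem avgChar_add (Y : Subgroup G) (f f' : G → k) :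
    avgChar Y (f + f') = avgChar Y f + avgChar Y f' := by
  ext h; simp [avgChar, Finset.sum_add_distrib, mul_add]

theorem avgChar_const (Y : Subgroup G) (f : G → k) (hf : ∀ h, ∀ y ∈ Y, f (h * y) = f h) :
    avgChar Y f = f := by
  ext h
  rw [avgChar, Finset.sum_congr rfl (fun (y : Y) _ => hf h y y.2), Finset.sum_const,
    Finset.card_univ, ← Nat.card_eq_fintype_card, nsmul_eq_mul, ← mul_assoc,
    inv_mul_cancel₀ (card_ne Y), one_mul]

/-- the averaged character is the character of the fixed points -/
theorem avgChar_rep (Y : Subgroup G) [Y.Normal] (W : FDRep k G) :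
    ∃ W' : FDRep k G, avgChar Y W.character = W'.character := by
  have hc : ∀ g, W.ρ g * avg W.ρ Y = avg W.ρ Y * W.ρ g := fun g => avg_comm _ (normal_iff Y g)
  refine ⟨FDRep.of (rangeRep W.ρ (avg W.ρ Y) hc), ?_⟩
  ext h
  rw [char_of, rangeRep_trace _ _ _ (avg_idem _), trace_avg]
  rfl

theorem zero_of_char_one (W : FDRep k G) (h : W.character 1 = 0) : W.character = 0 := by
  rw [char_one'] at h
  have h0 : Module.finrank k W = 0 := by exact_mod_cast h
  have : Subsingleton W := Module.finrank_zero_iff.1 h0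
  ext g
  have : W.ρ g = 0 := LinearMap.ext fun v => Subsingleton.elim _ _
  rw [FDRep.character]
  rw [this]; simp

theorem tight_of {V : Type} [AddCommGroup V] [Module k V] [FiniteDimensional k V]
    (ρ : Representation k G V) (hρ : Irr ρ) (H : Subgroup G) (K : Subgroup H) [K.Normal]
    (E : Module.End k V) (hE : E = avg (ρ.comp H.subtype) K) (hne : E ≠ 0)
    (h0 : ∀ g, g ∉ H → E * ρ g * E = 0) (f : H → k)
    (hf : ∀ h : H, f h = LinearMap.trace k V (ρ h * E)) :
    TightInd H (fun g => LinearMap.trace k V (ρ g)) f := by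
  have hEE : E * E = E := by rw [hE]; exact avg_idem _
  have hcomm : ∀ h : H, ρ h * E = E * ρ h := fun h => by
    rw [hE]; exact avg_comm (ρ.comp H.subtype) (g := h) (normal_iff K h)
  have hres : resChar H (fun g => LinearMap.trace k V (ρ g)) =
      fun h : H => LinearMap.trace k V (ρ.comp H.subtype h) := rfl
  have hfa : f = avgChar K (resChar H (fun g => LinearMap.trace k V (ρ g))) := by
    ext h
    rw [hf, hE]
    exact trace_avg (ρ.comp H.subtype) K h
  have hfK : ∀ h, ∀ κ ∈ K, f (h * κ) = f h := by
    intro h κ hκ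
    rw [hf, hf]
    have := rho_avg (ρ.comp H.subtype) hκ
    rw [← hE] at this
    have h2 : ρ (κ : G) * E = E := this
    rw [Subgroup.coe_mul, map_mul ρ, mul_assoc, h2]
  have hff : avgChar K f = f := avgChar_const K f hfK
  have hf1 : f 1 = (Module.finrank k (LinearMap.range E) : k) := by
    have := rangeRep_trace (ρ.comp H.subtype) E hcomm hEE 1
    rw [hf]
    simp only [map_one] at this
    rw [← LinearMap.trace_one, this]
    simp
  have hpos : f 1 ≠ 0 := by
    rw [hf1]
    intro h
    have h0 : Module.finrank k (LinearMap.range E) = 0 := by exact_mod_cast h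
    rw [Submodule.finrank_eq_zero, LinearMap.range_eq_bot] at h0
    exact hne h0
  refine ⟨?_, ?_, ?_⟩
  · -- induction formula
    set J : Module.End k V := (Nat.card H : k)⁻¹ • ∑ x : G, ρ x * E * ρ x⁻¹ with hJ
    have hJc : ∀ g, ρ g * J = J * ρ g := by
      intro g
      rw [hJ, mul_smul_comm, smul_mul_assoc, Finset.mul_sum, Finset.sum_mul]
      congr 1
      refine Fintype.sum_equiv (Equiv.mulLeft g) _ _ ?_
      intro x
      have : ρ g⁻¹ * ρ g = 1 := by rw [← map_mul]; simp
      simp [mul_assoc, this]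
    have hJE : J * E = E := by
      rw [hJ, smul_mul_assoc, Finset.sum_mul]
      have h2 : ∀ x : G, ρ x * E * ρ x⁻¹ * E = if x ∈ H then E else 0 := by
        intro x
        split_ifs with hx
        · have := hcomm ⟨x, hx⟩
          simp only at this
          rw [this, mul_assoc E, ← map_mul]; simp [hEE]
        · rw [mul_assoc, mul_assoc, ← mul_assoc E, h0 x⁻¹ (by simpa using hx), mul_zero]
      rw [Finset.sum_congr rfl (fun x _ => h2 x), ← Finset.sum_filter, Finset.sum_const,
        ← Nat.cast_smul_eq_nsmul k, smul_smul]
      have : ({x ∈ (Finset.univ : Finset G) | x ∈ H}).card = Nat.card H := by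
        rw [Nat.card_eq_fintype_card, Fintype.card_subtype]
      rw [this, inv_mul_cancel₀ (card_ne H), one_smul]
    have hJ1 : J = 1 := by
      rcases hρ.2 (LinearMap.ker (J - 1)) (by
        intro g x hx
        rw [LinearMap.mem_ker] at hx ⊢
        have h3 := LinearMap.congr_fun (hJc g) x
        simp only [Module.End.mul_apply, LinearMap.sub_apply, Module.End.one_apply] at *
        rw [← h3, ← map_sub, hx, map_zero]) with h | h
      · exfalso
        apply hne
        ext v
        have : E v ∈ LinearMap.ker (J - 1) := by
          rw [LinearMap.mem_ker]
          have := LinearMap.congr_fun hJE v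
          simp only [Module.End.mul_apply, LinearMap.sub_apply, Module.End.one_apply] at *
          rw [this, sub_self]
        rw [h] at this
        simpa using this
      · rw [LinearMap.ker_eq_top] at h
        exact sub_eq_zero.1 h
    ext g
    have h5 : ∀ x : G, (if h : x⁻¹ * g * x ∈ H then f ⟨x⁻¹ * g * x, h⟩ else 0) =
        LinearMap.trace k V (ρ g * (ρ x * E * ρ x⁻¹)) := by
      intro x
      have h6 : LinearMap.trace k V (ρ g * (ρ x * E * ρ x⁻¹)) =
          LinearMap.trace k V (ρ (x⁻¹ * g * x) * E) := by
        rw [← mul_assoc, LinearMap.trace_mul_comm]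
        simp [mul_assoc]
      rw [h6]
      split_ifs with h
      · rw [hf]
      · rw [← hEE, ← mul_assoc, LinearMap.trace_mul_comm, ← mul_assoc, h0 _ h, map_zero]
    rw [indChar, finsum_eq_sum_of_fintype, Finset.sum_congr rfl (fun x _ => h5 x), ← map_sum,
      ← Finset.mul_sum, ← smul_eq_mul, ← map_smul, ← mul_smul_comm, ← hJ, hJ1, mul_one]
  · have hc' : ∀ g, (ρ.comp H.subtype) g * (1 - E) = (1 - E) * (ρ.comp H.subtype) g := by
      intro g; rw [mul_sub, sub_mul, mul_one, one_mul]; congr 1; exact hcomm g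
    refine ⟨FDRep.of (rangeRep (ρ.comp H.subtype) (1 - E) hc'), ?_, ?_⟩
    · ext h
      simp only [one_smul, Pi.add_apply]
      rw [char_of, rangeRep_trace _ _ _ (by rw [mul_sub, sub_mul, sub_mul, hEE]; simp), hf, ← map_add,
        mul_sub]
      simp [resChar]
    · rintro ⟨W, hW⟩
      have h1 : avgChar K (FDRep.of (rangeRep (ρ.comp H.subtype) (1 - E) hc')).character = 0 := by
        have h2 : (FDRep.of (rangeRep (ρ.comp H.subtype) (1 - E) hc')).character =
            resChar H (fun g => LinearMap.trace k V (ρ g)) + (-f) := by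
          ext h
          rw [char_of, rangeRep_trace _ _ _ (by rw [mul_sub, sub_mul, sub_mul, hEE]; simp), mul_sub]
          simp [resChar, hf, sub_eq_add_neg]
        have hm : avgChar K (-f) = - f := avgChar_const K _ (by
          intro h y hy; simp [hfK h y hy])
        rw [h2, avgChar_add, ← hfa, hm, add_neg_cancel]
      rw [hW, avgChar_add, hff] at h1
      obtain ⟨W', hW'⟩ := avgChar_rep K W
      rw [hW'] at h1
      have h3 := congrFun h1 1
      rw [Pi.add_apply, char_one', hf1, ← Nat.cast_add, Pi.zero_apply] at h3
      have h4 : Module.finrank k (LinearMap.range E) + Module.finrank k W' = 0 := by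
        exact_mod_cast h3
      apply hpos
      rw [hf1]
      have : Module.finrank k (LinearMap.range E) = 0 := by omega
      rw [this]; simp
  · rintro f' - hg ⟨W, hW⟩
    have h1 : avgChar K f' = f' := avgChar_const K f' (fun h y hy => galConj_eq hg (hfK h y hy))
    have h2 : f' 1 = f 1 := by rw [hf1]; exact galConj_nat hg _ hf1
    have h3 := hfa
    rw [hW, avgChar_add, h1] at h3
    obtain ⟨W', hW'⟩ := avgChar_rep K W
    rw [hW'] at h3
    have h4 := congrFun h3 1
    rw [Pi.add_apply, h2] at h4
    have h5 := zero_of_char_one W' (by simpa using h4)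
    rw [h3, h5, add_zero]

end

end Genotype

namespace Genotype
section
variable {k : Type} [Field k] [CharZero k] {G : Type} [Group G] [Fintype G]

theorem corner_irr {V : Type} [AddCommGroup V] [Module k V]
    {ρ : Representation k G V} (hρ : Irr ρ) (H : Subgroup G)
    {E : Module.End k V} (hEE : E * E = E) (hc : ∀ h ∈ H, ρ h * E = E * ρ h)
    (h0 : ∀ g, g ∉ H → E * ρ g * E = 0) (U : Submodule k V) (hU : U ≤ LinearMap.range E)
    (hs : ∀ h ∈ H, ∀ x ∈ U, ρ h x ∈ U) (hne : U ≠ ⊥) : LinearMap.range E ≤ U := by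
  have hfix : ∀ u ∈ U, E u = u := by
    intro u hu
    obtain ⟨w, rfl⟩ := hU hu
    exact LinearMap.congr_fun hEE w
  set W : Submodule k V := ⨆ g : G, U.map (ρ g) with hW
  have hUW : U ≤ W := by
    refine le_trans ?_ (le_iSup _ (1 : G))
    intro u hu
    exact ⟨u, hu, by simp⟩
  have hWt : W = ⊤ := by
    rcases hρ.2 W (by
      intro g x hx
      have : W ≤ W.comap (ρ g) := by
        rw [hW]
        refine iSup_le fun x => ?_
        rw [Submodule.map_le_iff_le_comap]
        intro u hu
        refine (le_iSup (fun g => U.map (ρ g)) (g * x)) ⟨u, hu, by simp⟩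
      exact this hx) with h | h
    · rw [h] at hUW; exact absurd (le_bot_iff.1 hUW) hne
    · exact h
  have hWE : W ≤ U.comap E := by
    rw [hW]
    refine iSup_le fun g => ?_
    rw [Submodule.map_le_iff_le_comap]
    intro u hu
    change E (ρ g u) ∈ U
    by_cases hg : g ∈ H
    · have := LinearMap.congr_fun (hc g hg) u
      simp only [Module.End.mul_apply] at this
      rw [← this, hfix u hu]
      exact hs g hg u hu
    · have := LinearMap.congr_fun (h0 g hg) u
      simp only [Module.End.mul_apply, LinearMap.zero_apply] at this
      rw [hfix u hu] at this
      rw [this]; exact U.zero_mem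
  rintro _ ⟨v, rfl⟩
  rw [hWt] at hWE
  exact hWE (Submodule.mem_top (x := v))

theorem cyclic_of_free {A : Type} [Group A] [Fintype A] (hA : ∀ x y : A, x * y = y * x)
    {V : Type} [AddCommGroup V] [Module k V] [Nontrivial V] (σ : Representation k A V)
    (h : ∀ B : Subgroup A, B ≠ ⊥ → avg σ B = 0) : IsCyclic A := by
  letI cr : CommRing (Algebra.adjoin k (Set.range σ)) := Algebra.adjoinCommRingOfComm k (by
    rintro _ ⟨x, rfl⟩ _ ⟨y, rfl⟩
    rw [← map_mul, ← map_mul, hA])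
  let S := Algebra.adjoin k (Set.range σ)
  obtain ⟨P, hP⟩ := Ideal.exists_maximal S
  letI : Field (S ⧸ P) := Ideal.Quotient.field P
  let τ : A →* S := σ.codRestrict S.toSubmonoid
    (fun x => Algebra.subset_adjoin ⟨x, rfl⟩)
  let q : S →+* S ⧸ P := Ideal.Quotient.mk P
  let f : A →* (S ⧸ P) := q.toMonoidHom.comp τ
  refine isCyclic_of_subgroup_isDomain f ?_
  rw [injective_iff_map_eq_one]
  by_contra hcon
  push Not at hcon
  obtain ⟨b, hb, hb1⟩ := hcon
  let B : Subgroup A := f.toHomUnits.ker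
  have hBf : ∀ b ∈ B, f b = 1 := by
    intro b hb
    have : f.toHomUnits b = 1 := hb
    have := congrArg Units.val this
    simpa using this
  have hbB : b ∈ B := by
    change f.toHomUnits b = 1
    ext
    simpa using hb
  have h1 := h B (by intro hB; rw [hB] at hbB; exact hb1 (Subgroup.mem_bot.1 hbB))
  rw [avg] at h1
  have h2 : ∑ y : B, σ y = 0 := by
    rcases smul_eq_zero.1 h1 with h | h
    · exact absurd h (inv_ne_zero (card_ne B))
    · convert h
  have h3 : ∑ y : B, τ y = 0 := by
    apply Subtype.ext
    have : ((∑ y : B, τ y : S) : Module.End k V) = ∑ y : B, σ y := by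
      rw [AddSubmonoidClass.coe_finsetSum]; rfl
    rw [this, h2]; rfl
  have h4 := congrArg q h3
  rw [map_sum, map_zero] at h4
  have h5 : ∀ y : B, q (τ y) = 1 := fun y => hBf y y.2
  rw [Finset.sum_congr rfl (fun y _ => h5 y), Finset.sum_const, nsmul_eq_mul, mul_one,
    Finset.card_univ, ← Nat.card_eq_fintype_card] at h4
  have h6 : algebraMap k S (Nat.card B : k) ∈ P := by
    rw [← Ideal.Quotient.eq_zero_iff_mem]
    rw [map_natCast, map_natCast]; exact h4
  have h7 : IsUnit (algebraMap k S (Nat.card B : k)) :=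
    (isUnit_iff_ne_zero.2 (card_ne B)).map _
  exact hP.ne_top (Ideal.eq_top_of_isUnit_mem P h6 h7)

/-- admissible pairs -/
def Good {V : Type} [AddCommGroup V] [Module k V] (ρ : Representation k G V)
    (H Y : Subgroup G) : Prop :=
  Y ≤ H ∧ (∀ h ∈ H, ∀ y, y ∈ Y ↔ h * y * h⁻¹ ∈ Y) ∧ avg ρ Y ≠ 0 ∧
    ∀ g, g ∉ H → avg ρ Y * ρ g * avg ρ Y = 0

theorem good_step {V : Type} [AddCommGroup V] [Module k V] {ρ : Representation k G V}
    (hρ : Irr ρ) {H K A : Subgroup G} (hg : Good ρ H K)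
    (hmin : ∀ H' Y', Good ρ H' Y' → Nat.card H ≤ Nat.card H')
    (hK : ∀ h ∈ H, ρ h * avg ρ K = avg ρ K → h ∈ K)
    (hAH : A ≤ H) (hAn : ∀ h ∈ H, ∀ a ∈ A, h * a * h⁻¹ ∈ A)
    (hAc : ∀ a ∈ A, ∀ b ∈ A, a * b * a⁻¹ * b⁻¹ ∈ K)
    (B : Subgroup G) (hB1 : K ≤ B) (hB2 : B ≤ A) (hB : avg ρ B ≠ 0) : B = K := by
  obtain ⟨hKH, hKn, hE0, h0⟩ := hg
  obtain ⟨Y, ⟨hY1, hY2, hY0⟩, hYmax⟩ := Set.exists_max_image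
    {Y : Subgroup G | K ≤ Y ∧ Y ≤ A ∧ avg ρ Y ≠ 0} (fun Y => Nat.card Y) (Set.toFinite _)
    ⟨B, hB1, hB2, hB⟩
  have hYn : ∀ a ∈ A, ∀ y, y ∈ Y ↔ a * y * a⁻¹ ∈ Y := by
    have key : ∀ a ∈ A, ∀ y ∈ Y, a * y * a⁻¹ ∈ Y := by
      intro a ha y hy
      have := Y.mul_mem (hY1 (hAc a ha y (hY2 hy))) hy
      simpa using this
    intro a ha y
    refine ⟨key a ha y, fun h => ?_⟩
    have := key a⁻¹ (A.inv_mem ha) _ h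
    simpa [mul_assoc] using this
  have hYK : avg ρ Y * avg ρ K = avg ρ Y := avg_mul_avg' ρ hY1
  have hKY : avg ρ K * avg ρ Y = avg ρ Y := avg_mul_avg ρ hY1
  have hgood : Good ρ (H ⊓ Subgroup.normalizer (Y : Set G)) Y := by
    refine ⟨le_inf (hY2.trans hAH) Subgroup.le_normalizer, ?_, hY0, ?_⟩
    · intro h hh y
      exact Subgroup.mem_normalizer_iff.1 hh.2 y
    · intro g hgn
      by_cases hgH : g ∈ H
      · have hgN : ¬ g ∈ Subgroup.normalizer (Y : Set G) := fun h => hgn ⟨hgH, h⟩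
        let Yg : Subgroup G := Y.map (MulAut.conj g).toMonoidHom
        have hYgA : Yg ≤ A := by
          rintro _ ⟨y, hy, rfl⟩
          exact hAn g hgH y (hY2 hy)
        by_contra hne
        obtain ⟨v, hv⟩ : ∃ v, (avg ρ Y * ρ g * avg ρ Y) v ≠ 0 := by
          by_contra hh
          push Not at hh
          exact hne (LinearMap.ext hh)
        set w := (avg ρ Y * ρ g * avg ρ Y) v with hw
        have hw' : w = avg ρ Y (ρ g (avg ρ Y v)) := rfl
        have h1 : ∀ y ∈ Y, ρ y w = w := fun y hy => rho_avg_apply ρ hy _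
        have h2 : ∀ y ∈ Yg, ρ y w = w := by
          intro y hy
          have hc := LinearMap.congr_fun (avg_comm ρ (hYn y (hYgA hy))) (ρ g (avg ρ Y v))
          simp only [Module.End.mul_apply] at hc
          rw [hw', hc]
          congr 1
          obtain ⟨y', hy', rfl⟩ := hy
          have := rho_avg_apply ρ hy' v
          conv_rhs => rw [← this]
          have hh : ∀ x y z, ρ x (ρ y z) = ρ (x * y) z := fun x y z => by
            rw [map_mul]; rfl
          rw [hh, hh]
          congr 2
          simp
        have h3 : ∀ y ∈ Y ⊔ Yg, ρ y w = w := by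
          let S : Subgroup G :=
            { carrier := {y | ρ y w = w}
              one_mem' := by simp
              mul_mem' := by
                intro a b ha hb
                simp only [Set.mem_setOf_eq] at *
                rw [map_mul, Module.End.mul_apply, hb, ha]
              inv_mem' := by
                intro a ha
                simp only [Set.mem_setOf_eq] at *
                conv_lhs => rw [← ha]
                rw [← Module.End.mul_apply, ← map_mul]; simp }
          have : Y ⊔ Yg ≤ S := sup_le h1 h2
          exact fun y hy => this hy
        have h4 : avg ρ (Y ⊔ Yg) ≠ 0 := by
          intro h
          have := avg_fix ρ h3
          rw [h] at this
          exact hv this.symm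
        have h5 := hYmax (Y ⊔ Yg) ⟨hY1.trans le_sup_left, sup_le hY2 hYgA, h4⟩
        have h6 : Y = Y ⊔ Yg := Subgroup.eq_of_le_of_card_ge le_sup_left h5
        have h7 : Yg ≤ Y := by rw [h6]; exact le_sup_right
        have h8 : Yg = Y := Subgroup.eq_of_le_of_card_ge h7 (by
          exact (Nat.card_congr (Y.equivMapOfInjective _ (MulAut.conj g).injective).toEquiv).le)
        apply hgN
        rw [Subgroup.mem_normalizer_iff]
        intro y
        constructor
        · intro hy; rw [← h8]; exact ⟨y, hy, rfl⟩
        · intro hy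
          rw [← h8] at hy
          obtain ⟨y', hy', he⟩ := hy
          have : y' = y := (MulAut.conj g).injective he
          rwa [← this]
      · calc avg ρ Y * ρ g * avg ρ Y = (avg ρ Y * avg ρ K) * ρ g * (avg ρ K * avg ρ Y) := by
              rw [hYK, hKY]
          _ = avg ρ Y * (avg ρ K * ρ g * avg ρ K) * avg ρ Y := by simp only [mul_assoc]
          _ = 0 := by rw [h0 g hgH]; simp
  have hH : H ⊓ Subgroup.normalizer (Y : Set G) = H :=
    Subgroup.eq_of_le_of_card_ge inf_le_left (hmin _ _ hgood)
  have hYn' : ∀ h ∈ H, ∀ y, y ∈ Y ↔ h * y * h⁻¹ ∈ Y := by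
    intro h hh y
    rw [← hH] at hh
    exact Subgroup.mem_normalizer_iff.1 hh.2 y
  have hr : LinearMap.range (avg ρ K) ≤ LinearMap.range (avg ρ Y) := by
    refine corner_irr hρ H (avg_idem ρ) (fun h hh => avg_comm ρ (hKn h hh)) h0 _ ?_ ?_ ?_
    · rintro _ ⟨v, rfl⟩
      rw [← hKY]; exact ⟨_, rfl⟩
    · rintro h hh _ ⟨v, rfl⟩
      have := LinearMap.congr_fun (avg_comm ρ (hYn' h hh)) v
      exact ⟨_, this.symm⟩
    · rw [Ne, LinearMap.range_eq_bot]; exact hY0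
  have hYle : Y ≤ K := by
    intro y hy
    apply hK y (hAH (hY2 hy))
    ext v
    obtain ⟨w, hw⟩ := hr ⟨v, rfl⟩
    rw [Module.End.mul_apply, ← hw]
    exact rho_avg_apply ρ hy w
  have hYeq : Y = K := le_antisymm hYle hY1
  have := hYmax B ⟨hB1, hB2, hB⟩
  rw [hYeq] at this
  exact (Subgroup.eq_of_le_of_card_ge hB1 this).symm

end
end Genotype

namespace Genotype
section
variable {k : Type} [Field k] [CharZero k] {G : Type} [Group G] [Fintype G]

theorem rho_mul {V : Type} [AddCommGroup V] [Module k V] (ρ : Representation k G V) (x y : G)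
    (v : V) : ρ (x * y) v = ρ x (ρ y v) := by rw [map_mul]; rfl

theorem avg_res {V : Type} [AddCommGroup V] [Module k V] (ρ : Representation k G V)
    (H K : Subgroup G) (hK : K ≤ H) :
    avg (ρ.comp H.subtype) (K.subgroupOf H) = avg ρ K := by
  have h1 : avg (ρ.comp H.subtype) (K.subgroupOf H) * avg ρ K = avg ρ K :=
    avg_mul_of_fix _ (fun y hy => rho_avg ρ (Subgroup.mem_subgroupOf.1 hy))
  have h2 : avg (ρ.comp H.subtype) (K.subgroupOf H) * avg ρ K =
      avg (ρ.comp H.subtype) (K.subgroupOf H) :=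
    mul_avg_of_fix _ (fun y hy => avg_rho (ρ.comp H.subtype) (y := ⟨y, hK hy⟩)
      (Subgroup.mem_subgroupOf.2 hy))
  rw [← h2, h1]

theorem exists_good_min {V : Type} [AddCommGroup V] [Module k V] (ρ : Representation k G V)
    (hρ : Irr ρ) : ∃ H K : Subgroup G, Good ρ H K ∧
      (∀ H' Y', Good ρ H' Y' → Nat.card H ≤ Nat.card H') ∧
      (∀ h ∈ H, ρ h * avg ρ K = avg ρ K → h ∈ K) := by
  have := hρ.1
  have hex : {q : Subgroup G × Subgroup G | Good ρ q.1 q.2}.Nonempty := by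
    refine ⟨(⊤, ⊥), bot_le, ?_, ?_, ?_⟩
    · intro h _ y; simp
    · rw [avg_bot]; exact one_ne_zero
    · intro g hg; exact absurd (Subgroup.mem_top g) hg
  obtain ⟨⟨H, Y⟩, hq, hmin⟩ := Set.exists_min_image _ (fun q => Nat.card q.1) (Set.toFinite _) hex
  obtain ⟨hYH, hYn, hY0, h0⟩ := hq
  simp only at *
  let K : Subgroup G :=
    { carrier := {h | h ∈ H ∧ ρ h * avg ρ Y = avg ρ Y}
      one_mem' := ⟨H.one_mem, by simp⟩
      mul_mem' := by
        rintro a b ⟨ha, ha'⟩ ⟨hb, hb'⟩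
        exact ⟨H.mul_mem ha hb, by rw [map_mul, mul_assoc, hb', ha']⟩
      inv_mem' := by
        rintro a ⟨ha, ha'⟩
        refine ⟨H.inv_mem ha, ?_⟩
        conv_lhs => rw [← ha']
        rw [← mul_assoc, ← map_mul]; simp }
  have hYK : Y ≤ K := fun y hy => ⟨hYH hy, rho_avg ρ hy⟩
  have hav : avg ρ K = avg ρ Y := by
    have h1 : avg ρ K * avg ρ Y = avg ρ Y := avg_mul_of_fix ρ (fun y hy => hy.2)
    rw [← h1, avg_mul_avg' ρ hYK]
  have hKn : ∀ h ∈ H, ∀ y ∈ K, h * y * h⁻¹ ∈ K := by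
    rintro h hh y ⟨hy, hy'⟩
    refine ⟨H.mul_mem (H.mul_mem hh hy) (H.inv_mem hh), ?_⟩
    have hc := avg_comm ρ (hYn h⁻¹ (H.inv_mem hh))
    have hc' := avg_comm ρ (hYn h hh)
    rw [map_mul, map_mul, mul_assoc, hc, ← mul_assoc, mul_assoc (ρ h), hy', hc', mul_assoc,
      ← map_mul]
    simp
  refine ⟨H, K, ⟨fun y hy => hy.1, ?_, by rwa [hav], by rwa [hav]⟩, ?_, ?_⟩
  · intro h hh y
    refine ⟨hKn h hh y, fun hy => ?_⟩
    have := hKn _ (H.inv_mem hh) _ hy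
    simpa [mul_assoc] using this
  · intro H' Y' h; exact hmin (H', Y') h
  · intro h hh hh'
    rw [hav] at hh'
    exact ⟨hh, hh'⟩

theorem part_one (ψ : FDRep k G) (hψ : IsIrr ψ) :
    (∃ (H : Subgroup G) (K : Subgroup H) (_ : K.Normal),
        IsRoquette (H ⧸ K) ∧
        ∃ φ : FDRep k (H ⧸ K), IsIrr φ ∧ IsFaithfulRep φ ∧
          TightIndSub H K ψ.character φ.character) := by
  have hρ : Irr ψ.ρ := hψ
  obtain ⟨H, K0, hgood, hmin, hK0⟩ := exists_good_min ψ.ρ hρ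
  obtain ⟨hKH, hKn, hE0, h0⟩ := hgood
  set ρ := ψ.ρ with hρdef
  let K : Subgroup H := K0.subgroupOf H
  have hKN : K.Normal := ⟨fun n hn g => by
    rw [Subgroup.mem_subgroupOf] at *
    exact (hKn g g.2 n).1 hn⟩
  have hav := avg_res ρ H K0 hKH
  set E := avg ρ K0 with hE
  have hc : ∀ h : H, (ρ.comp H.subtype) h * E = E * (ρ.comp H.subtype) h := fun h =>
    avg_comm ρ (hKn h h.2)
  have hEE : E * E = E := avg_idem ρ
  let σ : Representation k H (LinearMap.range E) := rangeRep (ρ.comp H.subtype) E hc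
  have hσK : ∀ h ∈ K, σ h = 1 := by
    intro h hh
    ext ⟨_, v, rfl⟩
    exact rho_avg_apply ρ (Subgroup.mem_subgroupOf.1 hh) v
  let τ : Representation k (H ⧸ K) (LinearMap.range E) := QuotientGroup.lift K σ hσK
  have hτ : ∀ h : H, τ (QuotientGroup.mk h) = σ h := fun h => rfl
  have hinj : ∀ h : H, σ h = 1 → h ∈ K := by
    intro h hh
    rw [Subgroup.mem_subgroupOf]
    refine hK0 h h.2 ?_
    ext v
    have := congrArg Subtype.val (LinearMap.congr_fun hh ⟨E v, v, rfl⟩)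
    exact this
  have hnt : Nontrivial (LinearMap.range E) := by
    rw [Submodule.nontrivial_iff_ne_bot, Ne, LinearMap.range_eq_bot]; exact hE0
  have hfaith : Function.Injective τ := by
    rw [injective_iff_map_eq_one]
    intro q hq
    induction q using QuotientGroup.induction_on with
    | H h =>
      rw [hτ] at hq
      exact (QuotientGroup.eq_one_iff h).2 (hinj h hq)
  refine ⟨H, K, hKN, ?_, FDRep.of τ, ?_, hfaith, ?_⟩
  · -- Roquette
    intro A hAn hAc
    refine cyclic_of_free (k := k) (fun x y => Subtype.ext (hAc x x.2 y y.2))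
      (τ.comp A.subtype) ?_
    intro B hB
    by_contra hne
    let A0 : Subgroup G := (A.comap (QuotientGroup.mk' K)).map H.subtype
    let B0 : Subgroup G := ((B.map A.subtype).comap (QuotientGroup.mk' K)).map H.subtype
    have hA0H : A0 ≤ H := by rintro _ ⟨h, _, rfl⟩; exact h.2
    have hmemA : ∀ h : H, (h : G) ∈ A0 ↔ (QuotientGroup.mk h : H ⧸ K) ∈ A := by
      intro h
      constructor
      · rintro ⟨h', hh', he⟩
        rw [← Subtype.ext he]; exact hh'
      · intro hh; exact ⟨h, hh, rfl⟩
    have hmemB : ∀ h : H, (h : G) ∈ B0 ↔ (QuotientGroup.mk h : H ⧸ K) ∈ B.map A.subtype := by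
      intro h
      constructor
      · rintro ⟨h', hh', he⟩
        rw [← Subtype.ext he]; exact hh'
      · intro hh; exact ⟨h, hh, rfl⟩
    have hmk : ∀ h : H, (QuotientGroup.mk h : H ⧸ K) = 1 ↔ (h : G) ∈ K0 := by
      intro h; rw [QuotientGroup.eq_one_iff, Subgroup.mem_subgroupOf]
    have hKB : K0 ≤ B0 := by
      intro κ hκ
      rw [hmemB ⟨κ, hKH hκ⟩, (hmk _).2 hκ]
      exact Subgroup.one_mem _
    have hBA : B0 ≤ A0 := by
      rintro _ ⟨h, hh, rfl⟩
      refine (hmemA h).2 ?_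
      obtain ⟨a, _, ha⟩ := hh
      have : (QuotientGroup.mk h : H ⧸ K) = a := ha.symm
      rw [this]; exact a.2
    have hB0 : avg ρ B0 ≠ 0 := by
      obtain ⟨v, hv⟩ : ∃ v, avg (MonoidHom.comp τ A.subtype) B v ≠ 0 := by
        by_contra hh
        push Not at hh
        exact hne (LinearMap.ext hh)
      have hfix : ∀ y ∈ B0, ρ y (avg (MonoidHom.comp τ A.subtype) B v : LinearMap.range E) =
          (avg (MonoidHom.comp τ A.subtype) B v : LinearMap.range E) := by
        rintro _ ⟨h, ⟨a, ha, ha'⟩, rfl⟩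
        have h1 := rho_avg_apply (MonoidHom.comp τ A.subtype) ha v
        have h2 : MonoidHom.comp τ A.subtype a = σ h := by
          rw [← hτ]
          change τ (A.subtype a) = _
          rw [ha']; rfl
        rw [h2] at h1
        exact congrArg Subtype.val h1
      intro h
      have := avg_fix ρ hfix
      rw [h] at this
      exact hv (Subtype.ext this.symm)
    have hstep := good_step hρ ⟨hKH, hKn, hE0, h0⟩ hmin hK0 hA0H
      (by
        intro h hh a ha
        have := hAn.conj_mem _ ((hmemA ⟨a, hA0H ha⟩).1 ha) (QuotientGroup.mk ⟨h, hh⟩)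
        exact (hmemA ((⟨h, hh⟩ : H) * (⟨a, hA0H ha⟩ : H) * (⟨h, hh⟩ : H)⁻¹)).2 this)
      (by
        intro a ha b hb
        have := hAc _ ((hmemA ⟨a, hA0H ha⟩).1 ha) _ ((hmemA ⟨b, hA0H hb⟩).1 hb)
        refine (hmk (⟨a, hA0H ha⟩ * ⟨b, hA0H hb⟩ * ⟨a, hA0H ha⟩⁻¹ * ⟨b, hA0H hb⟩⁻¹)).1 ?_
        simp only [QuotientGroup.mk_mul, QuotientGroup.mk_inv]
        rw [this]; group)
      B0 hKB hBA hB0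
    apply hB
    rw [Subgroup.eq_bot_iff_forall]
    rintro ⟨q, hq⟩ hqB
    induction q using QuotientGroup.induction_on with
    | H h =>
      have h1 : (h : G) ∈ B0 := (hmemB h).2 ⟨_, hqB, rfl⟩
      rw [hstep] at h1
      exact Subtype.ext ((hmk h).2 h1)
  · -- irreducible
    rw [irr_of]
    refine ⟨hnt, ?_⟩
    intro U hU
    by_cases hUb : U = ⊥
    · exact Or.inl hUb
    right
    have h1 := corner_irr hρ H hEE (fun h hh => hc ⟨h, hh⟩) h0 (U.map (LinearMap.range E).subtype)
      (by rintro _ ⟨u, _, rfl⟩; exact u.2)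
      (by
        rintro h hh _ ⟨u, hu, rfl⟩
        exact ⟨_, hU (QuotientGroup.mk ⟨h, hh⟩) u hu, rfl⟩)
      (by
        intro hb
        apply hUb
        rw [eq_bot_iff]
        intro u hu
        have h2 : (u : ψ) ∈ U.map (LinearMap.range E).subtype := ⟨u, hu, rfl⟩
        rw [hb] at h2
        exact Subtype.ext h2)
    rw [eq_top_iff]
    rintro ⟨x, hx⟩ -
    obtain ⟨u, hu, he⟩ := h1 hx
    have : u = ⟨x, hx⟩ := Subtype.ext he
    rwa [← this]
  · -- tight
    exact tight_of ρ hρ H K E hav.symm hE0 h0 _ (fun h => by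
      exact rangeRep_trace (ρ.comp H.subtype) E hc hEE h)

end
end Genotype

namespace Genotype

theorem galConj_comp {k l X Y : Type} [Field k] [Field l] {f : X → k} {f' : X → l}
    (s : Y → X) (h : IsGaloisConj f f') :
    IsGaloisConj (fun y => f (s y)) (fun y => f' (s y)) := by
  obtain ⟨M, i1, i2, i3, i, j, α, h⟩ := h
  have h1 : charField (fun y => f (s y)) ≤ charField f :=
    Subfield.closure_mono (by rintro _ ⟨y, rfl⟩; exact ⟨s y, rfl⟩)
  have h2 : charField (fun y => f' (s y)) ≤ charField f' :=
    Subfield.closure_mono (by rintro _ ⟨y, rfl⟩; exact ⟨s y, rfl⟩)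
  exact ⟨M, i1, i2, i3, i.comp (Subfield.inclusion h1), j.comp (Subfield.inclusion h2), α,
    fun y => h (s y)⟩

theorem exists_lift_charField {k L M X : Type} [Field k] [Field L] [Field M] (f : X → k)
    (ι : k →+* L) (ι' : M →+* L) (m : X → M) (h : ∀ x, ι (f x) = ι' (m x)) :
    ∃ i : charField f →+* M, ∀ x, i ⟨f x, mem_charField f x⟩ = m x := by
  have hle : charField f ≤ ι'.fieldRange.comap ι := by
    rw [charField, Subfield.closure_le]
    rintro _ ⟨x, rfl⟩
    exact ⟨m x, (h x).symm⟩
  let e : M ≃+* ι'.fieldRange := RingEquiv.ofBijective ι'.rangeRestrictField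
    ⟨fun a b hab => ι'.injective (congrArg Subtype.val hab), by rintro ⟨_, a, rfl⟩; exact ⟨a, rfl⟩⟩
  let c : charField f →+* ι'.fieldRange := (ι.comp (charField f).subtype).codRestrict _
    (fun y => hle y.2)
  refine ⟨e.symm.toRingHom.comp c, fun x => ?_⟩
  change e.symm (c _) = m x
  rw [RingEquiv.symm_apply_eq]
  exact Subtype.ext (h x)

theorem galConj_of {k L M X : Type} [Field k] [Field L] [Field M] [Algebra ℚ M] [IsGalois ℚ M]
    (f f' : X → k) (ι : k →+* L) (ι' : M →+* L) (α : M ≃+* M) (m : X → M)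
    (h : ∀ x, ι (f x) = ι' (m x)) (h' : ∀ x, ι (f' x) = ι' (α (m x))) : IsGaloisConj f f' := by
  obtain ⟨i, hi⟩ := exists_lift_charField f ι ι' m h
  obtain ⟨j, hj⟩ := exists_lift_charField f' ι ι' _ h'
  exact ⟨M, _, _, inferInstance, i, j, α, fun x => by rw [hi, hj]⟩

/-- spectral decomposition of an operator of finite order -/
theorem spec {L V : Type} [Field L] [CharZero L] [AddCommGroup V] [Module L V]
    [FiniteDimensional L V] {N : ℕ} (hN : 0 < N) {ζ : L} (hζ : IsPrimitiveRoot ζ N)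
    (A : Module.End L V) (hA : A ^ N = 1) :
    ∃ d : ℕ → ℕ, (∀ i, LinearMap.trace L V (A ^ i) =
      ∑ j ∈ Finset.range N, (d j : L) * ζ ^ (i * j)) ∧
      (Polynomial.aeval A (Polynomial.cyclotomic N L) = 0 → ∀ j, d j ≠ 0 → j.Coprime N) := by
  have hN0 : (N : L) ≠ 0 := Nat.cast_ne_zero.2 hN.ne'
  have hz0 : ζ ≠ 0 := hζ.ne_zero hN.ne'
  let B : ℕ → Module.End L V := fun j => (ζ⁻¹ ^ j) • A
  have hB : ∀ j, B j ^ N = 1 := by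
    intro j
    simp only [B]
    rw [smul_pow, hA, ← pow_mul, mul_comm, pow_mul, inv_pow, hζ.pow_eq_one]
    simp
  let e : ℕ → Module.End L V := fun j => (N : L)⁻¹ • ∑ i ∈ Finset.range N, B j ^ i
  have hBe : ∀ j, B j * e j = e j := by
    intro j
    have h1 := mul_geom_sum (B j) N
    rw [hB, sub_self, sub_mul, one_mul, sub_eq_zero] at h1
    simp only [e]
    rw [mul_smul_comm, h1]
  have hAe : ∀ j, A * e j = ζ ^ j • e j := by
    intro j
    conv_rhs => rw [← hBe j]
    simp only [B]
    rw [smul_mul_assoc, smul_smul, ← mul_pow, mul_inv_cancel₀ hz0, one_pow, one_smul]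
  have hAie : ∀ i j, A ^ i * e j = ζ ^ (i * j) • e j := by
    intro i j
    induction i with
    | zero => simp
    | succ i ih =>
      rw [pow_succ', mul_assoc, ih, mul_smul_comm, hAe, smul_smul, ← pow_add]
      congr 2; ring
  have hBie : ∀ i j, B j ^ i * e j = e j := by
    intro i j
    induction i with
    | zero => simp
    | succ i ih => rw [pow_succ', mul_assoc, ih, hBe]
  have hee : ∀ j, e j * e j = e j := by
    intro j
    conv_lhs => enter [1]; simp only [e]
    rw [smul_mul_assoc, Finset.sum_mul, Finset.sum_congr rfl (fun i _ => hBie i j),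
      Finset.sum_const, Finset.card_range, ← Nat.cast_smul_eq_nsmul L, smul_smul,
      inv_mul_cancel₀ hN0, one_smul]
  have hsum : ∑ j ∈ Finset.range N, e j = 1 := by
    simp only [e]
    rw [← Finset.smul_sum, Finset.sum_comm]
    have h1 : ∀ i ∈ Finset.range N, ∑ j ∈ Finset.range N, B j ^ i =
        if i = 0 then (N : L) • (1 : Module.End L V) else 0 := by
      intro i hi
      split_ifs with h
      · subst h; simp [Nat.cast_smul_eq_nsmul]
      · have h2 : ∀ j, B j ^ i = ((ζ⁻¹ ^ i) ^ j) • A ^ i := by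
          intro j; simp only [B]; rw [smul_pow, ← pow_mul, ← pow_mul, mul_comm]
        rw [Finset.sum_congr rfl (fun j _ => h2 j), ← Finset.sum_smul]
        have h3 := mul_geom_sum (ζ⁻¹ ^ i) N
        have hx : (ζ⁻¹ ^ i) ^ N = 1 := by
          rw [← pow_mul, mul_comm, pow_mul, inv_pow, hζ.pow_eq_one]; simp
        rw [hx, sub_self, mul_eq_zero] at h3
        rcases h3 with h3 | h3
        · exfalso
          rw [sub_eq_zero, inv_pow, inv_eq_one] at h3
          exact hζ.pow_ne_one_of_pos_of_lt h (Finset.mem_range.1 hi) h3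
        · rw [h3, zero_smul]
    rw [Finset.sum_congr rfl h1, Finset.sum_ite_eq' (Finset.range N) 0, if_pos (by simpa using hN),
      smul_smul, inv_mul_cancel₀ hN0, one_smul]
  refine ⟨fun j => Module.finrank L (LinearMap.range (e j)), ?_, ?_⟩
  · intro i
    have htr : ∀ j, LinearMap.trace L V (e j) = Module.finrank L (LinearMap.range (e j)) := by
      intro j
      have he : IsIdempotentElem (e j) := hee j
      exact (LinearMap.IsIdempotentElem.isProj_range _ he).trace
    calc LinearMap.trace L V (A ^ i) = LinearMap.trace L V (A ^ i * ∑ j ∈ Finset.range N, e j) := by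
          rw [hsum, mul_one]
      _ = _ := by
          rw [Finset.mul_sum, map_sum]
          refine Finset.sum_congr rfl fun j _ => ?_
          rw [hAie, map_smul, htr, smul_eq_mul, mul_comm]
  · intro hc j hj
    have hne : e j ≠ 0 := by
      intro h
      apply hj
      simp [h]
    have h1 : ∀ P : Polynomial L, Polynomial.aeval A P * e j = P.eval (ζ ^ j) • e j := by
      intro P
      induction P using Polynomial.induction_on' with
      | add p q hp hq => rw [map_add, add_mul, hp, hq, Polynomial.eval_add, add_smul]
      | monomial n c =>
        rw [Polynomial.aeval_monomial, mul_assoc, hAie, Polynomial.eval_monomial,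
          ← Algebra.smul_def, smul_smul, ← pow_mul, mul_comm n]
    have h2 := h1 (Polynomial.cyclotomic N L)
    rw [hc, zero_mul, eq_comm, smul_eq_zero] at h2
    have h3 := h2.resolve_right hne
    have : NeZero (N : L) := ⟨hN0⟩
    have h4 := Polynomial.isRoot_cyclotomic_iff.1 h3
    exact (hζ.pow_iff_coprime hN j).1 h4

end Genotype

namespace Genotype

theorem geom_root {L : Type} [Field L] {N : ℕ} {ζ : L} (hζ : IsPrimitiveRoot ζ N) (c : ℕ) :
    ∑ i ∈ Finset.range N, ζ ^ (i * c) = if N ∣ c then (N : L) else 0 := by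
  have h0 : ∀ i, ζ ^ (i * c) = (ζ ^ c) ^ i := fun i => by rw [← pow_mul, mul_comm]
  simp only [h0]
  split_ifs with h
  · rw [(hζ.pow_eq_one_iff_dvd c).2 h]; simp
  · have h3 := mul_geom_sum (ζ ^ c) N
    have hx : (ζ ^ c) ^ N = 1 := by rw [← pow_mul, mul_comm, pow_mul, hζ.pow_eq_one, one_pow]
    rw [hx, sub_self, mul_eq_zero] at h3
    refine h3.resolve_left fun h4 => h ?_
    rw [sub_eq_zero] at h4
    exact (hζ.pow_eq_one_iff_dvd c).1 h4

theorem schur_trace {k R V W : Type} [Field k] [Group R] [AddCommGroup V] [Module k V]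
    [AddCommGroup W] [Module k W] {φ : Representation k R V} {ω : Representation k R W}
    (hφ : Irr φ) (hω : Irr ω) (T : φ.IntertwiningMap ω) (hT : T ≠ 0) :
    ∃ e : V ≃ₗ[k] W, ∀ g, ω g = e.conj (φ g) := by
  have hTg : ∀ g v, T.toLinearMap (φ g v) = ω g (T.toLinearMap v) := fun g v =>
    LinearMap.congr_fun (T.isIntertwining' g) v
  have hk : LinearMap.ker T.toLinearMap = ⊥ := by
    refine (hφ.2 (LinearMap.ker T.toLinearMap) fun g x hx => ?_).resolve_right fun h => ?_
    · rw [LinearMap.mem_ker] at hx ⊢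
      rw [hTg, hx, map_zero]
    · apply hT
      rw [LinearMap.ker_eq_top] at h
      ext v
      exact LinearMap.congr_fun h v
  have hr : LinearMap.range T.toLinearMap = ⊤ := by
    refine (hω.2 (LinearMap.range T.toLinearMap) fun g x hx => ?_).resolve_left fun h => ?_
    · obtain ⟨v, rfl⟩ := hx
      exact ⟨φ g v, hTg g v⟩
    · apply hT
      rw [LinearMap.range_eq_bot] at h
      ext v
      exact LinearMap.congr_fun h v
  let e := LinearEquiv.ofBijective T.toLinearMap ⟨LinearMap.ker_eq_bot.1 hk, LinearMap.range_eq_top.1 hr⟩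
  refine ⟨e, fun g => ?_⟩
  ext w
  obtain ⟨v, rfl⟩ := e.surjective w
  rw [LinearEquiv.conj_apply_apply, LinearEquiv.symm_apply_apply]
  exact (hTg g v).symm

theorem spec' {k V : Type} [Field k] [CharZero k] [AddCommGroup V] [Module k V]
    [FiniteDimensional k V] {N : ℕ} (hN : 0 < N) {ζ : AlgebraicClosure k}
    (hζ : IsPrimitiveRoot ζ N) (A : Module.End k V) (hA : A ^ N = 1)
    (hc : Polynomial.aeval A (Polynomial.cyclotomic N k) = 0) :
    ∃ d : ℕ → ℕ, (∀ i, algebraMap k (AlgebraicClosure k) (LinearMap.trace k V (A ^ i)) =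
      ∑ j ∈ Finset.range N, (d j : AlgebraicClosure k) * ζ ^ (i * j)) ∧
      (∀ j, d j ≠ 0 → j.Coprime N) := by
  let L := AlgebraicClosure k
  let F := Module.End.baseChangeHom k L V
  have hF : ∀ T : Module.End k V, F T = T.baseChange L := fun T => rfl
  obtain ⟨d, h1, h2⟩ := spec hN hζ (F A) (by rw [← map_pow, hA, map_one])
  refine ⟨d, fun i => ?_, h2 ?_⟩
  · rw [← h1, ← map_pow, hF, LinearMap.trace_baseChange]
  · rw [← Polynomial.map_cyclotomic N (algebraMap k L), Polynomial.aeval_map_algebraMap,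
      Polynomial.aeval_algHom_apply, hc, map_zero]

theorem exists_v {N j l : ℕ} (hN : 0 < N) (hj : j.Coprime N) (hl : l.Coprime N) :
    ∃ v : ℕ, v.Coprime N ∧ N ∣ v * j + (N - 1) * l := by
  have : NeZero N := ⟨hN.ne'⟩
  let v := ZMod.unitOfCoprime l hl * (ZMod.unitOfCoprime j hj)⁻¹
  refine ⟨(v : ZMod N).val, ZMod.val_coe_unit_coprime v, ?_⟩
  rw [← ZMod.natCast_eq_zero_iff]
  have h1 : (v : ZMod N) * j = l := by
    have : v * ZMod.unitOfCoprime j hj = ZMod.unitOfCoprime l hl := by simp [v]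
    have := congrArg Units.val this
    simpa using this
  push_cast [Nat.cast_sub hN]
  rw [ZMod.natCast_zmod_val, h1]
  simp

theorem galois_lemma {k R V W : Type} [Field k] [CharZero k] [Group R] [Fintype R]
    [AddCommGroup V] [Module k V] [FiniteDimensional k V]
    [AddCommGroup W] [Module k W] [FiniteDimensional k W]
    {φ : Representation k R V} {ω : Representation k R W}
    (hφ : Irr φ) (hω : Irr ω) {a : R} {N : ℕ} (hN : 0 < N) (ha : orderOf a = N)
    (haut : ∀ u, u.Coprime N → ∃ e : R ≃* R, e a = a ^ u)
    (hv : ∀ g, g ∉ Subgroup.zpowers a → LinearMap.trace k V (φ g) = 0)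
    (hcφ : Polynomial.aeval (φ a) (Polynomial.cyclotomic N k) = 0)
    (hcω : Polynomial.aeval (ω a) (Polynomial.cyclotomic N k) = 0) :
    IsGaloisConj (fun g => LinearMap.trace k V (φ g)) (fun g => LinearMap.trace k W (ω g)) := by
  have hne : NeZero N := ⟨hN.ne'⟩
  let L := AlgebraicClosure k
  let M := CyclotomicField N ℚ
  have hneQ : NeZero (N : ℚ) := ⟨by exact_mod_cast hN.ne'⟩
  have hcyc : IsCyclotomicExtension {N} ℚ M := CyclotomicField.isCyclotomicExtension N ℚ
  have hzp : ∀ g ∈ Subgroup.zpowers a, ∃ i < N, a ^ i = g := by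
    intro g hg
    have := (mem_zpowers_iff_mem_range_orderOf (x := a) (y := g)).1 hg
    simpa [ha] using this
  have hGal : IsGalois ℚ M := IsCyclotomicExtension.isGalois {N} ℚ M
  let ι' : M →+* L := (IsAlgClosed.lift : M →ₐ[ℚ] L).toRingHom
  let z : M := IsCyclotomicExtension.zeta N ℚ M
  have hz : IsPrimitiveRoot z N := IsCyclotomicExtension.zeta_spec N ℚ M
  let ζ : L := ι' z
  have hζ : IsPrimitiveRoot ζ N := hz.map_of_injective ι'.injective
  have haN : a ^ N = 1 := by rw [← ha, pow_orderOf_eq_one]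
  obtain ⟨d, hd1, hd2⟩ := spec' hN hζ (φ a) (by rw [← map_pow, haN, map_one]) hcφ
  obtain ⟨d', hd1', hd2'⟩ := spec' hN hζ (ω a) (by rw [← map_pow, haN, map_one]) hcω
  have hV := hφ.1
  have hW := hω.1
  have hex : ∃ j ∈ Finset.range N, d j ≠ 0 := by
    by_contra! h
    have := hd1 0
    rw [Finset.sum_eq_zero (fun j hj => by rw [h j hj]; simp)] at this
    simp [Module.finrank_pos.ne'] at this
  have hex' : ∃ j ∈ Finset.range N, d' j ≠ 0 := by
    by_contra! h
    have := hd1' 0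
    rw [Finset.sum_eq_zero (fun j hj => by rw [h j hj]; simp)] at this
    simp [Module.finrank_pos.ne'] at this
  obtain ⟨j, hjN, hj⟩ := hex
  obtain ⟨l, hlN, hl⟩ := hex'
  obtain ⟨v, hvc, hvd⟩ := exists_v hN (hd2 j hj) (hd2' l hl)
  obtain ⟨e, he⟩ := haut v hvc
  have hemem : ∀ g, g ∉ Subgroup.zpowers a → e g ∉ Subgroup.zpowers a := by
    intro g hg hg'
    apply hg
    have hsub : (Subgroup.zpowers a).map e.toMonoidHom ≤ Subgroup.zpowers a := by
      rw [MonoidHom.map_zpowers, Subgroup.zpowers_le]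
      change e a ∈ _
      rw [he]; exact pow_mem (Subgroup.mem_zpowers a) v
    have hcard : Nat.card ((Subgroup.zpowers a).map e.toMonoidHom) = Nat.card (Subgroup.zpowers a) :=
      Nat.card_congr ((Subgroup.zpowers a).equivMapOfInjective _ e.injective).toEquiv.symm
    have heq := Subgroup.eq_of_le_of_card_ge hsub hcard.ge
    rw [← heq] at hg'
    obtain ⟨g', h1, h2⟩ := hg'
    rwa [← e.injective h2]
  let φe : Representation k R V := φ.comp e.toMonoidHom
  have hφe : Irr φe := by
    refine ⟨hφ.1, fun U hU => hφ.2 U fun g x hx => ?_⟩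
    have := hU (e.symm g) x hx
    simpa [φe] using this
  have : Invertible (Nat.card R : k) := invertibleOfNonzero (by
    exact_mod_cast Nat.card_pos.ne')
  have hpair := Representation.card_inv_mul_sum_char_mul_char_eq_finrank ω φe
  have hsum : ∑ g, φe.character g * ω.character g⁻¹ ≠ 0 := by
    have h1 : ∑ g, φe.character g * ω.character g⁻¹ = ∑ i ∈ Finset.range N,
        LinearMap.trace k V (φ a ^ (i * v)) * LinearMap.trace k W (ω a ^ (i * (N - 1))) := by
      symm
      refine Finset.sum_of_injOn (fun i => a ^ i) ?_ ?_ ?_ ?_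
      · intro i hi j hj hij
        rw [Finset.coe_range, Set.mem_Iio] at hi hj
        exact pow_injOn_Iio_orderOf (by rwa [ha]) (by rwa [ha]) hij
      · intro i _; simp
      · intro g _ hg
        have : g ∉ Subgroup.zpowers a := by
          intro h
          apply hg
          obtain ⟨i, hi, rfl⟩ := hzp g h
          exact ⟨i, by simpa using hi, rfl⟩
        have h2 : φe.character g = 0 := hv _ (hemem g this)
        rw [h2, zero_mul]
      · intro i _
        have h2 : (a ^ i)⁻¹ = a ^ (i * (N - 1)) := by
          rw [inv_eq_iff_mul_eq_one, ← pow_add]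
          have : i + i * (N - 1) = N * i := by
            obtain ⟨n, rfl⟩ := Nat.exists_eq_succ_of_ne_zero hN.ne'
            simp; ring
          rw [this, pow_mul, haN, one_pow]
        rw [h2]
        change _ = LinearMap.trace k V (φ (e (a ^ i))) * LinearMap.trace k W (ω _)
        rw [map_pow e, he, ← pow_mul, map_pow φ, map_pow ω, mul_comm v]
    rw [h1]
    intro h
    have h2 := congrArg (algebraMap k L) h
    rw [map_zero, map_sum] at h2
    simp only [map_mul] at h2
    have h3 : ∀ i, algebraMap k L (LinearMap.trace k V (φ a ^ (i * v))) *
        algebraMap k L (LinearMap.trace k W (ω a ^ (i * (N - 1)))) =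
        ∑ j ∈ Finset.range N, ∑ l ∈ Finset.range N, (d j : L) * d' l * ζ ^ (i * (v * j + (N - 1) * l)) := by
      intro i
      rw [hd1, hd1', Finset.sum_mul_sum]
      refine Finset.sum_congr rfl fun j _ => Finset.sum_congr rfl fun l _ => ?_
      rw [show i * (v * j + (N - 1) * l) = i * v * j + i * (N - 1) * l by ring, pow_add]
      ring
    simp only [h3] at h2
    rw [Finset.sum_comm] at h2
    have h4 : ∀ j, ∑ i ∈ Finset.range N, ∑ l ∈ Finset.range N,
        (d j : L) * d' l * ζ ^ (i * (v * j + (N - 1) * l)) =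
        ((∑ l ∈ Finset.range N, if N ∣ v * j + (N - 1) * l then d j * d' l * N else 0 : ℕ) : L) := by
      intro j
      rw [Finset.sum_comm]
      rw [Nat.cast_sum (R := L)]
      refine Finset.sum_congr rfl fun l _ => ?_
      rw [← Finset.mul_sum, geom_root hζ]
      split_ifs <;> simp
    simp only [h4] at h2
    rw [← Nat.cast_sum (R := L), Nat.cast_eq_zero, Finset.sum_eq_zero_iff] at h2
    have h5 := h2 j hjN
    rw [Finset.sum_eq_zero_iff] at h5
    have h6 := h5 l hlN
    rw [if_pos hvd] at h6
    simp [hj, hl, hN.ne'] at h6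
  have hT : ∃ T : ω.IntertwiningMap φe, T ≠ 0 := by
    by_contra! h
    have : Subsingleton (ω.IntertwiningMap φe) := ⟨fun a b => by rw [h a, h b]⟩
    rw [Module.finrank_zero_of_subsingleton, Nat.cast_zero, mul_eq_zero] at hpair
    rcases hpair with h | h
    · rw [inv_eq_zero] at h
      exact absurd h (by exact_mod_cast Nat.card_pos.ne')
    · exact hsum h
  obtain ⟨T, hT⟩ := hT
  obtain ⟨E, hE⟩ := schur_trace hω hφe T hT
  have hchar : ∀ g, LinearMap.trace k W (ω g) = LinearMap.trace k V (φ (e g)) := by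
    intro g
    have := hE g
    change φ (e g) = _ at this
    rw [this, LinearMap.trace_conj']
  have hirr : Irreducible (Polynomial.cyclotomic N ℚ) := Polynomial.cyclotomic.irreducible_rat hN
  have hzv : IsPrimitiveRoot (z ^ v) N := hz.pow_of_coprime v hvc
  let α : M ≃+* M := (IsCyclotomicExtension.fromZetaAut hzv hirr).toRingEquiv
  have hα : α z = z ^ v := IsCyclotomicExtension.fromZetaAut_spec hzv hirr
  have hi : ∀ g : R, ∃ i : ℕ, g ∈ Subgroup.zpowers a → a ^ i = g := by
    intro g
    by_cases h : g ∈ Subgroup.zpowers a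
    · obtain ⟨i, hi, rfl⟩ := hzp g h
      exact ⟨i, fun _ => rfl⟩
    · exact ⟨0, fun h' => absurd h' h⟩
  choose i hi using hi
  have hn1 : ∀ n : ℕ, ι' (n : M) = (n : L) := fun n => map_natCast ι' n
  have hn2 : ∀ n : ℕ, α (n : M) = (n : M) := fun n => map_natCast α n
  refine galConj_of (L := L) (M := M) _ _ (algebraMap k L) ι' α
    (fun g => if g ∈ Subgroup.zpowers a then ∑ j ∈ Finset.range N, (d j : M) * z ^ (i g * j) else 0) ?_ ?_
  · intro g
    split_ifs with h
    · rw [← hi g h, map_pow, hd1, map_sum, hi g h]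
      refine Finset.sum_congr rfl fun j _ => ?_
      rw [map_mul, map_pow, hn1]
    · rw [hv g h]; simp
  · intro g
    rw [hchar]
    split_ifs with h
    · have : e g = a ^ (i g * v) := by
        conv_lhs => rw [← hi g h]
        rw [map_pow, he, ← pow_mul, mul_comm]
      rw [this, map_pow, hd1, map_sum, map_sum]
      refine Finset.sum_congr rfl fun j _ => ?_
      rw [map_mul, map_mul, map_pow, map_pow, hα, hn2, hn1, map_pow, ← pow_mul]
      congr 1
      congr 1; ring
    · rw [hv _ (hemem g h)]; simp

end Genotype

namespace Genotype

structure RD (p m : ℕ) (R : Type) [Group R] (a : R) : Prop where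
  ord : orderOf a = p ^ m
  aut : ∀ u, u.Coprime (p ^ m) → ∃ e : R ≃* R, e a = a ^ u
  cen : 1 ≤ m → ∀ g, g * a ^ (p ^ (m - 1)) = a ^ (p ^ (m - 1)) * g
  van : ∀ (k V : Type) [Field k] [CharZero k] [AddCommGroup V] [Module k V]
    (φ : Representation k R V), Polynomial.aeval (φ a) (Polynomial.cyclotomic (p ^ m) k) = 0 →
    ∀ g, g ∉ Subgroup.zpowers a → LinearMap.trace k V (φ g) = 0
  alt : (∀ g, g ∈ Subgroup.zpowers a) ∨
    (p = 2 ∧ ∃ s t x, TwoPar m s t ∧ TwoGen (2 ^ m) s t a x)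

theorem aeval_cyc_two {k A : Type} [Field k] [Ring A] [Algebra k A] (a : A) {m : ℕ} (hm : 1 ≤ m) :
    Polynomial.aeval a (Polynomial.cyclotomic (2 ^ m) k) = a ^ (2 ^ (m - 1)) + 1 := by
  obtain ⟨n, rfl⟩ := Nat.exists_eq_add_of_le' hm
  rw [Polynomial.cyclotomic_prime_pow_eq_geom_sum Nat.prime_two]
  simp [Finset.sum_range_succ, add_comm]

theorem aeval_cyc_pp {k A : Type} [Field k] [Ring A] [Algebra k A] (a : A) {p m : ℕ}
    (hp : p.Prime) (hm : 1 ≤ m) :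
    Polynomial.aeval a (Polynomial.cyclotomic (p ^ m) k) =
      ∑ i ∈ Finset.range p, (a ^ (p ^ (m - 1))) ^ i := by
  obtain ⟨n, rfl⟩ := Nat.exists_eq_add_of_le' hm
  rw [Polynomial.cyclotomic_prime_pow_eq_geom_sum hp]
  simp

/-- arithmetic of the parameters -/
theorem TwoPar.arith {m s t : ℕ} (h : TwoPar m s t) :
    ∃ q : ℕ, 1 ≤ q ∧ 2 ^ m = 4 * q ∧ 2 ^ (m - 1) = 2 * q ∧
    ((∃ c, q * s = q * 3 + 4 * q * c)) ∧ (∃ c, s = 2 * c + 1) ∧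
    (t = 0 ∨ t = 2 * q) ∧ (s = 4 * q - 1 ∨ (s = 2 * q - 1 ∧ 2 ≤ q ∧ ∃ c, q = 2 * c)) := by
  obtain ⟨hm, h⟩ := h
  obtain ⟨n, rfl⟩ := Nat.exists_eq_add_of_le' hm
  have e1 : 2 ^ (n + 2) = 4 * 2 ^ n := by ring
  have e2 : 2 ^ (n + 2 - 1) = 2 * 2 ^ n := by
    rw [show n + 2 - 1 = n + 1 by omega]; ring
  have e3 : 1 ≤ 2 ^ n := Nat.one_le_two_pow
  rw [e1, e2] at h
  refine ⟨2 ^ n, e3, e1, e2, ?_⟩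
  generalize hq : 2 ^ n = q at *
  have hodd : 3 ≤ n + 2 → ∃ c, q = 2 * c ∧ 1 ≤ c := by
    intro h3
    obtain ⟨l, rfl⟩ := Nat.exists_eq_add_of_le' (show 1 ≤ n by omega)
    exact ⟨2 ^ l, by rw [← hq]; ring, Nat.one_le_two_pow⟩
  have hs1 : s = 4 * q - 1 → (∃ c, q * s = q * 3 + 4 * q * c) ∧ (∃ c, s = 2 * c + 1) := by
    rintro rfl
    refine ⟨⟨q - 1, ?_⟩, 2 * q - 1, by omega⟩
    obtain ⟨r, rfl⟩ := Nat.exists_eq_add_of_le' e3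
    rw [show 4 * (r + 1) - 1 = 4 * r + 3 by omega, show r + 1 - 1 = r by omega]; ring
  rcases h with ⟨h1, h2, h3⟩ | ⟨h1, h2⟩ | ⟨h1, h2, h3⟩
  · exact ⟨(hs1 h1).1, (hs1 h1).2, Or.inl h2, Or.inl h1⟩
  · exact ⟨(hs1 h1).1, (hs1 h1).2, Or.inr h2, Or.inl h1⟩
  · obtain ⟨c, hc, hc1⟩ := hodd h3
    refine ⟨⟨c - 1, ?_⟩, ⟨q - 1, by omega⟩, Or.inl h2, Or.inr ⟨h1, by omega, c, hc⟩⟩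
    obtain ⟨r, rfl⟩ := Nat.exists_eq_add_of_le' hc1
    rw [h1, hc, show 2 * (2 * (r + 1)) - 1 = 4 * r + 3 by omega, show r + 1 - 1 = r by omega]; ring

theorem RD_two {R : Type} [Group R] {m s t : ℕ} {a x : R} (hp : TwoPar m s t)
    (h : TwoGen (2 ^ m) s t a x) : RD 2 m R a := by
  obtain ⟨q, hq, e1, e2, ⟨c, hc⟩, ⟨c', hc'⟩, ht, hs⟩ := hp.arith
  have haN : a ^ (4 * q) = 1 := by rw [← e1, ← h.1, pow_orderOf_eq_one]
  refine ⟨h.1, ?_, ?_, ?_, Or.inr ⟨rfl, s, t, x, hp, h⟩⟩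
  · intro u hu
    refine twoGen_aut (by positivity) h hu ?_
    rcases ht with rfl | rfl
    · simp [Nat.ModEq]
    · have : u % 2 = 1 := by
        rw [← Nat.odd_iff]
        rw [← Nat.coprime_two_right]
        exact Nat.Coprime.coprime_dvd_right (dvd_pow_self 2 (by have := hp.1; omega)) hu
      obtain ⟨w, rfl⟩ : ∃ w, u = 2 * w + 1 := ⟨u / 2, by omega⟩
      rw [e1, show 2 * q * (2 * w + 1) = 2 * q + 4 * q * w by ring]
      simp [Nat.ModEq]
  · intro hm g
    rw [e2]
    have hx : x * a ^ (2 * q) = a ^ (2 * q) * x := by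
      have := h.comm ((2 * q : ℕ) : ℤ)
      rw [zpow_natCast, ← Nat.cast_mul, zpow_natCast] at this
      rw [this, hc', show (2 * c' + 1) * (2 * q) = 2 * q + 4 * q * c' by ring, pow_add, pow_mul a (4*q), haN,
        one_pow, mul_one]
    obtain ⟨i, rfl | rfl⟩ := h.form g
    · exact ((Commute.refl a).zpow_left i).pow_right _
    · rw [mul_assoc, hx, ← mul_assoc, ← mul_assoc]
      congr 1
      exact ((Commute.refl a).zpow_left i).pow_right _
  · intro k V _ _ _ _ φ hφ g hg
    rw [aeval_cyc_two _ (by have := hp.1; omega), e2] at hφ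
    have hm1 : φ (a ^ (2 * q)) = -1 := by rw [map_pow]; exact eq_neg_of_add_eq_zero_left hφ
    obtain ⟨i, rfl | rfl⟩ := h.form g
    · exact absurd (zpow_mem (Subgroup.mem_zpowers a) i) hg
    have hb : a ^ q * (a ^ i * x) * (a ^ q)⁻¹ = a ^ (2 * q) * (a ^ i * x) := by
      rw [mul_inv_eq_iff_eq_mul]
      have hx : x * a ^ q = a ^ (3 * q) * x := by
        have := h.comm ((q : ℕ) : ℤ)
        rw [zpow_natCast, ← Nat.cast_mul, zpow_natCast] at this
        rw [this, mul_comm s, hc, pow_add, pow_mul a (4*q), haN,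
          one_pow, mul_one, mul_comm 3]
      have hq3 : a ^ (2 * q) * a ^ (3 * q) = a ^ q := by
        rw [← pow_add, show 2 * q + 3 * q = 4 * q + q by ring, pow_add, haN, one_mul]
      have hcom : a ^ i * a ^ (3 * q) = a ^ (3 * q) * a ^ i :=
        ((Commute.refl a).zpow_left i).pow_right _
      rw [mul_assoc, mul_assoc, hx, ← mul_assoc (a ^ i), hcom, mul_assoc, ← mul_assoc (a ^ (2 * q)), hq3]
    have h1 : LinearMap.trace k V (φ (a ^ q * (a ^ i * x) * (a ^ q)⁻¹)) =
        LinearMap.trace k V (φ (a ^ i * x)) := by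
      rw [map_mul, LinearMap.trace_mul_comm, ← map_mul]
      congr 2; group
    rw [hb, map_mul, hm1, neg_one_mul, map_neg] at h1
    have h2 : (2 : k) * LinearMap.trace k V (φ (a ^ i * x)) = 0 := by linear_combination -h1
    simpa using h2

theorem exists_RD {p : ℕ} (hp : p.Prime) {R : Type} [Group R] [Finite R] (hR : IsPGroup p R)
    (h : IsRoquette R) : ∃ m a, RD p m R a := by
  rcases roquette_class hp hR h with ⟨m, a, h1, h2⟩ | ⟨rfl, m, s, t, a, x, h1, h2⟩
  · refine ⟨m, a, h1, fun u hu => cyc_aut (pow_pos hp.pos m) h1 h2 hu, ?_, ?_, Or.inl h2⟩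
    · intro _ g
      obtain ⟨i, rfl⟩ := h2 g
      exact ((Commute.refl a).zpow_left i).pow_right _
    · intro k V _ _ _ _ φ _ g hg
      exact absurd (h2 g) hg
  · exact ⟨m, a, RD_two h1 h2⟩

theorem RD.faithful {p m : ℕ} (hp : p.Prime) {R : Type} [Group R] {a : R} (h : RD p m R a)
    {k V : Type} [Field k] [CharZero k] [AddCommGroup V] [Module k V] (φ : Representation k R V)
    (hφ : Irr φ) (hf : Function.Injective φ) :
    Polynomial.aeval (φ a) (Polynomial.cyclotomic (p ^ m) k) = 0 := by
  rcases Nat.eq_zero_or_pos m with rfl | hm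
  · have : a = 1 := by
      have := h.ord
      simpa using this
    simp [this]
  rw [aeval_cyc_pp _ hp hm, ← map_pow]
  set z := a ^ (p ^ (m - 1)) with hz
  have hzp : z ^ p = 1 := by
    rw [hz, ← pow_mul, ← pow_succ, show m - 1 + 1 = m by omega, ← h.ord, pow_orderOf_eq_one]
  have hz1 : z ≠ 1 := by
    rw [hz]
    refine pow_ne_one_of_lt_orderOf (pow_pos hp.pos _).ne' ?_
    rw [h.ord]
    exact Nat.pow_lt_pow_right hp.one_lt (by omega)
  have hU : LinearMap.ker (φ z - 1) = ⊥ := by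
    refine (hφ.2 _ fun g x hx => ?_).resolve_right fun ht => hz1 ?_
    · rw [LinearMap.mem_ker] at hx ⊢
      rw [LinearMap.sub_apply, Module.End.one_apply, sub_eq_zero] at hx ⊢
      rw [← Module.End.mul_apply, ← map_mul, ← h.cen hm, map_mul, Module.End.mul_apply, hx]
    · rw [LinearMap.ker_eq_top, sub_eq_zero] at ht
      exact hf (by rw [ht, map_one])
  have h1 := mul_geom_sum (φ z) p
  rw [← map_pow, hzp, map_one, sub_self] at h1
  ext v
  have h2 := LinearMap.congr_fun h1 v
  rw [Module.End.mul_apply] at h2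
  have h3 : (∑ i ∈ Finset.range p, φ z ^ i) v ∈ LinearMap.ker (φ z - 1) := h2
  rw [hU] at h3
  simpa using h3

end Genotype

namespace Genotype

def K1 {H : Type} [Group H] (K : Subgroup H) [K.Normal] (p m : ℕ) (a : H ⧸ K) : Subgroup H :=
  (Subgroup.zpowers (a ^ (p ^ (m - 1)))).comap (QuotientGroup.mk' K)

theorem RD.cen' {p m : ℕ} {R : Type} [Group R] {a : R} (h : RD p m R a) (g : R) :
    g * a ^ (p ^ (m - 1)) = a ^ (p ^ (m - 1)) * g := by
  rcases Nat.eq_zero_or_pos m with rfl | hm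
  · have : a = 1 := by
      have := h.ord
      simpa using this
    simp [this]
  · exact h.cen hm g

theorem K1_le {H : Type} [Group H] (K : Subgroup H) [K.Normal] (p m : ℕ) (a : H ⧸ K) :
    K ≤ K1 K p m a := by
  intro x hx
  have : (QuotientGroup.mk' K) x = 1 := by simpa using hx
  rw [K1, Subgroup.mem_comap, this]
  exact one_mem _

theorem K1_normal {H : Type} [Group H] {K : Subgroup H} [K.Normal] {p m : ℕ} {a : H ⧸ K}
    (h : RD p m (H ⧸ K) a) : (K1 K p m a).Normal := by
  have : (Subgroup.zpowers (a ^ (p ^ (m - 1)))).Normal := by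
    refine ⟨fun n hn g => ?_⟩
    obtain ⟨i, rfl⟩ := hn
    have : Commute g (a ^ (p ^ (m - 1))) := h.cen' g
    have h2 := (this.zpow_right i).eq
    simp only
    rw [h2, mul_inv_cancel_right]
    exact ⟨i, rfl⟩
  exact Subgroup.Normal.comap this _

section
variable {k : Type} [Field k] [CharZero k] {H : Type} [Group H] [Fintype H]
  {V : Type} [AddCommGroup V] [Module k V]

def cop (ρ : Representation k H V) (K : Subgroup H) [K.Normal] (p m : ℕ) (a : H ⧸ K) :
    Module.End k V :=
  avg ρ K - (if m = 0 then 0 else avg ρ (K1 K p m a))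

variable (ρ : Representation k H V) (K : Subgroup H) [K.Normal] (p m : ℕ) (a : H ⧸ K)

theorem avg_cop : avg ρ K * cop ρ K p m a = cop ρ K p m a := by
  unfold cop
  split_ifs
  · simp [avg_idem]
  · rw [mul_sub, avg_idem, avg_mul_avg _ (K1_le K p m a)]

theorem cop_idem : cop ρ K p m a * cop ρ K p m a = cop ρ K p m a := by
  have h := avg_cop ρ K p m a
  conv_lhs => enter [1]; unfold cop
  rw [sub_mul, h]
  split_ifs with hm
  · simp
  · rw [sub_eq_self]
    unfold cop
    rw [if_neg hm, mul_sub, avg_mul_avg' _ (K1_le K p m a), avg_idem, sub_self]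

variable {K p m a}

theorem cop_comm (h : RD p m (H ⧸ K) a) (g : H) :
    ρ g * cop ρ K p m a = cop ρ K p m a * ρ g := by
  have := K1_normal h
  unfold cop
  split_ifs
  · simp [avg_comm ρ (normal_iff K g)]
  · rw [mul_sub, sub_mul, avg_comm ρ (normal_iff K g), avg_comm ρ (normal_iff _ g)]

theorem cop_spec (hp : p.Prime) (h : RD p m (H ⧸ K) a) (b : H) (hb : QuotientGroup.mk b = a) (v : V) :
    cop ρ K p m a v = v ↔ (∀ κ ∈ K, ρ κ v = v) ∧
      Polynomial.aeval (ρ b) (Polynomial.cyclotomic (p ^ m) k) v = 0 := by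
  have key : (∀ κ ∈ K, ρ κ v = v) → (cop ρ K p m a v = v ↔
      Polynomial.aeval (ρ b) (Polynomial.cyclotomic (p ^ m) k) v = 0) := by
    intro hK
    have hav : avg ρ K v = v := avg_fix ρ hK
    unfold cop
    rw [LinearMap.sub_apply, hav]
    split_ifs with hm
    · subst hm
      have ha : a = 1 := by
        have := h.ord
        simpa using this
      have : b ∈ K := by
        rw [ha] at hb
        exact (QuotientGroup.eq_one_iff b).1 hb
      simp [hK b this]
    · have hm : 1 ≤ m := by omega
      rw [aeval_cyc_pp _ hp hm, sub_eq_self]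
      set z := b ^ (p ^ (m - 1)) with hz
      have hzK1 : z ∈ K1 K p m a := by
        rw [K1, Subgroup.mem_comap, hz, map_pow]
        have : QuotientGroup.mk' K b = a := hb
        rw [this]
        exact Subgroup.mem_zpowers _
      have hzp : z ^ p ∈ K := by
        rw [← QuotientGroup.eq_one_iff, hz, ← pow_mul, ← pow_succ, show m - 1 + 1 = m by omega]
        have : ((b ^ p ^ m : H) : H ⧸ K) = (b : H ⧸ K) ^ p ^ m := rfl
        rw [this, hb, ← h.ord, pow_orderOf_eq_one]
      rw [← map_pow, ← hz]
      have hfixK : ∀ (g : H), ∀ κ ∈ K, ρ κ (ρ g v) = ρ g v := by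
        intro g κ hκ
        rw [← Module.End.mul_apply, ← map_mul, show κ * g = g * (g⁻¹ * κ * g) by group, map_mul,
          Module.End.mul_apply, hK]
        have := (inferInstance : K.Normal).conj_mem κ hκ g⁻¹
        simpa using this
      set w := (∑ i ∈ Finset.range p, ρ z ^ i) v with hw
      have hwz : ρ z w = w := by
        have h1 := mul_geom_sum (ρ z) p
        have h2 := LinearMap.congr_fun h1 v
        rw [← map_pow, Module.End.mul_apply, LinearMap.sub_apply, LinearMap.sub_apply, hK _ hzp,
          Module.End.one_apply, Module.End.one_apply, sub_self, sub_eq_zero] at h2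
        exact h2
      have hwK : ∀ κ ∈ K, ρ κ w = w := by
        intro κ hκ
        rw [hw, LinearMap.sum_apply, map_sum]
        refine Finset.sum_congr rfl fun i _ => ?_
        rw [← map_pow]
        exact hfixK _ κ hκ
      let S : Subgroup H :=
        { carrier := {g | ρ g w = w}
          one_mem' := by simp
          mul_mem' := by
            intro x y hx hy
            simp only [Set.mem_setOf_eq] at hx hy ⊢
            rw [map_mul, Module.End.mul_apply, hy, hx]
          inv_mem' := by
            intro x hx
            simp only [Set.mem_setOf_eq] at hx ⊢
            conv_lhs => rw [← hx]
            rw [← Module.End.mul_apply, ← map_mul]; simp }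
      have hwK1 : ∀ g ∈ K1 K p m a, ρ g w = w := by
        intro g hg
        obtain ⟨i, hi⟩ := hg
        have hi' : (QuotientGroup.mk (z ^ i) : H ⧸ K) = QuotientGroup.mk g := by
          have h1 : (QuotientGroup.mk' K) (z ^ i) = (QuotientGroup.mk' K) g := by
            rw [← hi, map_zpow, hz, map_pow]
            have : QuotientGroup.mk' K b = a := hb
            rw [this]
          exact h1
        rw [QuotientGroup.eq] at hi'
        have h1 : z ^ i * ((z ^ i)⁻¹ * g) ∈ S :=
          mul_mem (zpow_mem (show z ∈ S from hwz) i) (hwK _ hi')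
        rw [mul_inv_cancel_left] at h1
        exact h1
      have hw1 : avg ρ (K1 K p m a) w = w := avg_fix ρ hwK1
      have hw2 : avg ρ (K1 K p m a) w = (p : k) • avg ρ (K1 K p m a) v := by
        rw [hw, LinearMap.sum_apply, map_sum]
        have : ∀ i ∈ Finset.range p, avg ρ (K1 K p m a) ((ρ z ^ i) v) = avg ρ (K1 K p m a) v := by
          intro i _
          rw [← map_pow, ← Module.End.mul_apply, avg_rho ρ (pow_mem hzK1 i)]
        rw [Finset.sum_congr rfl this, Finset.sum_const, Finset.card_range, Nat.cast_smul_eq_nsmul]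
      rw [← hw1, hw2, smul_eq_zero]
      have hp0 : (p : k) ≠ 0 := Nat.cast_ne_zero.2 hp.ne_zero
      simp [hp0]
  constructor
  · intro hc
    have hK : ∀ κ ∈ K, ρ κ v = v := by
      intro κ hκ
      rw [← hc, ← avg_cop, Module.End.mul_apply, rho_avg_apply ρ hκ]
    exact ⟨hK, (key hK).1 hc⟩
  · rintro ⟨hK, h2⟩
    exact (key hK).2 h2

end

end Genotype

namespace Genotype

section
variable {k : Type} [Field k] [CharZero k] {H : Type} [Group H] [Fintype H]
  {V : Type} [AddCommGroup V] [Module k V] [FiniteDimensional k V]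

theorem avg_mem (ρ : Representation k H V) (Y : Subgroup H) (N : Submodule k V)
    (hN : ∀ h, ∀ x ∈ N, ρ h x ∈ N) {v : V} (hv : v ∈ N) : avg ρ Y v ∈ N := by
  rw [avg_apply]
  exact N.smul_mem _ (N.sum_mem fun y _ => hN _ _ hv)

theorem cop_mem (ρ : Representation k H V) (K : Subgroup H) [K.Normal] (p m : ℕ) (a : H ⧸ K)
    (N : Submodule k V) (hN : ∀ h, ∀ x ∈ N, ρ h x ∈ N) {v : V} (hv : v ∈ N) :
    cop ρ K p m a v ∈ N := by
  unfold cop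
  rw [LinearMap.sub_apply]
  refine N.sub_mem (avg_mem ρ _ N hN hv) ?_
  split_ifs
  · simp
  · exact avg_mem ρ _ N hN hv

theorem maschke (ρ : Representation k H V) (S : Submodule k V) (hS : ∀ h, ∀ x ∈ S, ρ h x ∈ S) :
    ∃ e : Module.End k V, e * e = e ∧ (∀ h, ρ h * e = e * ρ h) ∧ LinearMap.range e = S := by
  obtain ⟨π, hπ⟩ := S.exists_isCompl
  let P : Module.End k V := S.subtype ∘ₗ (S.projectionOnto π hπ)
  have hP : ∀ v, P v ∈ S := fun v => Subtype.coe_prop _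
  have hP' : ∀ v ∈ S, P v = v := fun v hv => by
    simp only [P, LinearMap.comp_apply, Submodule.subtype_apply]
    exact congrArg Subtype.val (Submodule.projectionOnto_apply_left hπ ⟨v, hv⟩)
  let e : Module.End k V := (Nat.card H : k)⁻¹ • ∑ x : H, ρ x * P * ρ x⁻¹
  have hne : (Nat.card H : k) ≠ 0 := Nat.cast_ne_zero.2 Nat.card_pos.ne'
  have he : ∀ v, e v = (Nat.card H : k)⁻¹ • ∑ x : H, ρ x (P (ρ x⁻¹ v)) := by
    intro v; simp [e, LinearMap.sum_apply]
  have heS : ∀ v, e v ∈ S := fun v => by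
    rw [he]
    exact S.smul_mem _ (S.sum_mem fun x _ => hS _ _ (hP _))
  have heS' : ∀ v ∈ S, e v = v := fun v hv => by
    rw [he]
    have : ∀ x ∈ (Finset.univ : Finset H), ρ x (P (ρ x⁻¹ v)) = v := by
      intro x _
      rw [hP' _ (hS _ _ hv), ← Module.End.mul_apply, ← map_mul]; simp
    rw [Finset.sum_congr rfl this, Finset.sum_const, Finset.card_univ, ← Nat.cast_smul_eq_nsmul k,
      smul_smul, ← Nat.card_eq_fintype_card, inv_mul_cancel₀ hne, one_smul]
  refine ⟨e, ?_, ?_, ?_⟩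
  · ext v
    exact heS' _ (heS v)
  · intro g
    simp only [e]
    rw [mul_smul_comm, smul_mul_assoc, Finset.mul_sum, Finset.sum_mul]
    congr 1
    refine Fintype.sum_equiv (Equiv.mulLeft g) _ _ ?_
    intro x
    have : ρ g⁻¹ * ρ g = 1 := by rw [← map_mul]; simp
    simp [mul_assoc, this]
  · apply le_antisymm
    · rintro _ ⟨v, rfl⟩; exact heS v
    · intro v hv; exact ⟨v, heS' v hv⟩

theorem exists_minimal (ρ : Representation k H V) (S : Submodule k V) (hS : ∀ h, ∀ x ∈ S, ρ h x ∈ S)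
    (hne : S ≠ ⊥) : ∃ T ≤ S, T ≠ ⊥ ∧ (∀ h, ∀ x ∈ T, ρ h x ∈ T) ∧
      ∀ U ≤ T, (∀ h, ∀ x ∈ U, ρ h x ∈ U) → U = ⊥ ∨ U = T := by
  let P : Submodule k V → Prop := fun T => T ≤ S ∧ T ≠ ⊥ ∧ (∀ h, ∀ x ∈ T, ρ h x ∈ T)
  obtain ⟨T, hT, hmin⟩ := WellFounded.has_min (wellFounded_lt (α := Submodule k V)) {T | P T}
    ⟨S, le_rfl, hne, hS⟩
  refine ⟨T, hT.1, hT.2.1, hT.2.2, fun U hU hU' => ?_⟩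
  by_cases h0 : U = ⊥
  · exact Or.inl h0
  · right
    by_contra hne'
    exact hmin U ⟨hU.trans hT.1, h0, hU'⟩ (lt_of_le_of_ne hU hne')

theorem rangeRep_irr (ρ : Representation k H V) (e : Module.End k V) (hc : ∀ h, ρ h * e = e * ρ h)
    (hne : LinearMap.range e ≠ ⊥)
    (hmin : ∀ U ≤ LinearMap.range e, (∀ h, ∀ x ∈ U, ρ h x ∈ U) → U = ⊥ ∨ U = LinearMap.range e) :
    Irr (rangeRep ρ e hc) := by
  refine ⟨(Submodule.nontrivial_iff_ne_bot).2 hne, fun U hU => ?_⟩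
  have := hmin (U.map (LinearMap.range e).subtype) (Submodule.map_subtype_le _ _) (by
    rintro h _ ⟨x, hx, rfl⟩
    exact ⟨rangeRep ρ e hc h x, hU h x hx, rangeRep_apply ρ e hc h x⟩)
  rcases this with h | h
  · left
    apply Submodule.map_injective_of_injective (Submodule.subtype_injective (LinearMap.range e))
    rw [h, Submodule.map_bot]
  · right
    apply Submodule.map_injective_of_injective (Submodule.subtype_injective (LinearMap.range e))
    rw [h, Submodule.map_subtype_top]

/-- galois conjugacy of irreps of `H` on which `cop` acts as the identity -/
theorem galois_cop {K : Subgroup H} [K.Normal] {p m : ℕ} {a : H ⧸ K} (hp : p.Prime)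
    (h : RD p m (H ⧸ K) a) {W : Type} [AddCommGroup W] [Module k W] [FiniteDimensional k W]
    (φ : Representation k (H ⧸ K) V) (hφ : Irr φ) (hf : Function.Injective φ)
    (ω : Representation k H W) (hω : Irr ω) (hc : ∀ w, cop ω K p m a w = w) :
    IsGaloisConj (fun g : H => LinearMap.trace k V (φ (QuotientGroup.mk g)))
      (fun g => LinearMap.trace k W (ω g)) := by
  obtain ⟨b, hb⟩ := QuotientGroup.mk_surjective a
  have hK : ∀ κ ∈ K, ω κ = 1 := fun κ hκ => LinearMap.ext fun w =>
    ((cop_spec ω hp h b hb w).1 (hc w)).1 κ hκ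
  obtain ⟨ω', hω'mk⟩ : ∃ ω' : Representation k (H ⧸ K) W,
      ∀ g : H, ω' (QuotientGroup.mk g) = ω g := ⟨QuotientGroup.lift K ω hK, fun g => rfl⟩
  have hω' : Irr ω' := ⟨hω.1, fun U hU => hω.2 U fun g x hx => by
    rw [← hω'mk]; exact hU (QuotientGroup.mk g) x hx⟩
  have hcω : Polynomial.aeval (ω' a) (Polynomial.cyclotomic (p ^ m) k) = 0 := by
    rw [← hb, hω'mk]
    exact LinearMap.ext fun w => ((cop_spec ω hp h b hb w).1 (hc w)).2
  have hcφ := h.faithful hp φ hφ hf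
  have := galois_lemma hφ hω' (pow_pos hp.pos m) h.ord h.aut (h.van k V φ hcφ) hcφ hcω
  have h2 := galConj_comp (fun g : H => (QuotientGroup.mk g : H ⧸ K)) this
  simp only [hω'mk] at h2
  exact h2

theorem cop_faithful {K : Subgroup H} [K.Normal] {p m : ℕ} {a : H ⧸ K} (hp : p.Prime)
    (h : RD p m (H ⧸ K) a)
    (φ : Representation k (H ⧸ K) V) (hφ : Irr φ) (hf : Function.Injective φ) (v : V) :
    cop (φ.comp (QuotientGroup.mk' K)) K p m a v = v := by
  obtain ⟨b, hb⟩ := QuotientGroup.mk_surjective a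
  rw [cop_spec _ hp h b hb]
  constructor
  · intro κ hκ
    have : (QuotientGroup.mk' K) κ = 1 := by simpa using hκ
    rw [MonoidHom.comp_apply, this, map_one, Module.End.one_apply]
  · have : (φ.comp (QuotientGroup.mk' K)) b = φ a := by rw [← hb]; rfl
    rw [this, h.faithful hp φ hφ hf]; rfl

def copChar (K : Subgroup H) [K.Normal] (p m : ℕ) (a : H ⧸ K) (f : H → k) : k :=
  avgChar K f 1 - if m = 0 then 0 else avgChar (K1 K p m a) f 1

theorem trace_cop (ρ : Representation k H V) (K : Subgroup H) [K.Normal] (p m : ℕ) (a : H ⧸ K) :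
    LinearMap.trace k V (cop ρ K p m a) = copChar K p m a (fun g => LinearMap.trace k V (ρ g)) := by
  unfold cop copChar
  rw [map_sub]
  have h1 : ∀ Y : Subgroup H, LinearMap.trace k V (avg ρ Y) =
      avgChar Y (fun g => LinearMap.trace k V (ρ g)) 1 := by
    intro Y
    have := trace_avg ρ Y 1
    rw [map_one, one_mul] at this
    exact this
  rw [h1]
  split_ifs
  · simp
  · rw [h1]

theorem copChar_add (K : Subgroup H) [K.Normal] (p m : ℕ) (a : H ⧸ K) (f f' : H → k) :
    copChar K p m a (f + f') = copChar K p m a f + copChar K p m a f' := by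
  unfold copChar
  rw [avgChar_add, avgChar_add]
  split_ifs <;> simp <;> ring

theorem rangeRep_cop (ρ : Representation k H V) (K : Subgroup H) [K.Normal] (p m : ℕ) (a : H ⧸ K)
    (e : Module.End k V) (hc : ∀ h, ρ h * e = e * ρ h) (v : LinearMap.range e) :
    ((cop (rangeRep ρ e hc) K p m a v : LinearMap.range e) : V) = cop ρ K p m a v := by
  have h1 : ∀ Y : Subgroup H, ((avg (rangeRep ρ e hc) Y v : LinearMap.range e) : V) =
      avg ρ Y v := by
    intro Y
    rw [avg_apply, avg_apply]
    simp [rangeRep_apply]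
  unfold cop
  rw [LinearMap.sub_apply, LinearMap.sub_apply, Submodule.coe_sub, h1]
  split_ifs
  · simp
  · rw [h1]

theorem cop_W_zero {K : Subgroup H} [K.Normal] {p m : ℕ} {a : H ⧸ K} (hp : p.Prime)
    (h : RD p m (H ⧸ K) a) (φ : Representation k (H ⧸ K) V) (hφ : Irr φ)
    (hf : Function.Injective φ) (W : FDRep k H) (c : H → k)
    (hcW : c = (fun g : H => LinearMap.trace k V (φ (QuotientGroup.mk g))) + W.character)
    (hno : ¬ CharOccurs (fun g : H => LinearMap.trace k V (φ (QuotientGroup.mk g))) W.character)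
    (htight : ∀ f' : H → k, IsIrrChar f' →
      IsGaloisConj (fun g : H => LinearMap.trace k V (φ (QuotientGroup.mk g))) f' →
      CharOccurs f' c → f' = (fun g : H => LinearMap.trace k V (φ (QuotientGroup.mk g)))) :
    cop W.ρ K p m a = 0 := by
  by_contra hne
  obtain ⟨T, hT1, hT2, hT3, hT4⟩ := exists_minimal W.ρ (LinearMap.range (cop W.ρ K p m a)) (by
    rintro g _ ⟨x, rfl⟩
    refine ⟨W.ρ g x, ?_⟩
    rw [← Module.End.mul_apply, ← cop_comm W.ρ h]; rfl) (by rwa [Ne, LinearMap.range_eq_bot])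
  obtain ⟨e, he1, he2, rfl⟩ := maschke W.ρ T hT3
  have hirr := rangeRep_irr W.ρ e he2 hT2 hT4
  have hcop : ∀ w, cop (rangeRep W.ρ e he2) K p m a w = w := by
    intro w
    apply Subtype.ext
    rw [rangeRep_cop]
    obtain ⟨x, hx⟩ := hT1 w.2
    rw [← hx, ← Module.End.mul_apply, cop_idem]
  have hgal := galois_cop hp h φ hφ hf _ hirr hcop
  have he1' : (1 - e) * (1 - e) = 1 - e := by
    rw [mul_sub, mul_one, sub_mul, one_mul, he1, sub_self, sub_zero]
  have he2' : ∀ g, W.ρ g * (1 - e) = (1 - e) * W.ρ g := fun g => by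
    rw [mul_sub, sub_mul, he2, one_mul, mul_one]
  have hocc : CharOccurs (fun g => LinearMap.trace k _ (rangeRep W.ρ e he2 g)) W.character := by
    refine ⟨FDRep.of (rangeRep W.ρ (1 - e) he2'), ?_⟩
    ext g
    rw [Pi.add_apply, char_of, rangeRep_trace _ _ _ he1, rangeRep_trace _ _ _ he1', ← map_add,
      ← mul_add, add_sub_cancel, mul_one]
    rfl
  have heq := htight _ ⟨FDRep.of (rangeRep W.ρ e he2), (irr_of _).2 hirr, by
    ext g; rw [char_of]⟩ hgal (by
      have := hocc.add (FDRep.of (φ.comp (QuotientGroup.mk' K)))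
      have h2 : c = (FDRep.of (φ.comp (QuotientGroup.mk' K))).character + W.character := by
        rw [hcW]
        congr 1
      rw [h2]
      exact this)
  rw [heq] at hocc
  exact hno hocc

end

theorem part_two {p : ℕ} (hp : p.Prime) {G : Type} [Group G] [Fintype G]
    (hG : IsPGroup p G) {k : Type} [Field k] [CharZero k] (ψ : FDRep k G)
    (H : Subgroup G) (K : Subgroup H) [K.Normal] (hR : IsRoquette (H ⧸ K))
    (φ φ' : FDRep k (H ⧸ K)) (hφ : IsIrr φ) (hf : IsFaithfulRep φ)
    (ht : TightIndSub H K ψ.character φ.character) (hφ' : IsIrr φ') (hf' : IsFaithfulRep φ')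
    (ht' : TightIndSub H K ψ.character φ'.character) : φ.character = φ'.character := by
  obtain ⟨m, a, h⟩ := exists_RD hp ((hG.to_subgroup H).to_quotient K) hR
  have hirr : Irr (φ'.ρ.comp (QuotientGroup.mk' K)) :=
    ⟨hφ'.1, fun U hU => hφ'.2 U fun g x hx => by
      obtain ⟨g, rfl⟩ := QuotientGroup.mk_surjective g
      exact hU g x hx⟩
  have hgal := galois_cop hp h φ.ρ hφ hf (φ'.ρ.comp (QuotientGroup.mk' K)) hirr
    (cop_faithful hp h φ'.ρ hφ' hf')
  obtain ⟨-, -, h3⟩ := ht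
  obtain ⟨-, ⟨W, hW, -⟩, -⟩ := ht'
  have h4 := h3 (fun h => φ'.character (QuotientGroup.mk h))
    ⟨FDRep.of (φ'.ρ.comp (QuotientGroup.mk' K)), (irr_of _).2 hirr, by
      ext g; rw [char_of]; rfl⟩ hgal ⟨W, by rw [hW, one_smul]⟩
  ext g
  obtain ⟨g, rfl⟩ := QuotientGroup.mk_surjective g
  exact (congrFun h4 g).symm

end Genotype

namespace Genotype

theorem finrank_sup_le {k V ι : Type} [Field k] [AddCommGroup V] [Module k V]
    [FiniteDimensional k V] (s : Finset ι) (f : ι → Submodule k V) (d : ℕ)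
    (h : ∀ i ∈ s, Module.finrank k (f i) ≤ d) : Module.finrank k (s.sup f : Submodule k V) ≤ s.card * d := by
  induction s using Finset.induction_on with
  | empty => simp
  | insert i s hi ih =>
    rw [Finset.sup_insert, Finset.card_insert_of_notMem hi]
    have h1 := Submodule.finrank_add_le_finrank_add_finrank (f i) (s.sup f)
    have h2 := ih fun j hj => h j (Finset.mem_insert_of_mem hj)
    have h3 := h i (Finset.mem_insert_self i s)
    rw [Nat.add_mul]
    omega

theorem corner_zero {k G V : Type} [Field k] [CharZero k] [Group G] [Fintype G] [AddCommGroup V]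
    [Module k V] [FiniteDimensional k V] (ρ : Representation k G V) (hρ : Irr ρ) (H : Subgroup G)
    (c : Module.End k V) (hc1 : c * c = c) (hc2 : ∀ h : H, ρ h * c = c * ρ h) (hc0 : c ≠ 0)
    (hc3 : ∀ N : Submodule k V, (∀ h : H, ∀ x ∈ N, ρ h x ∈ N) → ∀ v ∈ N, c v ∈ N)
    (hd : Nat.card H * Module.finrank k V = Nat.card G * Module.finrank k (LinearMap.range c)) :
    ∀ g, g ∉ H → c * ρ g * c = 0 := by
  set d := Module.finrank k (LinearMap.range c) with hd'
  let s : Finset (G ⧸ H) := Finset.univ.erase (QuotientGroup.mk 1)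
  let f : G ⧸ H → Submodule k V := fun q => (LinearMap.range c).map (ρ q.out)
  have hfg : ∀ g : G, f (QuotientGroup.mk g) = (LinearMap.range c).map (ρ g) := by
    intro g
    obtain ⟨h, hh⟩ := QuotientGroup.mk_out_eq_mul H g
    simp only [f, hh]
    apply le_antisymm
    · rintro _ ⟨_, ⟨x, rfl⟩, rfl⟩
      refine ⟨ρ h (c x), ⟨ρ h x, ?_⟩, ?_⟩
      · rw [← Module.End.mul_apply, ← hc2]; rfl
      · rw [map_mul]; rfl
    · rintro _ ⟨_, ⟨x, rfl⟩, rfl⟩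
      refine ⟨ρ (h⁻¹ : H) (c x), ⟨ρ (h⁻¹ : H) x, ?_⟩, ?_⟩
      · rw [← Module.End.mul_apply, ← hc2]; rfl
      · rw [← Module.End.mul_apply, ← map_mul]; simp
  let N : Submodule k V := s.sup f
  have hmemN : ∀ g, g ∉ H → ∀ v, ρ g (c v) ∈ N := by
    intro g hg v
    have : f (QuotientGroup.mk g) ≤ N := by
      refine Finset.le_sup (Finset.mem_erase.2 ⟨?_, Finset.mem_univ _⟩)
      intro h
      rw [QuotientGroup.eq] at h
      exact hg (by simpa using h)
    apply this
    rw [hfg]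
    exact ⟨c v, ⟨v, rfl⟩, rfl⟩
  have hM1 : f (QuotientGroup.mk 1) = LinearMap.range c := by
    rw [hfg, map_one]
    exact Submodule.map_id _
  have hgstab : ∀ g : G, ∀ q, (f q).map (ρ g) = f (g • q) := by
    intro g q
    obtain ⟨x, rfl⟩ := QuotientGroup.mk_surjective q
    have : g • (QuotientGroup.mk x : G ⧸ H) = QuotientGroup.mk (g * x) := rfl
    rw [this, hfg, hfg, map_mul]
    exact (Submodule.map_comp _ _ _).symm
  have hmapsup : ∀ (t : Finset (G ⧸ H)) (g : G), (t.sup f).map (ρ g) ≤ (t.image (g • ·)).sup f := by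
    intro t g
    induction t using Finset.induction_on with
    | empty => simp
    | insert i t hi ih =>
      rw [Finset.sup_insert, Submodule.map_sup, Finset.image_insert, Finset.sup_insert, hgstab]
      exact sup_le_sup le_rfl ih
  have htop : LinearMap.range c ⊔ N = ⊤ := by
    have h1 : LinearMap.range c ⊔ N = Finset.univ.sup f := by
      rw [← hM1, ← Finset.sup_insert, Finset.insert_erase (Finset.mem_univ _)]
    rw [h1]
    refine (hρ.2 _ fun g x hx => ?_).resolve_left fun h => ?_
    · have h2 : ρ g x ∈ (Finset.univ.sup f).map (ρ g) := ⟨x, hx, rfl⟩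
      exact (Finset.sup_mono (f := f) (Finset.subset_univ _) : _ ≤ _) (hmapsup _ g h2)
    · rw [← h1, sup_eq_bot_iff, LinearMap.range_eq_bot] at h
      exact hc0 h.1
  have hNH : ∀ h : H, ∀ x ∈ N, ρ h x ∈ N := by
    intro h x hx
    have h2 : ρ h x ∈ N.map (ρ h) := ⟨x, hx, rfl⟩
    refine (Finset.sup_mono (f := f) ?_ : (s.image ((h : G) • ·)).sup f ≤ s.sup f) (hmapsup _ _ h2)
    intro q hq
    obtain ⟨q', hq', rfl⟩ := Finset.mem_image.1 hq
    refine Finset.mem_erase.2 ⟨fun he => (Finset.mem_erase.1 hq').1 ?_, Finset.mem_univ _⟩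
    rw [smul_eq_iff_eq_inv_smul] at he
    rw [he]
    change QuotientGroup.mk _ = _
    rw [QuotientGroup.eq]
    simp
  have hNd : Module.finrank k N ≤ (Nat.card (G ⧸ H) - 1) * d := by
    have := finrank_sup_le s f d (fun i _ => Submodule.finrank_map_le _ _)
    rwa [Finset.card_erase_of_mem (Finset.mem_univ _), Finset.card_univ, ← Nat.card_eq_fintype_card] at this
  have hVd : Module.finrank k V = Nat.card (G ⧸ H) * d := by
    rw [Subgroup.card_eq_card_quotient_mul_card_subgroup H] at hd
    have : 0 < Nat.card H := Nat.card_pos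
    apply Nat.eq_of_mul_eq_mul_left this
    rw [hd]; ring
  have hinf : LinearMap.range c ⊓ N = ⊥ := by
    have h1 := Submodule.finrank_sup_add_finrank_inf_eq (LinearMap.range c) N
    rw [htop, finrank_top, hVd, ← hd'] at h1
    have hpos : 0 < Nat.card (G ⧸ H) := Nat.card_pos
    obtain ⟨n, hn⟩ := Nat.exists_eq_succ_of_ne_zero hpos.ne'
    rw [hn] at h1 hNd
    rw [Nat.succ_sub_one] at hNd
    rw [Nat.succ_mul] at h1
    have h2 : Module.finrank k (LinearMap.range c ⊓ N : Submodule k V) = 0 := by omega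
    rwa [Submodule.finrank_eq_zero] at h2
  intro g hg
  ext v
  have h1 : c (ρ g (c v)) ∈ LinearMap.range c ⊓ N :=
    ⟨⟨_, rfl⟩, hc3 N hNH _ (hmemN g hg v)⟩
  rw [hinf] at h1
  exact h1

theorem part_three_corner {p : ℕ} (hp : p.Prime) {G : Type} [Group G] [Fintype G]
    {k : Type} [Field k] [CharZero k] (ψ : FDRep k G) (hψ : IsIrr ψ)
    (H : Subgroup G) (K : Subgroup H) [K.Normal] {m : ℕ} {a : H ⧸ K} (h : RD p m (H ⧸ K) a)
    (φ : FDRep k (H ⧸ K)) (hφ : IsIrr φ) (hf : IsFaithfulRep φ)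
    (ht : TightIndSub H K ψ.character φ.character) :
    cop (ψ.ρ.comp H.subtype) K p m a ≠ 0 ∧
    ∀ g, g ∉ H → cop (ψ.ρ.comp H.subtype) K p m a * ψ.ρ g * cop (ψ.ρ.comp H.subtype) K p m a = 0 := by
  obtain ⟨h1, ⟨W, hW, hno⟩, h3⟩ := ht
  rw [one_smul] at hW
  have hW0 := cop_W_zero hp h φ.ρ hφ hf W _ hW hno h3
  set c := cop (ψ.ρ.comp H.subtype) K p m a with hc
  have hcc : c * c = c := cop_idem _ _ _ _ _
  have htr : LinearMap.trace k ψ c = Module.finrank k φ := by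
    rw [hc, trace_cop]
    have e1 : (fun g : H => LinearMap.trace k ψ ((ψ.ρ.comp H.subtype) g)) =
      resChar H ψ.character := rfl
    have e2 : cop (φ.ρ.comp (QuotientGroup.mk' K)) K p m a = 1 :=
      LinearMap.ext fun v => cop_faithful hp h φ.ρ hφ hf v
    have e3 := trace_cop (φ.ρ.comp (QuotientGroup.mk' K)) K p m a
    have e4 := trace_cop W.ρ K p m a
    rw [hW0, map_zero] at e4
    rw [e2, LinearMap.trace_one] at e3
    rw [e1, hW, copChar_add, show copChar K p m a W.character = 0 from e4.symm, add_zero]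
    exact e3.symm
  have hrk : Module.finrank k (LinearMap.range c) = Module.finrank k φ := by
    have := (LinearMap.IsIdempotentElem.isProj_range c hcc).trace
    rw [htr] at this
    exact_mod_cast this.symm
  have hVφ := hφ.1
  have hpos : 0 < Module.finrank k φ := Module.finrank_pos
  have hc0 : c ≠ 0 := by
    rintro h0
    rw [h0, LinearMap.range_zero, finrank_bot] at hrk
    omega
  refine ⟨hc0, corner_zero ψ.ρ hψ H c hcc (fun g => cop_comm (ψ.ρ.comp H.subtype) h g) hc0
    (fun N hN v hv => cop_mem (ψ.ρ.comp H.subtype) K p m a N hN hv) ?_⟩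
  rw [hrk]
  have h5 := congrFun h1 1
  rw [char_one', indChar] at h5
  have h6 : ∀ x : G, (if hx : x⁻¹ * 1 * x ∈ H then
      φ.character (QuotientGroup.mk (⟨x⁻¹ * 1 * x, hx⟩ : H)) else 0) = (Module.finrank k φ : k) := by
    intro x
    have hx : x⁻¹ * 1 * x = 1 := by group
    rw [dif_pos (by rw [hx]; exact one_mem H), ← char_one']
    have : (⟨x⁻¹ * 1 * x, by rw [hx]; exact one_mem H⟩ : H) = 1 := Subtype.ext hx
    rw [this]
    rfl
  simp only [h6] at h5
  rw [finsum_eq_sum_of_fintype, Finset.sum_const, Finset.card_univ, ← Nat.card_eq_fintype_card, nsmul_eq_mul] at h5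
  have hH0 : (Nat.card H : k) ≠ 0 := Nat.cast_ne_zero.2 Nat.card_pos.ne'
  rw [eq_inv_mul_iff_mul_eq₀ hH0] at h5
  exact_mod_cast h5

end Genotype

namespace Genotype

theorem exists_rat {k G X : Type} [Field k] [CharZero k] [Group G] [Fintype G] [AddCommGroup X]
    [Module k X] (ρ : Representation k G X) (hρ : Irr ρ) :
    ∃ (V : Type) (_ : AddCommGroup V) (_ : Module ℚ V) (_ : FiniteDimensional ℚ V)
      (σ : Representation ℚ G V) (j : V →+ X), Irr σ ∧ Function.Injective j ∧
      ∀ g v, j (σ g v) = ρ g (j v) := by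
  letI : Module ℚ X := Module.compHom X (algebraMap ℚ k)
  obtain ⟨x, hx⟩ := (@exists_ne X hρ.1 0)
  let L : G → (X →ₗ[ℚ] X) := fun g => (ρ g).toAddMonoidHom.toRatLinearMap
  have hL : ∀ g y, L g y = ρ g y := fun g y => rfl
  let M0 : Submodule ℚ X := Submodule.span ℚ (Set.range fun g => ρ g x)
  have hfd : FiniteDimensional ℚ M0 := FiniteDimensional.span_of_finite ℚ (Set.finite_range _)
  have hstab : ∀ g, ∀ y ∈ M0, L g y ∈ M0 := by
    intro g y hy
    have : M0 ≤ M0.comap (L g) := by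
      rw [Submodule.span_le]
      rintro _ ⟨g', rfl⟩
      refine Submodule.subset_span ⟨g * g', ?_⟩
      simp [hL]
    exact this hy
  let τ : Representation ℚ G M0 :=
    { toFun := fun g => (L g).restrict (hstab g)
      map_one' := by ext v; simp [hL]
      map_mul' := by intro g g'; ext v; simp [hL] }
  have hτ : ∀ g v, ((τ g v : M0) : X) = ρ g v := fun g v => rfl
  have hM0 : (⊤ : Submodule ℚ M0) ≠ ⊥ := by
    intro h
    have h1 : (⟨x, Submodule.subset_span ⟨1, by simp⟩⟩ : M0) ∈ (⊤ : Submodule ℚ M0) := trivial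
    rw [h] at h1
    exact hx (congrArg Subtype.val h1)
  obtain ⟨T, -, hT2, hT3, hT4⟩ := exists_minimal τ ⊤ (fun _ _ _ => trivial) hM0
  obtain ⟨e, he1, he2, rfl⟩ := maschke τ T hT3
  have hirr := rangeRep_irr τ e he2 hT2 hT4
  refine ⟨LinearMap.range e, inferInstance, inferInstance, inferInstance, rangeRep τ e he2,
    M0.subtype.toAddMonoidHom.comp (LinearMap.range e).subtype.toAddMonoidHom, hirr, ?_, ?_⟩
  · exact (Subtype.val_injective).comp Subtype.val_injective
  · intro g v
    change (((rangeRep τ e he2 g v : LinearMap.range e) : M0) : X) = _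
    rw [rangeRep_apply]
    rfl

theorem avg_transfer {k H X V : Type} [Field k] [CharZero k] [Group H] [Fintype H] [AddCommGroup X]
    [Module k X] (ρ : Representation k H X) [AddCommGroup V] [Module ℚ V] (σ : Representation ℚ H V)
    (j : V →+ X) (hj : ∀ g v, j (σ g v) = ρ g (j v)) (Y : Subgroup H) (v : V) :
    j (avg σ Y v) = avg ρ Y (j v) := by
  rw [avg_apply, avg_apply, map_inv_natCast_smul j ℚ k, map_sum]
  simp only [hj]

theorem cop_transfer {k H X V : Type} [Field k] [CharZero k] [Group H] [Fintype H] [AddCommGroup X]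
    [Module k X] (ρ : Representation k H X) [AddCommGroup V] [Module ℚ V] (σ : Representation ℚ H V)
    (j : V →+ X) (hj : ∀ g v, j (σ g v) = ρ g (j v)) (K : Subgroup H) [K.Normal] (p m : ℕ)
    (a : H ⧸ K) (v : V) :
    j (cop σ K p m a v) = cop ρ K p m a (j v) := by
  unfold cop
  rw [LinearMap.sub_apply, LinearMap.sub_apply, map_sub, avg_transfer ρ σ j hj]
  split_ifs
  · simp
  · rw [avg_transfer ρ σ j hj]

/-- commutant -/
def Cm {G V : Type} [Group G] [AddCommGroup V] [Module ℚ V] (σ : Representation ℚ G V) :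
    Subalgebra ℚ (Module.End ℚ V) := Subalgebra.centralizer ℚ (Set.range σ)

theorem mem_Cm {G V : Type} [Group G] [AddCommGroup V] [Module ℚ V] {σ : Representation ℚ G V}
    {T : Module.End ℚ V} : T ∈ Cm σ ↔ ∀ g, σ g * T = T * σ g := by
  rw [Cm, Subalgebra.mem_centralizer_iff]
  simp

theorem Cm_avg {H V : Type} [Group H] [Fintype H] [AddCommGroup V] [Module ℚ V]
    (σ : Representation ℚ H V) (T : Module.End ℚ V) (hT : ∀ g, σ g * T = T * σ g)
    (Y : Subgroup H) : avg σ Y * T = T * avg σ Y := by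
  unfold avg
  rw [smul_mul_assoc, mul_smul_comm, Finset.sum_mul, Finset.mul_sum]
  simp only [hT]

theorem Cm_cop {H V : Type} [Group H] [Fintype H] [AddCommGroup V] [Module ℚ V]
    (σ : Representation ℚ H V) (T : Module.End ℚ V) (hT : ∀ g, σ g * T = T * σ g)
    (K : Subgroup H) [K.Normal] (p m : ℕ) (a : H ⧸ K) :
    cop σ K p m a * T = T * cop σ K p m a := by
  unfold cop
  rw [sub_mul, mul_sub, Cm_avg _ _ hT]
  split_ifs
  · simp
  · rw [Cm_avg _ _ hT]

/-- restriction of the commutant to a corner -/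
theorem commutant_equiv {G V : Type} [Group G] [Fintype G] [AddCommGroup V] [Module ℚ V]
    (σ : Representation ℚ G V) (hσ : Irr σ) (H : Subgroup G) (c : Module.End ℚ V) (hc0 : c ≠ 0)
    (hc1 : c * c = c) (hc2 : ∀ h : H, (σ.comp H.subtype) h * c = c * (σ.comp H.subtype) h)
    (hc3 : ∀ T ∈ Cm σ, c * T = T * c)
    (hc4 : ∀ g, g ∉ H → c * σ g * c = 0) :
    Nonempty (Cm σ ≃ₐ[ℚ] Cm (rangeRep (σ.comp H.subtype) c hc2)) := by
  have hst : ∀ T ∈ Cm σ, ∀ v ∈ LinearMap.range c, T v ∈ LinearMap.range c := by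
    rintro T hT _ ⟨v, rfl⟩
    refine ⟨T v, ?_⟩
    rw [← Module.End.mul_apply, hc3 T hT]; rfl
  let r : Cm σ →ₐ[ℚ] Cm (rangeRep (σ.comp H.subtype) c hc2) :=
    { toFun := fun T => ⟨T.1.restrict (hst T.1 T.2), by
        rw [mem_Cm]
        intro h
        ext v
        have := mem_Cm.1 T.2 h
        exact LinearMap.congr_fun this v⟩
      map_one' := by ext v; rfl
      map_mul' := by intro S T; ext v; rfl
      map_zero' := by ext v; rfl
      map_add' := by intro S T; ext v; rfl
      commutes' := by intro q; ext v; rfl }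
  have hr : ∀ (T : Cm σ) (v : LinearMap.range c), (((r T).1 v : LinearMap.range c) : V) = T.1 v :=
    fun T v => rfl
  refine ⟨AlgEquiv.ofBijective r ⟨?_, ?_⟩⟩
  · rw [injective_iff_map_eq_zero]
    intro T hT
    have h1 : ∀ v, T.1 (c v) = 0 := fun v => by
      have := hr T ⟨c v, v, rfl⟩
      rw [hT] at this
      exact this.symm
    have h2 : LinearMap.ker T.1 = ⊤ := by
      refine (hσ.2 _ fun g x hx => ?_).resolve_left fun h => hc0 ?_
      · rw [LinearMap.mem_ker] at hx ⊢
        rw [← Module.End.mul_apply, ← mem_Cm.1 T.2 g, Module.End.mul_apply, hx, map_zero]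
      · ext v
        have : c v ∈ LinearMap.ker T.1 := h1 v
        rw [h] at this
        exact this
    exact Subtype.ext (LinearMap.ker_eq_top.1 h2)
  · intro S
    let S' : Module.End ℚ V := (LinearMap.range c).subtype ∘ₗ S.1 ∘ₗ c.rangeRestrict
    have hS'v : ∀ v, S' v = S.1 ⟨c v, v, rfl⟩ := fun v => rfl
    have hS1 : c * S' = S' := by
      ext v
      rw [Module.End.mul_apply, hS'v]
      obtain ⟨w, hw⟩ := (S.1 ⟨c v, v, rfl⟩).2
      rw [← hw, ← Module.End.mul_apply, hc1]
    have hS2 : S' * c = S' := by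
      ext v
      rw [Module.End.mul_apply, hS'v, hS'v]
      congr 2
      apply Subtype.ext
      exact LinearMap.congr_fun hc1 v
    have hS3 : ∀ h : H, σ h * S' = S' * σ h := by
      intro h
      ext v
      rw [Module.End.mul_apply, Module.End.mul_apply, hS'v, hS'v]
      have h1 := LinearMap.congr_fun (mem_Cm.1 S.2 h) ⟨c v, v, rfl⟩
      have h2 := congrArg Subtype.val h1
      rw [Module.End.mul_apply, rangeRep_apply, Module.End.mul_apply] at h2
      refine h2.trans ?_
      congr 2
      apply Subtype.ext
      rw [rangeRep_apply]
      exact LinearMap.congr_fun (hc2 h) v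
    let T : Module.End ℚ V := (Nat.card H : ℚ)⁻¹ • ∑ x : G, σ x * S' * σ x⁻¹
    have hT : T ∈ Cm σ := by
      rw [mem_Cm]
      intro g
      simp only [T]
      rw [mul_smul_comm, smul_mul_assoc, Finset.mul_sum, Finset.sum_mul]
      congr 1
      refine Fintype.sum_equiv (Equiv.mulLeft g) _ _ ?_
      intro x
      have : σ g⁻¹ * σ g = 1 := by rw [← map_mul]; simp
      simp [mul_assoc, this]
    have hTc : T * c = S' := by
      simp only [T]
      rw [smul_mul_assoc, Finset.sum_mul]
      have h2 : ∀ x : G, σ x * S' * σ x⁻¹ * c = if x ∈ H then S' else 0 := by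
        intro x
        split_ifs with hx
        · have h3 := hS3 ⟨x, hx⟩
          simp only at h3
          rw [h3, mul_assoc S', ← map_mul]
          simp [hS2]
        · conv_lhs => rw [← hS2]
          rw [← mul_assoc (σ x), mul_assoc (σ x * S'), mul_assoc (σ x * S'), hc4 x⁻¹ (by simpa using hx), mul_zero]
      rw [Finset.sum_congr rfl (fun x _ => h2 x), ← Finset.sum_filter, Finset.sum_const,
        ← Nat.cast_smul_eq_nsmul ℚ, smul_smul]
      have h5 : (Finset.univ.filter (fun x => x ∈ H)).card = Nat.card H := by
        rw [Nat.card_eq_fintype_card, ← Fintype.card_subtype]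
      rw [h5, inv_mul_cancel₀ (Nat.cast_ne_zero.2 Nat.card_pos.ne'), one_smul]
    refine ⟨⟨T, hT⟩, ?_⟩
    apply Subtype.ext
    ext v
    rw [hr]
    obtain ⟨w, hw⟩ := v.2
    change T v = _
    rw [← hw, ← Module.End.mul_apply, hTc, hS'v]
    congr 2
    exact Subtype.ext hw

end Genotype

namespace Genotype

theorem RD.triv {p m : ℕ} {R : Type} [Group R] {a : R} (h : RD p m R a) (hm : m = 0) (g : R) :
    g = 1 := by
  subst hm
  have ha : a = 1 := by
    have := h.ord
    simpa using this
  rcases h.alt with h1 | ⟨-, s, t, x, h1, -⟩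
  · have := h1 g
    rw [ha] at this
    simpa using this
  · have := h1.1
    omega

theorem rat_corner {p : ℕ} (hp : p.Prime) {G : Type} [Group G] [Fintype G] (hG : IsPGroup p G)
    {k : Type} [Field k] [CharZero k] (ψ : FDRep k G) (hψ : IsIrr ψ)
    (H : Subgroup G) (K : Subgroup H) [K.Normal] {m : ℕ} {a : H ⧸ K} (h : RD p m (H ⧸ K) a)
    (φ : FDRep k (H ⧸ K)) (hφ : IsIrr φ) (hf : IsFaithfulRep φ)
    (ht : TightIndSub H K ψ.character φ.character)
    {V : Type} [AddCommGroup V] [Module ℚ V] [FiniteDimensional ℚ V]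
    (σ : Representation ℚ G V) (j : V →+ ψ) (hσ : Irr σ) (hj : Function.Injective j)
    (hjg : ∀ g v, j (σ g v) = ψ.ρ g (j v)) :
    ∃ (U : Type) (_ : AddCommGroup U) (_ : Module ℚ U) (_ : FiniteDimensional ℚ U)
      (τ : Representation ℚ (H ⧸ K) U), Irr τ ∧
      Polynomial.aeval (τ a) (Polynomial.cyclotomic (p ^ m) ℚ) = 0 ∧
      Nonempty (Cm σ ≃ₐ[ℚ] Cm τ) ∧ (m = 0 → ∀ g, σ g = 1) ∧ (m ≠ 0 → ∃ g, σ g ≠ 1) := by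
  obtain ⟨hc0, hc4⟩ := part_three_corner hp ψ hψ H K h φ hφ hf ht
  set cψ := cop (ψ.ρ.comp H.subtype) K p m a with hcψ
  obtain ⟨c, hcdef⟩ : ∃ c, c = cop (σ.comp H.subtype) K p m a := ⟨_, rfl⟩
  have hjc : ∀ v, j (c v) = cψ (j v) := fun v => by
    rw [hcdef]
    exact cop_transfer (ψ.ρ.comp H.subtype) (σ.comp H.subtype) j (fun g v => hjg g v) K p m a v
  have c0 : c ≠ 0 := by
    intro h0
    apply hc0
    let S : Submodule k ψ := Submodule.span k (Set.range j)
    have hS : S = ⊤ := by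
      refine (hψ.2 S fun g x hx => ?_).resolve_left fun hb => ?_
      · have : S ≤ S.comap (ψ.ρ g) := by
          rw [Submodule.span_le]
          rintro _ ⟨v, rfl⟩
          exact Submodule.subset_span ⟨σ g v, hjg g v⟩
        exact this hx
      · obtain ⟨v, hv⟩ := (@exists_ne V hσ.1 0)
        have : j v ∈ S := Submodule.subset_span ⟨v, rfl⟩
        rw [hb] at this
        exact hv (hj (by rw [map_zero]; exact this))
    have hk : S ≤ LinearMap.ker cψ := by
      rw [Submodule.span_le]
      rintro _ ⟨v, rfl⟩
      change cψ (j v) = 0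
      rw [← hjc, h0]; simp
    rw [hS, top_le_iff, LinearMap.ker_eq_top] at hk
    exact hk
  have c1 : c * c = c := by rw [hcdef]; exact cop_idem _ _ _ _ _
  have c2 : ∀ h : H, (σ.comp H.subtype) h * c = c * (σ.comp H.subtype) h := fun g => by
    rw [hcdef]; exact cop_comm _ h g
  have c3 : ∀ T ∈ Cm σ, c * T = T * c := fun T hT => by
    rw [hcdef]
    exact Cm_cop (σ.comp H.subtype) T (fun g => mem_Cm.1 hT g) K p m a
  have c4 : ∀ g, g ∉ H → c * σ g * c = 0 := by
    intro g hg
    ext v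
    apply hj
    have := LinearMap.congr_fun (hc4 g hg) (j v)
    simp only [Module.End.mul_apply, LinearMap.zero_apply] at this ⊢
    rw [hjc, hjg, hjc, this, map_zero]
  obtain ⟨e⟩ := commutant_equiv σ hσ H c c0 c1 c2 c3 c4
  let τ0 := rangeRep (σ.comp H.subtype) c c2
  have hcop : ∀ u, cop τ0 K p m a u = u := by
    intro u
    apply Subtype.ext
    rw [rangeRep_cop, ← hcdef]
    obtain ⟨w, hw⟩ := u.2
    rw [← hw]
    exact LinearMap.congr_fun c1 w
  obtain ⟨b, hb⟩ := QuotientGroup.mk_surjective a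
  have hK : ∀ κ ∈ K, τ0 κ = 1 := fun κ hκ => LinearMap.ext fun u =>
    ((cop_spec τ0 hp h b hb u).1 (hcop u)).1 κ hκ
  have hΦ : Polynomial.aeval (τ0 b) (Polynomial.cyclotomic (p ^ m) ℚ) = 0 :=
    LinearMap.ext fun u => ((cop_spec τ0 hp h b hb u).1 (hcop u)).2
  obtain ⟨τ, hτ⟩ : ∃ τ : Representation ℚ (H ⧸ K) (LinearMap.range c),
      ∀ g : H, τ (QuotientGroup.mk g) = τ0 g := ⟨QuotientGroup.lift K τ0 hK, fun g => rfl⟩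
  have hrange : Set.range τ = Set.range τ0 := by
    ext T
    constructor
    · rintro ⟨g, rfl⟩
      obtain ⟨g, rfl⟩ := QuotientGroup.mk_surjective g
      exact ⟨g, (hτ g).symm⟩
    · rintro ⟨g, rfl⟩
      exact ⟨_, hτ g⟩
  have hCm : Cm τ = Cm τ0 := by unfold Cm; rw [hrange]
  have hne : LinearMap.range c ≠ ⊥ := by rwa [Ne, LinearMap.range_eq_bot]
  have hirr0 : Irr τ0 := by
    refine rangeRep_irr _ _ _ hne fun U hU hU' => ?_
    by_cases h0 : U = ⊥
    · exact Or.inl h0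
    · right
      exact le_antisymm hU (corner_irr hσ H c1 (fun g hg => c2 ⟨g, hg⟩) c4 U hU
        (fun g hg => hU' ⟨g, hg⟩) h0)
  refine ⟨LinearMap.range c, inferInstance, inferInstance, inferInstance, τ, ?_, ?_, ?_, ?_, ?_⟩
  · refine ⟨hirr0.1, fun U hU => hirr0.2 U fun g x hx => ?_⟩
    rw [← hτ]; exact hU _ x hx
  · rw [← hb, hτ, hΦ]
  · rw [hCm]; exact ⟨e⟩
  · intro hm
    have hKtop : ∀ x : H, x ∈ K := fun x => by
      rw [← QuotientGroup.eq_one_iff]; exact h.triv hm _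
    obtain ⟨v, hv⟩ : ∃ v, c v ≠ 0 := by
      by_contra! h0
      exact c0 (LinearMap.ext h0)
    have hHfix : ∀ x ∈ H, ∀ w, σ x (c w) = c w := by
      intro x hx w
      have := LinearMap.congr_fun (hK ⟨x, hx⟩ (hKtop _)) ⟨c w, w, rfl⟩
      have h2 := congrArg Subtype.val this
      rw [rangeRep_apply] at h2
      exact h2
    have hHc : ∀ w, (∀ x ∈ H, σ x w = w) → c w = w := by
      intro w hw
      rw [hcdef]
      unfold cop
      rw [if_pos hm, sub_zero]
      exact avg_fix _ fun y _ => hw y y.2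
    have hHtop : H = ⊤ := by
      by_contra hne
      have hnil : Group.IsNilpotent G := by
        have : Fact p.Prime := ⟨hp⟩
        exact hG.isNilpotent
      have hlt := Group.normalizerCondition_of_isNilpotent (G := G) H (lt_top_iff_ne_top.2 hne)
      obtain ⟨g, hg1, hg2⟩ := SetLike.exists_of_lt hlt
      have h1 := LinearMap.congr_fun (c4 g hg2) v
      simp only [Module.End.mul_apply, LinearMap.zero_apply] at h1
      rw [hHc] at h1
      · apply hv
        have := congrArg (σ g⁻¹) h1
        rwa [← Module.End.mul_apply, ← map_mul, inv_mul_cancel, map_one, map_zero] at this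
      · intro x hx
        have h2 : g⁻¹ * x * g ∈ H := by
          have := (Subgroup.mem_normalizer_iff.1 hg1 (g⁻¹ * x * g)).2 (by simpa [mul_assoc] using hx)
          exact this
        rw [← Module.End.mul_apply, ← map_mul, show x * g = g * (g⁻¹ * x * g) by group, map_mul,
          Module.End.mul_apply, hHfix _ h2]
    let F : Submodule ℚ V := ⨅ g : G, LinearMap.ker (σ g - 1)
    have hF : ∀ w, w ∈ F ↔ ∀ g, σ g w = w := by
      intro w
      simp [F, Submodule.mem_iInf, sub_eq_zero]
    have hFtop : F = ⊤ := by
      refine (hσ.2 F fun g x hx => ?_).resolve_left fun h0 => hv ?_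
      · rw [(hF x).1 hx g]; exact hx
      · have : c v ∈ F := (hF _).2 fun g => hHfix g (by rw [hHtop]; trivial) v
        rw [h0] at this
        exact this
    intro g
    ext w
    have : w ∈ F := by rw [hFtop]; trivial
    exact (hF w).1 this g
  · intro hm
    by_contra! hall
    have hτb : τ0 b = 1 := by
      ext u
      have : ((τ0 b u : LinearMap.range c) : V) = σ b u := rangeRep_apply _ _ c2 _ _
      rw [this, hall]; rfl
    rw [aeval_cyc_pp _ hp (by omega), hτb] at hΦ
    simp only [one_pow, Finset.sum_const, Finset.card_range] at hΦ
    obtain ⟨u, hu⟩ := (@exists_ne _ hirr0.1 0)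
    have h1 := LinearMap.congr_fun hΦ u
    rw [LinearMap.smul_apply, Module.End.one_apply, LinearMap.zero_apply, ← Nat.cast_smul_eq_nsmul ℚ,
      smul_eq_zero] at h1
    rcases h1 with h1 | h1
    · exact hp.ne_zero (by exact_mod_cast h1)
    · exact hu h1

end Genotype

namespace Genotype

open Polynomial in
theorem cyc_lift {N : ℕ} [NeZero N] {F : Type} [Field F] [CharZero F] [Algebra ℚ F]
    [IsCyclotomicExtension {N} ℚ F] {S : Type} [Ring S] [Algebra ℚ S]
    (ζ : F) (hζ : IsPrimitiveRoot ζ N) (A : S)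
    (hA : aeval A (cyclotomic N ℚ) = 0) : ∃ θ : F →ₐ[ℚ] S, θ ζ = A := by
  have h : aeval A (minpoly ℚ (hζ.powerBasis ℚ).gen) = 0 := by
    rw [IsPrimitiveRoot.powerBasis_gen, ← hζ.minpoly_eq_cyclotomic_of_irreducible (cyclotomic.irreducible_rat (NeZero.pos N))]
    exact hA
  refine ⟨(hζ.powerBasis ℚ).lift A h, ?_⟩
  have := (hζ.powerBasis ℚ).lift_gen A h
  rwa [IsPrimitiveRoot.powerBasis_gen] at this

theorem cyc_ext {N : ℕ} [NeZero N] {F : Type} [Field F] [CharZero F] [Algebra ℚ F]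
    [IsCyclotomicExtension {N} ℚ F] {S : Type} [Ring S] [Algebra ℚ S]
    {ζ : F} (hζ : IsPrimitiveRoot ζ N)
    (f g : F →ₐ[ℚ] S) (h : f ζ = g ζ) : f = g := by
  apply (hζ.powerBasis ℚ).algHom_ext
  rwa [IsPrimitiveRoot.powerBasis_gen]

theorem cycF_aut {N : ℕ} [NeZero N] {F : Type} [Field F] [CharZero F] [Algebra ℚ F]
    [IsCyclotomicExtension {N} ℚ F] {ζ : F} (hζ : IsPrimitiveRoot ζ N) (s : ℕ)
    (hs : ζ ^ (s * s) = ζ) : ∃ σ : F ≃ₐ[ℚ] F,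
      σ ζ = ζ ^ s ∧ σ * σ = 1 := by
  have hco : s.Coprime N := by
    by_cases h1 : N = 1
    · rw [h1]; exact Nat.coprime_one_right s
    have h2 : (s * s) ≡ 1 [MOD N] := by
      have hu := hζ.isUnit_unit (NeZero.ne N)
      rw [hu.eq_orderOf, ← pow_eq_pow_iff_modEq, pow_one]
      exact Units.ext hs
    have h3 : (s * s).Coprime N := by
      rw [Nat.Coprime, h2.gcd_eq, Nat.gcd_one_left]
    exact Nat.Coprime.coprime_mul_left h3
  obtain ⟨σ, hσ⟩ := cyc_lift ζ hζ (ζ ^ s) (by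
    have := (hζ.pow_of_coprime s hco)
    rw [Polynomial.aeval_def, Polynomial.eval₂_eq_eval_map, Polynomial.map_cyclotomic]
    exact this.isRoot_cyclotomic (NeZero.pos N))
  have hc : σ.comp σ = AlgHom.id ℚ _ := by
    apply cyc_ext hζ
    simp [hσ, ← pow_mul, hs]
  refine ⟨AlgEquiv.ofAlgHom σ σ hc hc, hσ, ?_⟩
  ext f
  exact DFunLike.congr_fun hc f

/-- fixed field of an involution -/
def FixI {F : Type} [Field F] [Algebra ℚ F] (σ : F ≃ₐ[ℚ] F) : Subalgebra ℚ F :=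
  (IntermediateField.fixedField (Subgroup.zpowers σ)).toSubalgebra

theorem mem_FixI {F : Type} [Field F] [Algebra ℚ F] {σ : F ≃ₐ[ℚ] F} {f : F} :
    f ∈ FixI σ ↔ σ f = f := by
  unfold FixI
  rw [IntermediateField.mem_toSubalgebra, IntermediateField.mem_fixedField_iff]
  constructor
  · intro h
    exact h σ (Subgroup.mem_zpowers σ)
  · intro h τ hτ
    have : Subgroup.zpowers σ ≤ MulAction.stabilizer (F ≃ₐ[ℚ] F) f := by
      rw [Subgroup.zpowers_le]
      exact h
    exact this hτ

theorem finrank_FixI {F : Type} [Field F] [Algebra ℚ F] [FiniteDimensional ℚ F] {σ : F ≃ₐ[ℚ] F}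
    (h2 : σ * σ = 1) (h1 : σ ≠ 1) : Module.finrank ℚ (FixI σ) * 2 = Module.finrank ℚ F := by
  unfold FixI
  change @Module.finrank ℚ (IntermediateField.fixedField (Subgroup.zpowers σ)) _ _
    (IntermediateField.fixedField (Subgroup.zpowers σ)).module' * 2 = _
  rw [← Module.finrank_mul_finrank ℚ (IntermediateField.fixedField (Subgroup.zpowers σ)) F]
  congr 1
  rw [IntermediateField.finrank_fixedField_eq_card, Nat.card_zpowers]
  symm
  exact orderOf_eq_prime (by rw [pow_two, h2]) h1

/-- complex conjugation -/
theorem cyc_conj {N : ℕ} [NeZero N] {F : Type} [Field F] [CharZero F] [Algebra ℚ F]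
    [IsCyclotomicExtension {N} ℚ F] {ζ : F} (hζ : IsPrimitiveRoot ζ N)
    (σ : F ≃ₐ[ℚ] F) (hσ : σ ζ = ζ⁻¹) :
    ∃ ι : F →ₐ[ℚ] ℂ, ∀ f, ι (σ f) = (starRingEnd ℂ) (ι f) := by
  have hz := Complex.isPrimitiveRoot_exp N (NeZero.ne N)
  obtain ⟨ι, hι⟩ := cyc_lift (S := ℂ) ζ hζ _ (by
    rw [Polynomial.aeval_def, Polynomial.eval₂_eq_eval_map, Polynomial.map_cyclotomic]
    exact hz.isRoot_cyclotomic (NeZero.pos N))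
  refine ⟨ι, ?_⟩
  let c : ℂ →ₐ[ℚ] ℂ := (Complex.conjAe.toAlgHom.restrictScalars ℚ)
  have : ι.comp σ.toAlgHom = c.comp ι := by
    apply cyc_ext hζ
    change ι (σ ζ) = (starRingEnd ℂ) (ι ζ)
    rw [hσ, map_inv₀, hι]
    apply Complex.inv_eq_conj
    exact hz.norm'_eq_one (NeZero.ne N)
  intro f
  exact DFunLike.congr_fun this f

theorem FixI_real {N : ℕ} [NeZero N] {F : Type} [Field F] [CharZero F] [Algebra ℚ F]
    [IsCyclotomicExtension {N} ℚ F] {ζ : F} (hζ : IsPrimitiveRoot ζ N)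
    (σ : F ≃ₐ[ℚ] F) (hσ : σ ζ = ζ⁻¹) :
    Nonempty (FixI σ →+* ℝ) := by
  obtain ⟨ι, hι⟩ := cyc_conj hζ σ hσ
  have him : ∀ f : FixI σ, (ι f).im = 0 := by
    intro f
    have h := hι f
    rw [mem_FixI.1 f.2] at h
    exact Complex.conj_eq_iff_im.1 h.symm
  refine ⟨{ toFun := fun f => (ι f).re, map_one' := by simp, map_zero' := by simp,
            map_add' := by intros; simp, map_mul' := ?_ }⟩
  intro f g
  simp [him]

theorem no_norm_neg {N : ℕ} [NeZero N] {F : Type} [Field F] [CharZero F] [Algebra ℚ F]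
    [IsCyclotomicExtension {N} ℚ F] {ζ : F} (hζ : IsPrimitiveRoot ζ N)
    (σ : F ≃ₐ[ℚ] F) (hσ : σ ζ = ζ⁻¹)
    (f : F) : σ f * f ≠ -1 := by
  obtain ⟨ι, hι⟩ := cyc_conj hζ σ hσ
  intro h
  have h1 := congrArg ι h
  rw [map_mul, hι, map_neg, map_one, ← Complex.normSq_eq_conj_mul_self] at h1
  have h2 := congrArg Complex.re h1
  simp at h2
  have := Complex.normSq_nonneg (ι f)
  linarith

theorem SD_noI {q : ℕ} {F : Type} [Field F] [CharZero F] [Algebra ℚ F] {ζ : F} {σ : F ≃ₐ[ℚ] F}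
    (h1 : ζ ^ (2 * q) = -1) (s c : ℕ) (hs : σ ζ = ζ ^ s) (hc : q * s = q * 3 + 4 * q * c) :
    ¬ ∃ i : FixI σ, i * i = -1 := by
  rintro ⟨⟨i, hi⟩, h⟩
  have hi' := mem_FixI.1 hi
  have h' : i * i = -1 := congrArg Subtype.val h
  have e : σ (ζ ^ q) = - ζ ^ q := by
    rw [map_pow, hs, ← pow_mul, mul_comm, hc]
    rw [show q * 3 + 4 * q * c = q + 2 * q + (2 * q) * (2 * c) by ring, pow_add, pow_add, pow_mul _ (2*q),
      h1, pow_mul (-1 : F)]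
    simp
  have h2 : (ζ ^ q) * (ζ ^ q) = -1 := by rw [← pow_add, ← two_mul, h1]
  have h3 : i = ζ ^ q ∨ i = - ζ ^ q := mul_self_eq_mul_self_iff.1 (by rw [h', h2])
  have h0 : ζ ^ q ≠ 0 := by
    intro h0; rw [h0] at h2; simp at h2
  rcases h3 with rfl | rfl
  · rw [e] at hi'
    exact h0 (self_eq_neg.1 hi'.symm)
  · rw [map_neg, e, neg_neg] at hi'
    exact h0 (self_eq_neg.1 hi')

theorem SD_noR {n : ℕ} {F : Type} [Field F] [CharZero F] [Algebra ℚ F] {ζ : F} {σ : F ≃ₐ[ℚ] F}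
    (h1 : ζ ^ (2 * 2 ^ (n + 1)) = -1) (hs : σ ζ = - ζ⁻¹) :
    IsEmpty (FixI σ →+* ℝ) := by
  refine ⟨fun h => ?_⟩
  have h0 : ζ ≠ 0 := by
    rintro rfl
    rw [zero_pow (by positivity)] at h1
    simp at h1
  let w : FixI σ := ⟨ζ - ζ⁻¹, by rw [mem_FixI, map_sub, map_inv₀, hs, inv_neg, inv_inv]; ring⟩
  have key : ∀ n, ∃ c : FixI σ, (c : F) = ζ ^ (2 ^ (n + 1)) + (ζ⁻¹) ^ (2 ^ (n + 1)) ∧ 2 ≤ h c := by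
    intro n
    induction n with
    | zero =>
      refine ⟨w * w + 2, ?_, ?_⟩
      · change (ζ - ζ⁻¹) * (ζ - ζ⁻¹) + 2 = _
        have e : ζ * ζ⁻¹ = 1 := mul_inv_cancel₀ h0
        simp only [zero_add, pow_one]
        linear_combination (-2) * e
      · rw [map_add, map_mul, map_ofNat]
        nlinarith [mul_self_nonneg (h w)]
    | succ n ih =>
      obtain ⟨c, hc, hc2⟩ := ih
      refine ⟨c * c - 2, ?_, ?_⟩
      · change (c : F) * c - 2 = _
        have e : ζ ^ (2 ^ (n + 1)) * ζ⁻¹ ^ (2 ^ (n + 1)) = 1 := by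
          rw [← mul_pow, mul_inv_cancel₀ h0, one_pow]
        rw [hc, pow_succ 2 (n + 1), pow_mul, pow_mul]
        linear_combination 2 * e
      · rw [map_sub, map_mul, map_ofNat]
        nlinarith
  obtain ⟨c, hc, hc2⟩ := key n
  have h2 : (ζ ^ (2 ^ (n + 1))) * (ζ ^ (2 ^ (n + 1))) = -1 := by rw [← pow_add, ← two_mul, h1]
  have : (c : F) = 0 := by
    rw [hc, inv_pow]
    have h3 : ζ ^ (2 ^ (n + 1)) ≠ 0 := pow_ne_zero _ h0
    field_simp
    linear_combination h2
  have h4 : c = 0 := Subtype.ext this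
  rw [h4, map_zero] at hc2
  linarith

end Genotype

namespace Genotype

theorem cyc_ind {N : ℕ} [NeZero N] {F : Type} [Field F] [CharZero F] [Algebra ℚ F]
    [IsCyclotomicExtension {N} ℚ F] {ζ : F} (hζ : IsPrimitiveRoot ζ N) (P : F → Prop)
    (hadd : ∀ f g, P f → P g → P (f + g)) (hmul : ∀ f g, P f → P g → P (f * g))
    (hq : ∀ r : ℚ, P (algebraMap ℚ F r)) (h : P ζ) (f : F) : P f := by
  obtain ⟨Q, hQ⟩ := (hζ.powerBasis ℚ).exists_eq_aeval' f
  rw [IsPrimitiveRoot.powerBasis_gen] at hQ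
  rw [hQ]
  clear hQ
  induction Q using Polynomial.induction_on with
  | C a => rw [Polynomial.aeval_C]; exact hq a
  | add p q hp hq => rw [map_add]; exact hadd _ _ hp hq
  | monomial n a ih =>
    rw [pow_succ, ← mul_assoc, map_mul, Polynomial.aeval_X]
    exact hmul _ _ ih h

section
variable {F U : Type} [Field F] [Algebra ℚ F] [AddCommGroup U] [Module ℚ U]

theorem theta_inj [Nontrivial U] (θ : F →ₐ[ℚ] Module.End ℚ U) (f : F) (u : U) (hu : u ≠ 0)
    (h : θ f u = 0) : f = 0 := by
  by_contra hf
  apply hu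
  have : θ (f⁻¹ * f) u = 0 := by rw [map_mul, Module.End.mul_apply, h, map_zero]
  rwa [inv_mul_cancel₀ hf, map_one] at this

/-- cyclic submodule -/
def orb (θ : F →ₐ[ℚ] Module.End ℚ U) (u : U) : F →ₗ[ℚ] U :=
  { toFun := fun f => θ f u
    map_add' := by intros; simp
    map_smul' := by intros; simp }

theorem orb_apply (θ : F →ₐ[ℚ] Module.End ℚ U) (u : U) (f : F) : orb θ u f = θ f u := rfl

theorem Cm_cyc [Nontrivial U] (θ : F →ₐ[ℚ] Module.End ℚ U) (C : Subalgebra ℚ (Module.End ℚ U))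
    (hC : ∀ T, T ∈ C ↔ ∀ f, θ f * T = T * θ f)
    (hU : ∀ W : Submodule ℚ U, (∀ f, ∀ w ∈ W, θ f w ∈ W) → W = ⊥ ∨ W = ⊤) :
    Nonempty (F ≃ₐ[ℚ] C) := by
  obtain ⟨u, hu⟩ := exists_ne (0 : U)
  have hW : LinearMap.range (orb θ u) = ⊤ := by
    refine (hU _ ?_).resolve_left ?_
    · rintro f _ ⟨g, rfl⟩
      exact ⟨f * g, by simp [orb_apply]⟩
    · intro h
      have : u ∈ LinearMap.range (orb θ u) := ⟨1, by simp [orb_apply]⟩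
      rw [h] at this
      exact hu this
  refine ⟨AlgEquiv.ofBijective (θ.codRestrict C fun f => (hC _).2 fun g => by
    rw [← map_mul, ← map_mul, mul_comm]) ⟨?_, ?_⟩⟩
  · exact RingHom.injective _
  · rintro ⟨T, hT⟩
    obtain ⟨f, hf⟩ : T u ∈ LinearMap.range (orb θ u) := by rw [hW]; trivial
    refine ⟨f, Subtype.ext ?_⟩
    change θ f = T
    ext v
    obtain ⟨g, rfl⟩ : v ∈ LinearMap.range (orb θ u) := by rw [hW]; trivial
    rw [orb_apply] at *
    have h1 := DFunLike.congr_fun ((hC T).1 hT g) u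
    simp only [Module.End.mul_apply] at h1
    rw [← h1, ← hf, ← Module.End.mul_apply, ← Module.End.mul_apply, ← map_mul, ← map_mul, mul_comm]

theorem Cm_dih [Nontrivial U] (θ : F →ₐ[ℚ] Module.End ℚ U) (C : Subalgebra ℚ (Module.End ℚ U))
    (X : Module.End ℚ U) (σ : F ≃ₐ[ℚ] F) (hX : ∀ f, X * θ f = θ (σ f) * X) (hXX : X * X = 1)
    (hσ : σ ≠ 1)
    (hC : ∀ T, T ∈ C ↔ (∀ f, θ f * T = T * θ f) ∧ X * T = T * X)
    (hU : ∀ W : Submodule ℚ U, (∀ f, ∀ w ∈ W, θ f w ∈ W) → (∀ w ∈ W, X w ∈ W) → W = ⊥ ∨ W = ⊤) :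
    Nonempty (FixI σ ≃ₐ[ℚ] C) := by
  have hXf : ∀ f u, X (θ f u) = θ (σ f) (X u) := fun f u => DFunLike.congr_fun (hX f) u
  have hXXu : ∀ u, X (X u) = u := fun u => DFunLike.congr_fun hXX u
  obtain ⟨u, hu, hXu⟩ : ∃ u, u ≠ 0 ∧ X u = u := by
    by_contra hcon
    push Not at hcon
    have h1 : ∀ v, X v = -v := by
      intro v
      by_contra hv
      apply hcon (X v + v)
      · intro h; exact hv (eq_neg_of_add_eq_zero_left h)
      · rw [map_add, hXXu, add_comm]
    apply hσ
    ext f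
    obtain ⟨u, hu⟩ := exists_ne (0 : U)
    have h2 := hXf f u
    rw [h1, h1, map_neg, neg_inj] at h2
    have h3 : θ (σ f - f) u = 0 := by rw [map_sub, LinearMap.sub_apply, h2, sub_self]
    exact sub_eq_zero.1 (theta_inj θ _ u hu h3)
  have hW : LinearMap.range (orb θ u) = ⊤ := by
    refine (hU _ ?_ ?_).resolve_left ?_
    · rintro f _ ⟨g, rfl⟩
      exact ⟨f * g, by simp [orb_apply]⟩
    · rintro _ ⟨g, rfl⟩
      exact ⟨σ g, by rw [orb_apply, orb_apply, hXf, hXu]⟩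
    · intro h
      have : u ∈ LinearMap.range (orb θ u) := ⟨1, by simp [orb_apply]⟩
      rw [h] at this
      exact hu this
  refine ⟨AlgEquiv.ofBijective ((θ.comp (FixI σ).val).codRestrict C fun f => (hC _).2 ⟨fun g => by
    rw [AlgHom.comp_apply, ← map_mul, ← map_mul, mul_comm], ?_⟩) ⟨?_, ?_⟩⟩
  · rw [AlgHom.comp_apply, hX]
    congr 2
    exact mem_FixI.1 f.2
  · exact fun f g h => Subtype.ext (θ.toRingHom.injective (congrArg Subtype.val h))
  · rintro ⟨T, hT⟩
    obtain ⟨f, hf⟩ : T u ∈ LinearMap.range (orb θ u) := by rw [hW]; trivial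
    have hTf : θ f = T := by
      ext v
      obtain ⟨g, rfl⟩ : v ∈ LinearMap.range (orb θ u) := by rw [hW]; trivial
      rw [orb_apply] at *
      have h1 := DFunLike.congr_fun (((hC T).1 hT).1 g) u
      simp only [Module.End.mul_apply] at h1
      rw [← h1, ← hf, ← Module.End.mul_apply, ← Module.End.mul_apply, ← map_mul, ← map_mul, mul_comm]
    have hσf : σ f = f := by
      have h1 := DFunLike.congr_fun ((hC T).1 hT).2 u
      simp only [Module.End.mul_apply] at h1
      rw [← hTf, hXf, hXu] at h1
      have h3 : θ (σ f - f) u = 0 := by rw [map_sub, LinearMap.sub_apply, h1, sub_self]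
      exact sub_eq_zero.1 (theta_inj θ _ u hu h3)
    exact ⟨⟨f, mem_FixI.2 hσf⟩, Subtype.ext hTf⟩

theorem Cm_quat [Nontrivial U] [FiniteDimensional ℚ F] (θ : F →ₐ[ℚ] Module.End ℚ U)
    (C : Subalgebra ℚ (Module.End ℚ U))
    (X : Module.End ℚ U) (σ : F ≃ₐ[ℚ] F) (hX : ∀ f, X * θ f = θ (σ f) * X) (hXX : X * X = -1)
    (hσ : σ ≠ 1) (hn : ∀ f, σ f * f ≠ -1)
    (hC : ∀ T, T ∈ C ↔ (∀ f, θ f * T = T * θ f) ∧ X * T = T * X)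
    (hU : ∀ W : Submodule ℚ U, (∀ f, ∀ w ∈ W, θ f w ∈ W) → (∀ w ∈ W, X w ∈ W) → W = ⊥ ∨ W = ⊤) :
    Module.finrank ℚ C = 2 * Module.finrank ℚ F ∧ ∃ S T : C, S * T ≠ T * S := by
  have hXf : ∀ f u, X (θ f u) = θ (σ f) (X u) := fun f u => DFunLike.congr_fun (hX f) u
  have hXXu : ∀ u, X (X u) = -u := fun u => DFunLike.congr_fun hXX u
  obtain ⟨u, hu⟩ := exists_ne (0 : U)
  have hind : ∀ f g, θ f u + θ g (X u) = 0 → f = 0 ∧ g = 0 := by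
    intro f g h
    by_cases hg : g = 0
    · subst hg
      rw [map_zero, LinearMap.zero_apply, add_zero] at h
      exact ⟨theta_inj θ _ u hu h, rfl⟩
    · exfalso
      have h1 : X u = θ (-(g⁻¹ * f)) u := by
        have h2 := congrArg (θ g⁻¹) h
        rw [map_add, ← Module.End.mul_apply, ← Module.End.mul_apply, ← map_mul, ← map_mul,
          inv_mul_cancel₀ hg, map_one, map_zero, Module.End.one_apply] at h2
        rw [map_neg, LinearMap.neg_apply]
        exact eq_neg_of_add_eq_zero_right h2
      generalize -(g⁻¹ * f) = d at h1
      apply hn d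
      have h3 := congrArg X h1
      rw [hXXu, hXf, h1, ← Module.End.mul_apply, ← map_mul] at h3
      have h4 : θ (σ d * d + 1) u = 0 := by
        rw [map_add, LinearMap.add_apply, ← h3, map_one, Module.End.one_apply, neg_add_cancel]
      exact eq_neg_of_add_eq_zero_left (theta_inj θ _ u hu h4)
  let E : U → (F × F →ₗ[ℚ] U) := fun v => (orb θ v).coprod (orb θ (X v))
  have hE : ∀ v f g, E v (f, g) = θ f v + θ g (X v) := fun v f g => by
    simp [E, LinearMap.coprod_apply, orb_apply]
  have hEθ : ∀ v f c, θ c (E v f) = E v (c * f.1, c * f.2) := by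
    rintro v ⟨f, g⟩ c
    rw [hE, hE, map_add, map_mul, map_mul]; rfl
  have hEX : ∀ v f, X (E v f) = E v (-σ f.2, σ f.1) := by
    rintro v ⟨f, g⟩
    rw [hE, hE, map_add, hXf, hXf, hXXu, map_neg, map_neg, LinearMap.neg_apply, add_comm]
  have hinj : Function.Injective (E u) := by
    rw [← LinearMap.ker_eq_bot, LinearMap.ker_eq_bot']
    rintro ⟨f, g⟩ h
    rw [hE] at h
    obtain ⟨h1, h2⟩ := hind f g h
    rw [h1, h2]; rfl
  have hsurj : Function.Surjective (E u) := by
    rw [← LinearMap.range_eq_top]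
    refine (hU _ ?_ ?_).resolve_left ?_
    · rintro f _ ⟨g, rfl⟩
      exact ⟨_, (hEθ u g f).symm⟩
    · rintro _ ⟨g, rfl⟩
      exact ⟨_, (hEX u g).symm⟩
    · intro h
      have : u ∈ LinearMap.range (E u) := ⟨(1, 0), by rw [hE]; simp⟩
      rw [h] at this
      exact hu this
  let e : (F × F) ≃ₗ[ℚ] U := LinearEquiv.ofBijective (E u) ⟨hinj, hsurj⟩
  have he : ∀ f, e.symm (E u f) = f := fun f => e.symm_apply_apply f
  have heu : e.symm u = (1, 0) := by
    have := he (1, 0)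
    rw [hE] at this
    simpa using this
  let L : U → Module.End ℚ U := fun v => (E v).comp e.symm.toLinearMap
  have hLE : ∀ v f, L v (E u f) = E v f := fun v f => by
    change E v (e.symm (E u f)) = _
    rw [he]
  have hLu : ∀ v, L v u = v := fun v => by
    change E v (e.symm u) = _
    rw [heu, hE]; simp
  have hLC : ∀ v, L v ∈ C := by
    intro v
    rw [hC]
    constructor
    · intro f
      ext w
      obtain ⟨g, rfl⟩ := hsurj w
      rw [Module.End.mul_apply, Module.End.mul_apply, hLE, hEθ, hEθ, hLE]
    · ext w
      obtain ⟨g, rfl⟩ := hsurj w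
      rw [Module.End.mul_apply, Module.End.mul_apply, hLE, hEX, hEX, hLE]
  let ev : C →ₗ[ℚ] U := { toFun := fun T => (T : Module.End ℚ U) u
                          map_add' := by intros; rfl
                          map_smul' := by intros; rfl }
  have hev : Function.Bijective ev := by
    constructor
    · rw [← LinearMap.ker_eq_bot, LinearMap.ker_eq_bot']
      rintro ⟨T, hT⟩ (h : T u = 0)
      apply Subtype.ext
      ext w
      obtain ⟨⟨f, g⟩, rfl⟩ := hsurj w
      have h1 := DFunLike.congr_fun (((hC T).1 hT).1 f) u
      have h2 := DFunLike.congr_fun (((hC T).1 hT).1 g) (X u)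
      have h3 := DFunLike.congr_fun ((hC T).1 hT).2 u
      simp only [Module.End.mul_apply] at h1 h2 h3
      rw [hE, map_add, ← h1, ← h2, ← h3, h]
      simp
    · intro v
      exact ⟨⟨L v, hLC v⟩, hLu v⟩
  refine ⟨?_, ?_⟩
  · rw [(LinearEquiv.ofBijective ev hev).finrank_eq, ← e.finrank_eq, Module.finrank_prod, two_mul]
  · obtain ⟨f, hf⟩ : ∃ f, σ f ≠ f := by
      by_contra hcon
      push Not at hcon
      exact hσ (by ext f; exact hcon f)
    refine ⟨⟨L (θ f u), hLC _⟩, ⟨L (X u), hLC _⟩, fun h => ?_⟩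
    have h1 := DFunLike.congr_fun (congrArg Subtype.val h) u
    change L (θ f u) (L (X u) u) = L (X u) (L (θ f u) u) at h1
    rw [hLu, hLu] at h1
    have h2 : X u = E u (0, 1) := by rw [hE]; simp
    have h3 : θ f u = E u (f, 0) := by rw [hE]; simp
    rw [h2, hLE, h3, hLE, ← h2, ← h3, hE, hE, hXf] at h1
    simp only [map_zero, map_one, LinearMap.zero_apply, zero_add, add_zero, Module.End.one_apply] at h1
    have h4 : θ (σ f - f) (X u) = 0 := by rw [map_sub, LinearMap.sub_apply, h1, sub_self]
    apply hf
    refine sub_eq_zero.1 (theta_inj θ _ (X u) ?_ h4)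
    intro h0
    have := hXXu u
    rw [h0, map_zero] at this
    exact hu (neg_eq_zero.1 this.symm)

end

end Genotype

namespace Genotype

theorem cyc_fd (N : ℕ) [NeZero N] (F : Type) [Field F] [Algebra ℚ F]
    [IsCyclotomicExtension {N} ℚ F] : FiniteDimensional ℚ F :=
  IsCyclotomicExtension.finiteDimensional {N} ℚ F

theorem cyc_fr (N : ℕ) [NeZero N] (F : Type) [Field F] [Algebra ℚ F]
    [IsCyclotomicExtension {N} ℚ F] : Module.finrank ℚ F = N.totient :=
  IsCyclotomicExtension.finrank F (Polynomial.cyclotomic.irreducible_rat (NeZero.pos N))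

theorem cyc_setup (N : ℕ) [NeZero N] {S : Type} [Ring S] [Algebra ℚ S] (A : S)
    (hA : Polynomial.aeval A (Polynomial.cyclotomic N ℚ) = 0) :
    ∃ (F : Type) (_ : Field F) (_ : CharZero F) (_ : Algebra ℚ F) (_ : FiniteDimensional ℚ F)
      (_ : IsCyclotomicExtension {N} ℚ F) (ζ : F) (θ : F →ₐ[ℚ] S),
      IsPrimitiveRoot ζ N ∧ θ ζ = A ∧ Module.finrank ℚ F = N.totient := by
  have h0 : NeZero ((N : ℕ) : ℚ) := ⟨by exact_mod_cast NeZero.ne N⟩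
  have h1 : @IsCyclotomicExtension {N} ℚ (CyclotomicField N ℚ) _ _ (CyclotomicField.algebra N ℚ) :=
    CyclotomicField.isCyclotomicExtension N ℚ
  have hc : CharZero (CyclotomicField N ℚ) := inferInstance
  generalize CyclotomicField.algebra N ℚ = al at h1
  have hfd := @cyc_fd N _ (CyclotomicField N ℚ) _ al h1
  have hz := @IsCyclotomicExtension.zeta_spec N _ ℚ (CyclotomicField N ℚ) _ _ al h1
  obtain ⟨θ, hθ⟩ := @cyc_lift N _ (CyclotomicField N ℚ) _ hc al h1 S _ _ _ hz A hA
  exact ⟨CyclotomicField N ℚ, _, hc, al, hfd, h1, _, θ, hz, hθ,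
    @cyc_fr N _ (CyclotomicField N ℚ) _ al h1⟩

section
variable {R U : Type} [Group R] [AddCommGroup U] [Module ℚ U] (τ : Representation ℚ R U)
  {F : Type} [Field F] [CharZero F] [Algebra ℚ F] {N : ℕ} [NeZero N] [IsCyclotomicExtension {N} ℚ F]
  {ζ : F} (θ : F →ₐ[ℚ] Module.End ℚ U) {a : R}

theorem theta_pow (hζ : IsPrimitiveRoot ζ N) (hθ : θ ζ = τ a) (i : ℤ) : τ (a ^ i) = θ (ζ ^ i) := by
  have h0 : ζ ≠ 0 := hζ.ne_zero (NeZero.ne N)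
  have hn : ∀ n : ℕ, τ (a ^ n) = θ (ζ ^ n) := by
    intro n; rw [map_pow, map_pow, hθ]
  obtain ⟨n, rfl | rfl⟩ := i.eq_nat_or_neg
  · rw [zpow_natCast, zpow_natCast, hn]
  · have h1 : τ (a ^ (-(n : ℤ))) * θ (ζ ^ n) = 1 := by
      rw [← hn, ← map_mul, ← zpow_natCast, ← zpow_add]
      simp
    have h2 : θ (ζ ^ n) * θ (ζ ^ (-(n : ℤ))) = 1 := by
      rw [← map_mul, ← zpow_natCast, ← zpow_add₀ h0]
      simp
    exact left_inv_eq_right_inv h1 h2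

theorem theta_comm (hζ : IsPrimitiveRoot ζ N) (hθ : θ ζ = τ a) (T : Module.End ℚ U)
    (hT : τ a * T = T * τ a) (f : F) : θ f * T = T * θ f := by
  refine cyc_ind hζ (fun f => θ f * T = T * θ f) ?_ ?_ ?_ ?_ f
  · intro f g hf hg
    rw [map_add, add_mul, mul_add, hf, hg]
  · intro f g hf hg
    rw [map_mul, mul_assoc, hg, ← mul_assoc, hf, mul_assoc]
  · intro r
    rw [AlgHom.commutes]
    exact Algebra.commutes r T
  · rw [hθ]; exact hT

theorem theta_tw (hζ : IsPrimitiveRoot ζ N) (hθ : θ ζ = τ a) (X : Module.End ℚ U) (σ : F ≃ₐ[ℚ] F)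
    (hX : X * τ a = θ (σ ζ) * X) (f : F) : X * θ f = θ (σ f) * X := by
  refine cyc_ind hζ (fun f => X * θ f = θ (σ f) * X) ?_ ?_ ?_ ?_ f
  · intro f g hf hg
    rw [map_add, map_add, map_add, add_mul, mul_add, hf, hg]
  · intro f g hf hg
    rw [map_mul, map_mul, map_mul, ← mul_assoc, hf, mul_assoc, hg, mul_assoc]
  · intro r
    rw [AlgEquiv.commutes, AlgHom.commutes]
    exact (Algebra.commutes r X).symm
  · rw [hθ]; exact hX

end

section
variable {R U : Type} [Group R] [AddCommGroup U] [Module ℚ U] [FiniteDimensional ℚ U]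
  (τ : Representation ℚ R U) {a : R}

theorem inv_cyc (hτ : Irr τ) (p m : ℕ) (hp : p.Prime)
    (hA : Polynomial.aeval (τ a) (Polynomial.cyclotomic (p ^ m) ℚ) = 0)
    (hgen : ∀ g, g ∈ Subgroup.zpowers a) :
    (∀ S T : Cm τ, S * T = T * S) ∧ Module.finrank ℚ (Cm τ) = (p ^ m).totient ∧
      (p = 2 → 2 ≤ m → ∃ i : Cm τ, i * i = -1) := by
  haveI := hτ.1
  have hne : NeZero (p ^ m) := ⟨pow_ne_zero _ hp.ne_zero⟩
  obtain ⟨F, _, _, _, _, _, ζ, θ, hζ, hθ, hF⟩ := cyc_setup (p ^ m) (τ a) hA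
  obtain ⟨e⟩ := Cm_cyc θ (Cm τ) (by
    intro T
    rw [mem_Cm]
    constructor
    · intro h f
      exact theta_comm τ θ hζ hθ T (h a) f
    · intro h g
      obtain ⟨i, rfl⟩ := hgen g
      change τ (a ^ i) * T = T * τ (a ^ i)
      rw [theta_pow τ θ hζ hθ, h]) (by
    intro W hW
    apply hτ.2
    intro g w hw
    obtain ⟨i, rfl⟩ := hgen g
    change τ (a ^ i) w ∈ W
    rw [theta_pow τ θ hζ hθ]
    exact hW _ w hw)
  refine ⟨?_, ?_, ?_⟩
  · intro S T
    apply e.symm.injective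
    rw [map_mul, map_mul, mul_comm]
  · rw [← e.toLinearEquiv.finrank_eq, hF]
  · rintro rfl hm
    obtain ⟨n, rfl⟩ := Nat.exists_eq_add_of_le' hm
    refine ⟨e (ζ ^ (2 ^ n)), ?_⟩
    have h1 : IsPrimitiveRoot (ζ ^ (2 ^ n * 2)) 2 :=
      hζ.pow (by positivity) (by ring)
    rw [← map_mul, ← pow_add, ← mul_two, h1.eq_neg_one_of_two_right, map_neg, map_one]

theorem inv_two (hτ : Irr τ) (m s t : ℕ) (x : R)
    (hA : Polynomial.aeval (τ a) (Polynomial.cyclotomic (2 ^ m) ℚ) = 0)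
    (hpar : TwoPar m s t) (hg : TwoGen (2 ^ m) s t a x) :
    (s = 2 ^ m - 1 ∧ t = 0 ∧ 3 ≤ m ∧ (∀ S T : Cm τ, S * T = T * S) ∧
      Module.finrank ℚ (Cm τ) * 2 = (2 ^ m).totient ∧ Nonempty (Cm τ →+* ℝ)) ∨
    (s = 2 ^ m - 1 ∧ t = 2 ^ (m - 1) ∧ 2 ≤ m ∧ ¬ (∀ S T : Cm τ, S * T = T * S) ∧
      Module.finrank ℚ (Cm τ) = 2 * (2 ^ m).totient) ∨
    (s = 2 ^ (m - 1) - 1 ∧ t = 0 ∧ 3 ≤ m ∧ (∀ S T : Cm τ, S * T = T * S) ∧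
      Module.finrank ℚ (Cm τ) * 2 = (2 ^ m).totient ∧ IsEmpty (Cm τ →+* ℝ) ∧
      ¬ ∃ i : Cm τ, i * i = -1) := by
  haveI := hτ.1
  have hne : NeZero (2 ^ m) := ⟨by positivity⟩
  obtain ⟨F, _, _, _, _, _, ζ, θ, hζ, hθ, hF⟩ := cyc_setup (2 ^ m) (τ a) hA
  obtain ⟨q, hq, e1, e2, ⟨c, hc⟩, ⟨c', hc'⟩, -, -⟩ := hpar.arith
  obtain ⟨hm, hst⟩ := hpar
  have h0 : ζ ≠ 0 := hζ.ne_zero (NeZero.ne _)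
  have hq1 : ζ ^ (2 * q) = -1 := by
    have h1 : IsPrimitiveRoot (ζ ^ (2 * q)) 2 := hζ.pow (by positivity) (by rw [e1]; ring)
    exact h1.eq_neg_one_of_two_right
  have hcomm : τ x * τ a = θ (ζ ^ s) * τ x := by
    have := hg.comm 1
    rw [zpow_one, mul_one] at this
    rw [← map_mul, this, map_mul, theta_pow τ θ hζ hθ, zpow_natCast]
  have hXX : τ x * τ x = θ (ζ ^ t) := by
    rw [← map_mul, hg.sq, theta_pow τ θ hζ hθ, zpow_natCast]
  have hC : ∀ T, T ∈ Cm τ ↔ (∀ f, θ f * T = T * θ f) ∧ τ x * T = T * τ x := by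
    intro T
    rw [mem_Cm]
    constructor
    · intro h
      exact ⟨fun f => theta_comm τ θ hζ hθ T (h a) f, h x⟩
    · rintro ⟨h, hx⟩ g
      obtain ⟨i, rfl | rfl⟩ := hg.form g
      · rw [theta_pow τ θ hζ hθ, h]
      · rw [map_mul, theta_pow τ θ hζ hθ, mul_assoc, hx, ← mul_assoc, h, mul_assoc]
  have hU : ∀ W : Submodule ℚ U, (∀ f, ∀ w ∈ W, θ f w ∈ W) → (∀ w ∈ W, τ x w ∈ W) →
      W = ⊥ ∨ W = ⊤ := by
    intro W hW hWx
    apply hτ.2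
    intro g w hw
    obtain ⟨i, rfl | rfl⟩ := hg.form g
    · rw [theta_pow τ θ hζ hθ]
      exact hW _ w hw
    · rw [map_mul, theta_pow τ θ hζ hθ]
      exact hW _ _ (hWx w hw)
  have hne1 : s = 2 ^ m - 1 → ζ ^ s = ζ⁻¹ ∧ ∃ σ : F ≃ₐ[ℚ] F, σ ζ = ζ ^ s ∧ σ * σ = 1 ∧ σ ≠ 1 := by
    intro hs
    have h1 : ζ ^ s = ζ⁻¹ := by
      apply eq_inv_of_mul_eq_one_left
      rw [← pow_succ, hs, Nat.sub_add_cancel Nat.one_le_two_pow, hζ.pow_eq_one]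
    refine ⟨h1, ?_⟩
    obtain ⟨σ, hσ, hσ2⟩ := cycF_aut hζ s (by rw [pow_mul, h1, inv_pow, h1, inv_inv])
    refine ⟨σ, hσ, hσ2, ?_⟩
    rintro rfl
    have h2 : ζ = ζ⁻¹ := by rw [← h1, ← hσ]; rfl
    have h3 : ζ ^ 2 = 1 := by
      rw [pow_two]; nth_rw 2 [h2]; exact mul_inv_cancel₀ h0
    have h4 := Nat.le_of_dvd (by norm_num) (hζ.dvd_of_pow_eq_one 2 h3)
    omega
  rcases hst with ⟨hs, ht, hm3⟩ | ⟨hs, ht⟩ | ⟨hs, ht, hm3⟩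
  · left
    obtain ⟨h1, σ, hσ, hσ2, hσ1⟩ := hne1 hs
    obtain ⟨e⟩ := Cm_dih θ (Cm τ) (τ x) σ (theta_tw τ θ hζ hθ (τ x) σ (by rw [hσ]; exact hcomm))
      (by rw [hXX, ht, pow_zero, map_one]) hσ1 hC hU
    refine ⟨hs, ht, hm3, ?_, ?_, ?_⟩
    · intro S T
      apply e.symm.injective
      rw [map_mul, map_mul, mul_comm]
    · rw [← e.toLinearEquiv.finrank_eq, finrank_FixI hσ2 hσ1, hF]
    · obtain ⟨r⟩ := FixI_real hζ σ (by rw [hσ, h1])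
      exact ⟨r.comp e.symm.toRingEquiv.toRingHom⟩
  · right; left
    obtain ⟨h1, σ, hσ, hσ2, hσ1⟩ := hne1 hs
    obtain ⟨h3, S, T, h4⟩ := Cm_quat θ (Cm τ) (τ x) σ
      (theta_tw τ θ hζ hθ (τ x) σ (by rw [hσ]; exact hcomm))
      (by rw [hXX, ht, e2, hq1, map_neg, map_one]) hσ1
      (no_norm_neg hζ σ (by rw [hσ, h1])) hC hU
    exact ⟨hs, ht, hm, fun h => h4 (h S T), by rw [h3, hF]⟩
  · right; right
    have h1 : ζ ^ s = -ζ⁻¹ := by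
      have : ζ ^ s * ζ = -1 := by
        rw [← pow_succ, hs, Nat.sub_add_cancel Nat.one_le_two_pow, e2, hq1]
      field_simp
      exact this
    obtain ⟨σ, hσ, hσ2⟩ := cycF_aut hζ s (by
      rw [pow_mul, h1, Odd.neg_pow ⟨c', hc'⟩, inv_pow, h1, inv_neg, inv_inv, neg_neg])
    have hσ1 : σ ≠ 1 := by
      rintro rfl
      have h2 : ζ = -ζ⁻¹ := by rw [← h1, ← hσ]; rfl
      have h3 : ζ ^ 2 = -1 := by
        rw [pow_two]; nth_rw 2 [h2]; rw [mul_neg, mul_inv_cancel₀ h0]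
      have h5 : ζ ^ 4 = 1 := by
        rw [show 4 = 2 * 2 by rfl, pow_mul, h3]; norm_num
      have h4 := Nat.le_of_dvd (by norm_num) (hζ.dvd_of_pow_eq_one 4 h5)
      have h6 : 2 ^ 3 ≤ 2 ^ m := Nat.pow_le_pow_right (by norm_num) hm3
      omega
    obtain ⟨e⟩ := Cm_dih θ (Cm τ) (τ x) σ (theta_tw τ θ hζ hθ (τ x) σ (by rw [hσ]; exact hcomm))
      (by rw [hXX, ht, pow_zero, map_one]) hσ1 hC hU
    refine ⟨hs, ht, hm3, ?_, ?_, ?_, ?_⟩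
    · intro S T
      apply e.symm.injective
      rw [map_mul, map_mul, mul_comm]
    · rw [← e.toLinearEquiv.finrank_eq, finrank_FixI hσ2 hσ1, hF]
    · obtain ⟨n, rfl⟩ := Nat.exists_eq_add_of_le' hm3
      have := SD_noR (n := n) (σ := σ) (ζ := ζ) (by
        rw [← hq1, ← e2]; congr 1; rw [show n + 3 - 1 = n + 2 by omega]; ring) (by rw [hσ, h1])
      exact ⟨fun r => this.false (r.comp e.toRingEquiv.toRingHom)⟩
    · rintro ⟨i, hi⟩
      refine SD_noI (q := q) (σ := σ) (ζ := ζ) hq1 s c hσ hc ⟨e.symm i, ?_⟩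
      rw [← map_mul, hi, map_neg, map_one]

end

end Genotype

namespace Genotype

theorem tot_two {m : ℕ} (hm : 1 ≤ m) : (2 ^ m).totient = 2 ^ (m - 1) := by
  rw [Nat.totient_prime_pow Nat.prime_two hm]; simp

theorem compare {p m m' : ℕ} (hp : p.Prime) {R R' : Type} [Group R] [Group R'] {a : R} {a' : R'}
    (h : RD p m R a) (h' : RD p m' R' a')
    {U U' : Type} [AddCommGroup U] [Module ℚ U] [FiniteDimensional ℚ U]
    [AddCommGroup U'] [Module ℚ U'] [FiniteDimensional ℚ U']
    (τ : Representation ℚ R U) (τ' : Representation ℚ R' U') (hτ : Irr τ) (hτ' : Irr τ')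
    (hA : Polynomial.aeval (τ a) (Polynomial.cyclotomic (p ^ m) ℚ) = 0)
    (hA' : Polynomial.aeval (τ' a') (Polynomial.cyclotomic (p ^ m') ℚ) = 0)
    (e : Cm τ ≃ₐ[ℚ] Cm τ') (hm : m = 0 ↔ m' = 0) : Nonempty (R ≃* R') := by
  have hfr : Module.finrank ℚ (Cm τ) = Module.finrank ℚ (Cm τ') := e.toLinearEquiv.finrank_eq
  have hcom : (∀ S T : Cm τ, S * T = T * S) ↔ (∀ S T : Cm τ', S * T = T * S) := by
    constructor
    · intro h S T
      apply e.symm.injective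
      rw [map_mul, map_mul, h]
    · intro h S T
      apply e.injective
      rw [map_mul, map_mul, h]
  have hI : (∃ i : Cm τ, i * i = -1) ↔ (∃ i : Cm τ', i * i = -1) := by
    constructor
    · rintro ⟨i, hi⟩
      exact ⟨e i, by rw [← map_mul, hi, map_neg, map_one]⟩
    · rintro ⟨i, hi⟩
      exact ⟨e.symm i, by rw [← map_mul, hi, map_neg, map_one]⟩
  have hRe : Nonempty (Cm τ →+* ℝ) ↔ Nonempty (Cm τ' →+* ℝ) := by
    constructor
    · rintro ⟨r⟩
      exact ⟨r.comp e.symm.toRingEquiv.toRingHom⟩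
    · rintro ⟨r⟩
      exact ⟨r.comp e.toRingEquiv.toRingHom⟩
  have hIR : ∀ {S : Type} [Ring S], (∃ i : S, i * i = -1) → ¬ Nonempty (S →+* ℝ) := by
    rintro S _ ⟨i, hi⟩ ⟨r⟩
    have := congrArg r hi
    rw [map_mul, map_neg, map_one] at this
    nlinarith [mul_self_nonneg (r i)]
  have hpow : ∀ {m m' : ℕ}, 2 ^ m = 2 ^ m' → m = m' := fun h => Nat.pow_right_injective le_rfl h
  -- mixed cases are impossible
  have mixed : ∀ {C : Type} [Ring C] [Algebra ℚ C] (m m' : ℕ), 3 ≤ m' →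
      Module.finrank ℚ C = (2 ^ m).totient → (2 ≤ m → ∃ i : C, i * i = -1) →
      Module.finrank ℚ C * 2 = (2 ^ m').totient → ¬ (∃ i : C, i * i = -1) → False := by
    intro C _ _ m m' hm' h1 h2 h3 h4
    have h5 : m < 2 := by
      by_contra hcon
      exact h4 (h2 (by omega))
    rw [tot_two (by omega)] at h3
    obtain ⟨n, rfl⟩ := Nat.exists_eq_add_of_le' hm'
    rw [show n + 3 - 1 = n + 2 by omega, pow_add] at h3
    have h6 := Nat.one_le_two_pow (n := n)
    have h7 : (2 ^ m).totient = 1 := by interval_cases m <;> simp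
    omega
  rcases h.alt with hc | ⟨rfl, s, t, x, hpar, hg⟩
  · obtain ⟨c1, c2, c3⟩ := inv_cyc τ hτ p m hp hA hc
    rcases h'.alt with hc' | ⟨rfl, s', t', x', hpar', hg'⟩
    · obtain ⟨d1, d2, d3⟩ := inv_cyc τ' hτ' p m' hp hA' hc'
      rw [hfr, d2] at c2
      have hmm : m = m' := by
        rcases Nat.eq_zero_or_pos m with h0 | h0
        · rw [h0, hm.1 h0]
        · have h1 : 0 < m' := by
            rcases Nat.eq_zero_or_pos m' with h1 | h1
            · have := hm.2 h1; omega
            · exact h1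
          rw [Nat.totient_prime_pow hp h0, Nat.totient_prime_pow hp h1] at c2
          have h2 := Nat.eq_of_mul_eq_mul_right (by have := hp.two_le; omega) c2
          have h3 := Nat.pow_right_injective hp.two_le h2
          omega
      subst hmm
      obtain ⟨f, -⟩ := cyc_equiv h.ord h'.ord hc hc'
      exact ⟨f⟩
    · exfalso
      rcases inv_two τ' hτ' m' s' t' x' hA' hpar' hg' with
        ⟨d1, d2, d3, d4, d5, d6⟩ | ⟨d1, d2, d3, d4, d5⟩ | ⟨d1, d2, d3, d4, d5, d6, d7⟩
      · exact mixed (C := Cm τ') m m' d3 (hfr ▸ c2) (fun h => hI.1 (c3 rfl h)) d5 (fun h => hIR h d6)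
      · exact d4 (hcom.1 c1)
      · exact mixed (C := Cm τ') m m' d3 (hfr ▸ c2) (fun h => hI.1 (c3 rfl h)) d5 d7
  · have key := inv_two τ hτ m s t x hA hpar hg
    rcases h'.alt with hc' | ⟨-, s', t', x', hpar', hg'⟩
    · exfalso
      obtain ⟨d1, d2, d3⟩ := inv_cyc τ' hτ' 2 m' hp hA' hc'
      rcases key with
        ⟨c1, c2, c3, c4, c5, c6⟩ | ⟨c1, c2, c3, c4, c5⟩ | ⟨c1, c2, c3, c4, c5, c6, c7⟩
      · exact mixed (C := Cm τ) m' m c3 (hfr.trans d2) (fun h => hI.2 (d3 rfl h)) c5 (fun h => hIR h c6)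
      · exact c4 (hcom.2 d1)
      · exact mixed (C := Cm τ) m' m c3 (hfr.trans d2) (fun h => hI.2 (d3 rfl h)) c5 c7
    · have key' := inv_two τ' hτ' m' s' t' x' hA' hpar' hg'
      have h1 := hpar.1
      have h1' := hpar'.1
      rw [tot_two (by omega)] at key key'
      suffices hs : m = m' ∧ s = s' ∧ t = t' by
        obtain ⟨rfl, rfl, rfl⟩ := hs
        obtain ⟨f, -⟩ := twoGen_equiv hg hg'
        exact ⟨f⟩
      have hm3 : 2 ^ (m - 1) = 2 ^ (m' - 1) → m = m' := fun h => by have := hpow h; omega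
      rcases key with
        ⟨c1, c2, c3, c4, c5, c6⟩ | ⟨c1, c2, c3, c4, c5⟩ | ⟨c1, c2, c3, c4, c5, c6, c7⟩ <;>
      rcases key' with
        ⟨d1, d2, d3, d4, d5, d6⟩ | ⟨d1, d2, d3, d4, d5⟩ | ⟨d1, d2, d3, d4, d5, d6, d7⟩
      · have := hm3 (by rw [← c5, ← d5, hfr])
        subst this; exact ⟨rfl, by rw [c1, d1], by rw [c2, d2]⟩
      · exact absurd (hcom.1 c4) d4
      · exact absurd (hRe.1 c6) (not_nonempty_iff.2 d6)
      · exact absurd (hcom.2 d4) c4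
      · have := hm3 (by rw [c5, d5] at hfr; omega)
        subst this; exact ⟨rfl, by rw [c1, d1], by rw [c2, d2]⟩
      · exact absurd (hcom.2 d4) c4
      · exact absurd (hRe.2 d6) (not_nonempty_iff.2 c6)
      · exact absurd (hcom.1 c4) d4
      · have := hm3 (by rw [← c5, ← d5, hfr])
        subst this; exact ⟨rfl, by rw [c1, d1], by rw [c2, d2]⟩

theorem part_three {p : ℕ} (hp : p.Prime) {G : Type} [Group G] [Fintype G] (hG : IsPGroup p G)
    {k : Type} [Field k] [CharZero k] (ψ : FDRep k G) (hψ : IsIrr ψ)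
    (H : Subgroup G) (K : Subgroup H) [K.Normal] (H' : Subgroup G) (K' : Subgroup H') [K'.Normal]
    (hR : IsRoquette (H ⧸ K)) (hR' : IsRoquette (H' ⧸ K'))
    (φ : FDRep k (H ⧸ K)) (hφ : IsIrr φ) (hf : IsFaithfulRep φ)
    (ht : TightIndSub H K ψ.character φ.character)
    (φ' : FDRep k (H' ⧸ K')) (hφ' : IsIrr φ') (hf' : IsFaithfulRep φ')
    (ht' : TightIndSub H' K' ψ.character φ'.character) : Nonempty ((H ⧸ K) ≃* (H' ⧸ K')) := by
  obtain ⟨m, a, h⟩ := exists_RD hp ((hG.to_subgroup H).to_quotient K) hR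
  obtain ⟨m', a', h'⟩ := exists_RD hp ((hG.to_subgroup H').to_quotient K') hR'
  obtain ⟨V, _, _, _, σ, j, hσ, hj, hjg⟩ := exists_rat ψ.ρ hψ
  obtain ⟨U, _, _, _, τ, hτ, hA, ⟨e⟩, h0, h1⟩ :=
    rat_corner hp hG ψ hψ H K h φ hφ hf ht σ j hσ hj hjg
  obtain ⟨U', _, _, _, τ', hτ', hA', ⟨e'⟩, h0', h1'⟩ :=
    rat_corner hp hG ψ hψ H' K' h' φ' hφ' hf' ht' σ j hσ hj hjg
  refine compare hp h h' τ τ' hτ hτ' hA hA' (e.symm.trans e') ?_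
  constructor
  · intro hm
    by_contra hm'
    obtain ⟨g, hg⟩ := h1' hm'
    exact hg (h0 hm g)
  · intro hm'
    by_contra hm
    obtain ⟨g, hg⟩ := h1 hm
    exact hg (h0' hm' g)

end Genotype

namespace Genotype

/-- **The Genotype Theorem.** Every irreducible `𝕂`-linear representation `ψ` of a finite
`p`-group `G` is tightly induced from a faithful irrep `φ` of some Roquette subquotient
`H/K`; for any such subquotient the faithful irrep `φ` is unique up to isomorphism
(i.e. its character is determined); and any two such subquotients are isomorphic
as groups. -/
theorem genotype_theorem (p : ℕ) (hp : p.Prime) (G : Type) [Group G] [Fintype G]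
    (hG : IsPGroup p G) (k : Type) [Field k] [CharZero k]
    (ψ : FDRep k G) (hψ : IsIrr ψ) :
    (∃ (H : Subgroup G) (K : Subgroup H) (_ : K.Normal),
        IsRoquette (H ⧸ K) ∧
        ∃ φ : FDRep k (H ⧸ K), IsIrr φ ∧ IsFaithfulRep φ ∧
          TightIndSub H K ψ.character φ.character) ∧
    (∀ (H : Subgroup G) (K : Subgroup H) (_ : K.Normal), IsRoquette (H ⧸ K) →
      ∀ φ φ' : FDRep k (H ⧸ K),
        IsIrr φ → IsFaithfulRep φ → TightIndSub H K ψ.character φ.character →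
        IsIrr φ' → IsFaithfulRep φ' → TightIndSub H K ψ.character φ'.character →
        φ.character = φ'.character) ∧
    (∀ (H : Subgroup G) (K : Subgroup H) (_ : K.Normal)
        (H' : Subgroup G) (K' : Subgroup H') (_ : K'.Normal),
      IsRoquette (H ⧸ K) → IsRoquette (H' ⧸ K') →
      (∃ φ : FDRep k (H ⧸ K), IsIrr φ ∧ IsFaithfulRep φ ∧
          TightIndSub H K ψ.character φ.character) →
      (∃ φ' : FDRep k (H' ⧸ K'), IsIrr φ' ∧ IsFaithfulRep φ' ∧
          TightIndSub H' K' ψ.character φ'.character) →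
      Nonempty ((H ⧸ K) ≃* (H' ⧸ K'))) := by
  refine ⟨part_one ψ hψ, ?_, ?_⟩
  · intro H K hK hR φ φ' h1 h2 h3 h4 h5 h6
    exact part_two hp hG ψ H K hR φ φ' h1 h2 h3 h4 h5 h6
  · rintro H K hK H' K' hK' hR hR' ⟨φ, h1, h2, h3⟩ ⟨φ', h4, h5, h6⟩
    exact part_three hp hG ψ hψ H K H' K' hR hR' φ h1 h2 h3 φ' h4 h5 h6

end Genotype
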